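/- arXiv:2107.13246 — 5 statements merged into one kernel-verified Lean document; each statement's English description precedes it below -/
import Mathlib

section
/- Let k ≥ 1 and i ≥ 0 be integers, T > 0, and let u : [0,T) → ℝ be a C^k function. Then the limit lim_{t→0⁺} t^{−i} ∫₀^t τ^i u(τ) dτ exists, and the function v : [0,T) → ℝ defined by v(t) = t^{−i} ∫₀^t τ^i u(τ) dτ for t ∈ (0,T) and v(0) equal to this limit is C^{k+1} on [0,T). -/
open intervalIntegral

/-- The weighted average `∫₀¹ s^i u(ts) ds`. -/
noncomputable def wAvg (i : ℕ) (u : ℝ → ℝ) (t : ℝ) : ℝ := ∫ s in (0 : ℝ)..1, s ^ i * u (t * s)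

lemma wAvg_congr {i : ℕ} {u U : ℝ → ℝ} {b t : ℝ} (h : ∀ x ∈ Set.Icc 0 b, U x = u x)
    (ht : t ∈ Set.Icc 0 b) : wAvg i u t = wAvg i U t := by
  unfold wAvg
  apply intervalIntegral.integral_congr
  intro s hs
  rw [Set.uIcc_of_le zero_le_one] at hs
  have h1 : t * s ≤ t := mul_le_of_le_one_right ht.1 hs.2
  simp only
  rw [h (t * s) ⟨mul_nonneg ht.1 hs.1, h1.trans ht.2⟩]

lemma wAvg_continuous (i : ℕ) {u : ℝ → ℝ} (hu : Continuous u) : Continuous (wAvg i u) := by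
  unfold wAvg
  apply intervalIntegral.continuous_parametric_intervalIntegral_of_continuous'
  fun_prop

lemma Ico_mem_nhdsWithin_aux {t b T : ℝ} (htb : t < b) :
    Set.Icc 0 b ∈ nhdsWithin t (Set.Ico 0 T) := by
  have : Set.Iio b ∈ nhdsWithin t (Set.Ico 0 T) := nhdsWithin_le_nhds (Iio_mem_nhds htb)
  filter_upwards [this, self_mem_nhdsWithin] with x hx hx'
  exact ⟨hx'.1, le_of_lt hx⟩

lemma ext_cont {T b : ℝ} (hb0 : 0 ≤ b) (hbT : b < T) {u : ℝ → ℝ}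
    (hu : ContinuousOn u (Set.Ico 0 T)) :
    ∃ (U : ℝ → ℝ) (C : ℝ), Continuous U ∧ (∀ x ∈ Set.Icc 0 b, U x = u x) ∧ ∀ x, |U x| ≤ C := by
  have hc : ContinuousOn u (Set.Icc 0 b) := hu.mono (fun x hx => ⟨hx.1, hx.2.trans_lt hbT⟩)
  obtain ⟨C, hC⟩ := isCompact_Icc.exists_bound_of_continuousOn hc
  refine ⟨Set.IccExtend hb0 ((Set.Icc 0 b).domRestrict u), C, ?_, ?_, ?_⟩
  · exact (continuousOn_iff_continuous_domRestrict.1 hc).Icc_extend'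
  · intro x hx
    rw [Set.IccExtend_of_mem _ _ hx]; rfl
  · intro x
    exact hC _ (Set.projIcc 0 b hb0 x).2

lemma wAvg_continuousOn (i : ℕ) {T : ℝ} {u : ℝ → ℝ} (hu : ContinuousOn u (Set.Ico 0 T)) :
    ContinuousOn (wAvg i u) (Set.Ico 0 T) := by
  intro t ht
  obtain ⟨b, htb, hbT⟩ := exists_between ht.2
  obtain ⟨U, C, hU, hUu, -⟩ := ext_cont (ht.1.trans htb.le) hbT hu
  refine ((wAvg_continuous i hU).continuousWithinAt).congr_of_eventuallyEq ?_
    (wAvg_congr hUu ⟨ht.1, htb.le⟩)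
  filter_upwards [Ico_mem_nhdsWithin_aux htb] with x hx
  exact wAvg_congr hUu hx

lemma ext_C1 {T b : ℝ} (hb0 : 0 ≤ b) (hbT : b < T) {u u' : ℝ → ℝ}
    (hu : ∀ t ∈ Set.Ico 0 T, HasDerivWithinAt u (u' t) (Set.Ico 0 T) t)
    (hu' : ContinuousOn u' (Set.Ico 0 T)) :
    ∃ (U g : ℝ → ℝ) (C : ℝ), Continuous g ∧ (∀ x, HasDerivAt U (g x) x) ∧
      (∀ x ∈ Set.Icc 0 b, U x = u x) ∧ (∀ x ∈ Set.Icc 0 b, g x = u' x) ∧ ∀ x, |g x| ≤ C := by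
  obtain ⟨g, C, hg, hgu, hC⟩ := ext_cont hb0 hbT hu'
  refine ⟨fun t => u 0 + ∫ s in (0 : ℝ)..t, g s, g, C, hg, ?_, ?_, hgu, hC⟩
  · intro x
    exact (intervalIntegral.integral_hasDerivAt_right (hg.intervalIntegrable _ _)
      (hg.stronglyMeasurableAtFilter _ _) hg.continuousAt).const_add _
  · intro x hx
    have h : ∫ s in (0 : ℝ)..x, g s = u x - u 0 := by
      apply intervalIntegral.integral_eq_sub_of_hasDerivAt_of_le hx.1
      · intro y hy
        exact ((hu y ⟨hy.1, (hy.2.trans hx.2).trans_lt hbT⟩).continuousWithinAt).mono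
          (fun z hz => ⟨hz.1, (hz.2.trans hx.2).trans_lt hbT⟩)
      · intro y hy
        have hyT : y < T := (hy.2.le.trans hx.2).trans_lt hbT
        rw [hgu y ⟨hy.1.le, hy.2.le.trans hx.2⟩]
        exact (hu y ⟨hy.1.le, hyT⟩).hasDerivAt (Ico_mem_nhds hy.1 hyT)
      · exact hg.intervalIntegrable _ _
    simp only [h]; ring

lemma wAvg_hasDerivAt (i : ℕ) {U g : ℝ → ℝ} {C : ℝ} (hg : Continuous g)
    (hU : ∀ x, HasDerivAt U (g x) x) (hC : ∀ x, |g x| ≤ C) (t : ℝ) :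
    HasDerivAt (wAvg i U) (wAvg (i + 1) g t) t := by
  have hUc : Continuous U := continuous_iff_continuousAt.2 fun x => (hU x).continuousAt
  unfold wAvg
  refine (intervalIntegral.hasDerivAt_integral_of_dominated_loc_of_deriv_le
    (F := fun t s => s ^ i * U (t * s)) (F' := fun t s => s ^ (i + 1) * g (t * s))
    (bound := fun _ => C) (s := Set.univ) Filter.univ_mem ?_ ?_ ?_ ?_ ?_ ?_).2
  · exact Filter.Eventually.of_forall fun x =>
      (by fun_prop : Continuous fun s => s ^ i * U (x * s)).aestronglyMeasurable
  · exact (by fun_prop : Continuous fun s => s ^ i * U (t * s)).intervalIntegrable _ _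
  · exact (by fun_prop : Continuous fun s => s ^ (i + 1) * g (t * s)).aestronglyMeasurable
  · refine Filter.Eventually.of_forall fun s hs x _ => ?_
    rw [Set.uIoc_of_le zero_le_one] at hs
    rw [Real.norm_eq_abs, abs_mul, abs_of_nonneg (pow_nonneg hs.1.le _)]
    have h1 : s ^ (i + 1) ≤ 1 := pow_le_one₀ hs.1.le hs.2
    calc s ^ (i + 1) * |g (x * s)| ≤ 1 * |g (x * s)| := by gcongr
      _ ≤ C := by rw [one_mul]; exact hC _
  · exact intervalIntegrable_const
  · refine Filter.Eventually.of_forall fun s hs x _ => ?_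
    have h := ((hU (x * s)).comp x ((hasDerivAt_id x).mul_const s)).const_mul (s ^ i)
    refine h.congr_deriv ?_
    simp
    ring

lemma wAvg_hasDerivWithinAt (i : ℕ) {T : ℝ} {u u' : ℝ → ℝ}
    (hu : ∀ t ∈ Set.Ico 0 T, HasDerivWithinAt u (u' t) (Set.Ico 0 T) t)
    (hu' : ContinuousOn u' (Set.Ico 0 T)) {t : ℝ} (ht : t ∈ Set.Ico 0 T) :
    HasDerivWithinAt (wAvg i u) (wAvg (i + 1) u' t) (Set.Ico 0 T) t ∧
      t * wAvg (i + 1) u' t + (i + 1) * wAvg i u t = u t := by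
  obtain ⟨b, htb, hbT⟩ := exists_between ht.2
  obtain ⟨U, g, C, hg, hU, hUu, hgu, hC⟩ := ext_C1 (ht.1.trans htb.le) hbT hu hu'
  have htb' : t ∈ Set.Icc 0 b := ⟨ht.1, htb.le⟩
  rw [wAvg_congr hgu htb']
  constructor
  · refine ((wAvg_hasDerivAt i hg hU hC t).hasDerivWithinAt).congr_of_eventuallyEq ?_
      (wAvg_congr hUu htb')
    filter_upwards [Ico_mem_nhdsWithin_aux htb] with x hx
    exact wAvg_congr hUu hx
  · have hUc : Continuous U := continuous_iff_continuousAt.2 fun x => (hU x).continuousAt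
    rw [wAvg_congr hUu htb', ← hUu t htb']
    unfold wAvg
    rw [← intervalIntegral.integral_const_mul, ← intervalIntegral.integral_const_mul,
      ← intervalIntegral.integral_add]
    · rw [intervalIntegral.integral_eq_sub_of_hasDerivAt (f := fun s => s ^ (i + 1) * U (t * s))]
      · simp
      · intro s _
        have h := (hasDerivAt_pow (i + 1) s).mul
          ((hU (t * s)).comp s ((hasDerivAt_id s).const_mul t))
        refine h.congr_deriv ?_
        simp
        ring
      · exact Continuous.intervalIntegrable (by fun_prop) _ _
    · exact Continuous.intervalIntegrable (by fun_prop) _ _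
    · exact Continuous.intervalIntegrable (by fun_prop) _ _

lemma contDiffOn_succ_aux {T : ℝ} {n : ℕ} {f f' : ℝ → ℝ}
    (hf : ∀ t ∈ Set.Ico 0 T, HasDerivWithinAt f (f' t) (Set.Ico 0 T) t)
    (hf' : ContDiffOn ℝ (n : ℕ∞) f' (Set.Ico 0 T)) :
    ContDiffOn ℝ ((n + 1 : ℕ) : ℕ∞) f (Set.Ico 0 T) := by
  have hun : UniqueDiffOn ℝ (Set.Ico 0 T) := uniqueDiffOn_Ico 0 T
  have : (((n + 1 : ℕ) : ℕ∞) : WithTop ℕ∞) = ((n : ℕ∞) : WithTop ℕ∞) + 1 := by push_cast; rfl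
  rw [this, contDiffOn_succ_iff_derivWithin hun]
  refine ⟨fun t ht => (hf t ht).differentiableWithinAt, by simp, hf'.congr fun t ht => ?_⟩
  exact (hf t ht).derivWithin (hun t ht)

lemma contDiffOn_succ_deriv {T : ℝ} {n : ℕ} {f : ℝ → ℝ}
    (hf : ContDiffOn ℝ ((n + 1 : ℕ) : ℕ∞) f (Set.Ico 0 T)) :
    (∀ t ∈ Set.Ico 0 T,
      HasDerivWithinAt f (derivWithin f (Set.Ico 0 T) t) (Set.Ico 0 T) t) ∧
    ContDiffOn ℝ (n : ℕ∞) (derivWithin f (Set.Ico 0 T)) (Set.Ico 0 T) := by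
  have hun : UniqueDiffOn ℝ (Set.Ico 0 T) := uniqueDiffOn_Ico 0 T
  have : (((n + 1 : ℕ) : ℕ∞) : WithTop ℕ∞) = ((n : ℕ∞) : WithTop ℕ∞) + 1 := by push_cast; rfl
  rw [this, contDiffOn_succ_iff_derivWithin hun] at hf
  exact ⟨fun t ht => (hf.1 t ht).hasDerivWithinAt, hf.2.2⟩

lemma wAvg_contDiffOn {T : ℝ} (k : ℕ) : ∀ (i : ℕ) (u : ℝ → ℝ),
    ContDiffOn ℝ (k : ℕ∞) u (Set.Ico 0 T) → ContDiffOn ℝ (k : ℕ∞) (wAvg i u) (Set.Ico 0 T) := by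
  induction k with
  | zero =>
    intro i u hu
    exact contDiffOn_zero.2 (wAvg_continuousOn i hu.continuousOn)
  | succ n ih =>
    intro i u hu
    obtain ⟨h1, h2⟩ := contDiffOn_succ_deriv hu
    exact contDiffOn_succ_aux
      (fun t ht => (wAvg_hasDerivWithinAt i h1 h2.continuousOn ht).1) (ih _ _ h2)

lemma wAvg_eq (i : ℕ) (u : ℝ → ℝ) {t : ℝ} (ht : 0 < t) :
    (∫ τ in (0 : ℝ)..t, τ ^ i * u τ) / t ^ i = t * wAvg i u t := by
  have h := intervalIntegral.mul_integral_comp_mul_left (a := 0) (b := 1)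
    (f := fun τ => τ ^ i * u τ) t
  simp only [mul_zero, mul_one] at h
  rw [← h, wAvg]
  have h2 : ∫ s in (0 : ℝ)..1, (t * s) ^ i * u (t * s)
      = t ^ i * ∫ s in (0 : ℝ)..1, s ^ i * u (t * s) := by
    rw [← intervalIntegral.integral_const_mul]
    congr 1; ext s; ring
  rw [h2]
  field_simp

/-- Lemma on the weighted integral average.
Let `k ≥ 1` and `i ≥ 0` be integers, `T > 0`, and let `u : [0,T) → ℝ` be `C^k`.
Then `lim_{t→0⁺} t⁻ⁱ ∫₀ᵗ τ^i u(τ) dτ` exists, and the function `v` defined by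
`v t = t⁻ⁱ ∫₀ᵗ τ^i u(τ) dτ` for `t ∈ (0,T)` and `v 0` equal to this limit is `C^{k+1}`
on `[0,T)`. -/
theorem stmt_1 (k : ℕ) (hk : 1 ≤ k) (i : ℕ) (T : ℝ) (hT : 0 < T) (u : ℝ → ℝ)
    (hu : ContDiffOn ℝ (k : ℕ∞) u (Set.Ico 0 T)) :
    ∃ L : ℝ,
      Filter.Tendsto (fun t => (∫ τ in (0 : ℝ)..t, τ ^ i * u τ) / t ^ i)
        (nhdsWithin 0 (Set.Ioi 0)) (nhds L) ∧
      ∀ v : ℝ → ℝ,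
        (∀ t ∈ Set.Ioo (0 : ℝ) T, v t = (∫ τ in (0 : ℝ)..t, τ ^ i * u τ) / t ^ i) →
        v 0 = L →
        ContDiffOn ℝ ((k + 1 : ℕ) : ℕ∞) v (Set.Ico 0 T) := by
  have hw := wAvg_contDiffOn k i u hu
  refine ⟨0, ?_, ?_⟩
  · have hc : ContinuousWithinAt (fun t => t * wAvg i u t) (Set.Ico 0 T) 0 :=
      continuousWithinAt_id.mul (hw.continuousOn 0 ⟨le_rfl, hT⟩)
    have h1 : Filter.Tendsto (fun t => t * wAvg i u t) (nhdsWithin 0 (Set.Ioi 0)) (nhds 0) := by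
      have h2 := hc.mono (Set.Ioo_subset_Ico_self (a := 0) (b := T))
      rw [ContinuousWithinAt, nhdsWithin_Ioo_eq_nhdsGT hT, zero_mul] at h2
      exact h2
    refine h1.congr' ?_
    filter_upwards [self_mem_nhdsWithin] with t ht
    exact (wAvg_eq i u ht).symm
  · intro v hv hv0
    obtain ⟨n, rfl⟩ : ∃ n, k = n + 1 := ⟨k - 1, by omega⟩
    obtain ⟨h1, h2⟩ := contDiffOn_succ_deriv hu
    have key : ContDiffOn ℝ ((n + 1 + 1 : ℕ) : ℕ∞) (fun t => t * wAvg i u t) (Set.Ico 0 T) := by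
      apply contDiffOn_succ_aux (f' := fun t => u t - i * wAvg i u t)
      · intro t ht
        obtain ⟨h3, h4⟩ := wAvg_hasDerivWithinAt i h1 h2.continuousOn ht
        have h5 := (hasDerivWithinAt_id t (Set.Ico 0 T)).mul h3
        refine h5.congr_deriv ?_
        rw [← h4]
        simp
        ring
      · exact hu.sub (contDiffOn_const.mul hw)
    refine key.congr fun t ht => ?_
    rcases ht.1.eq_or_lt with h0 | h0
    · rw [← h0, hv0]; simp
    · rw [hv t ⟨h0, ht.2⟩, wAvg_eq i u h0]
end

section
/- Let T > 0 and let k ≥ 0 be an integer. Let S₁, S₂ : [0,T] → ℝ be functions such that S₁ and the function t ↦ t·S₂(t) are C^k on [0,T]. Then there exist unique C^{k+2} functions s₁, s₂ : [0,T] → ℝ satisfying, for all t ∈ (0,T], the equations s₁''(t) − s₁'(t)/t = t·S₁(t) and s₂''(t) + s₂'(t)/t − s₂(t)/t² = t·S₂(t), together with the conditions s₁(0) = s₁'(0) = s₁''(0) = 0 and s₂(0) = s₂'(0) = 0. Moreover, there is a constant C > 0, independent of S₁, S₂ and T, such that for i = 1,2, sup_{t∈(0,T]} ( |s_i(t)|/t²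 + |s_i'(t)|/t ) ≤ C·T·sup_{t∈(0,T]} |S_i(t)|. -/
/-- A solution of the first singular linear initial-value problem
`s'' - s'/t = t·S(t)` on `(0,T]` with `s(0) = s'(0) = s''(0) = 0`, of class `C^{k+2}`
on `[0,T]` (derivatives at the endpoints are one-sided, i.e. taken within `[0,T]`). -/
def SolLin₁ (T : ℝ) (k : ℕ) (S s : ℝ → ℝ) : Prop :=
  ContDiffOn ℝ ((k + 2 : ℕ) : ℕ∞) s (Set.Icc 0 T) ∧
  (∀ t ∈ Set.Ioc (0 : ℝ) T,
    derivWithin (derivWithin s (Set.Icc 0 T)) (Set.Icc 0 T) t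
      - derivWithin s (Set.Icc 0 T) t / t = t * S t) ∧
  s 0 = 0 ∧ derivWithin s (Set.Icc 0 T) 0 = 0 ∧
  derivWithin (derivWithin s (Set.Icc 0 T)) (Set.Icc 0 T) 0 = 0

/-- A solution of the second singular linear initial-value problem
`s'' + s'/t - s/t² = t·S(t)` on `(0,T]` with `s(0) = s'(0) = 0`, of class `C^{k+2}`
on `[0,T]`. -/
def SolLin₂ (T : ℝ) (k : ℕ) (S s : ℝ → ℝ) : Prop :=
  ContDiffOn ℝ ((k + 2 : ℕ) : ℕ∞) s (Set.Icc 0 T) ∧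
  (∀ t ∈ Set.Ioc (0 : ℝ) T,
    derivWithin (derivWithin s (Set.Icc 0 T)) (Set.Icc 0 T) t
      + derivWithin s (Set.Icc 0 T) t / t - s t / t ^ 2 = t * S t) ∧
  s 0 = 0 ∧ derivWithin s (Set.Icc 0 T) 0 = 0


theorem aux_prim {g : ℝ → ℝ} (hg : Continuous g) (t : ℝ) :
    HasDerivAt (fun x => ∫ u in (0:ℝ)..x, g u) (g t) t :=
  intervalIntegral.integral_hasDerivAt_right (hg.intervalIntegrable _ _)
    (hg.stronglyMeasurableAtFilter _ _) hg.continuousAt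

theorem aux_contDiff_succ {n : ℕ} {f f' : ℝ → ℝ} (h : ∀ t, HasDerivAt f (f' t) t)
    (hf' : ContDiff ℝ (n : ℕ∞) f') : ContDiff ℝ ((n + 1 : ℕ) : ℕ∞) f := by
  have e : deriv f = f' := funext fun t => (h t).deriv
  have : ContDiff ℝ ((n : ℕ∞) + 1) f := by
    rw [contDiff_succ_iff_deriv]
    refine ⟨fun t => (h t).differentiableAt, by simp, by rw [e]; exact hf'⟩
  exact_mod_cast this

theorem aux_ext {T : ℝ} (hT : 0 < T) (n : ℕ) : ∀ f : ℝ → ℝ,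
    ContDiffOn ℝ (n : ℕ∞) f (Set.Icc 0 T) →
    ∃ F : ℝ → ℝ, ContDiff ℝ (n : ℕ∞) F ∧ Set.EqOn F f (Set.Icc 0 T) := by
  induction n with
  | zero =>
    intro f hf
    refine ⟨Set.IccExtend hT.le ((Set.Icc 0 T).domRestrict f), ?_, ?_⟩
    · have : Continuous (Set.IccExtend hT.le ((Set.Icc 0 T).domRestrict f)) :=
        hf.continuousOn.domRestrict.Icc_extend'
      simpa [contDiff_zero] using this
    · intro t ht
      rw [Set.IccExtend_of_mem hT.le _ ht]
      rfl
  | succ n ih =>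
    intro f hf
    have hu := uniqueDiffOn_Icc hT
    have hf1 : ContDiffOn ℝ ((n : ℕ∞) + 1) f (Set.Icc 0 T) := by exact_mod_cast hf
    rw [contDiffOn_succ_iff_derivWithin hu] at hf1
    obtain ⟨G, hG, hGe⟩ := ih _ hf1.2.2
    have hd := aux_prim hG.continuous
    refine ⟨fun t => f 0 + ∫ u in (0:ℝ)..t, G u,
      aux_contDiff_succ (fun t => (hd t).const_add _) hG, ?_⟩
    intro t ht
    have hz : ∀ x ∈ Set.Icc 0 T, HasDerivWithinAt
        (fun t => f 0 + (∫ u in (0:ℝ)..t, G u) - f t) 0 (Set.Icc 0 T) x := by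
      intro x hx
      have := ((hd x).const_add (f 0)).hasDerivWithinAt.sub (hf1.1 x hx).hasDerivWithinAt
      rw [hGe hx, sub_self] at this
      exact this
    have := (convex_Icc 0 T).norm_image_sub_le_of_norm_hasDerivWithin_le hz
      (C := 0) (by simp) (Set.left_mem_Icc.2 hT.le) ht
    simp at this
    simpa using sub_eq_zero.1 this

theorem aux_const {s : Set ℝ} (hs : Convex ℝ s) {f : ℝ → ℝ}
    (h : ∀ x ∈ s, HasDerivWithinAt f 0 s x) {x y : ℝ} (hx : x ∈ s) (hy : y ∈ s) : f y = f x := by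
  have := hs.norm_image_sub_le_of_norm_hasDerivWithin_le h (C := 0) (by simp) hx hy
  simp at this
  exact sub_eq_zero.1 this

theorem aux_H_cont (m : ℕ) {G : ℝ → ℝ} (hG : Continuous G) :
    Continuous (fun t => ∫ u in (0:ℝ)..1, u ^ m * G (t * u)) := by
  apply intervalIntegral.continuous_parametric_intervalIntegral_of_continuous'
  fun_prop

theorem aux_H_deriv (m : ℕ) {G G' : ℝ → ℝ} (hG : ∀ t, HasDerivAt G (G' t) t)
    (hG' : Continuous G') (t : ℝ) :
    HasDerivAt (fun t => ∫ u in (0:ℝ)..1, u ^ m * G (t * u))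
      (∫ u in (0:ℝ)..1, u ^ (m + 1) * G' (t * u)) t := by
  have hGc : Continuous G := continuous_iff_continuousAt.2 fun t => (hG t).continuousAt
  obtain ⟨B, hB⟩ := (isCompact_Icc (a := -(|t| + 1)) (b := |t| + 1)).exists_bound_of_continuousOn
    hG'.continuousOn
  refine (intervalIntegral.hasDerivAt_integral_of_dominated_loc_of_deriv_le
    (F := fun t u => u ^ m * G (t * u)) (F' := fun t u => u ^ (m + 1) * G' (t * u))
    (bound := fun _ => B) (Metric.ball_mem_nhds t one_pos) ?_ ?_ ?_ ?_ ?_ ?_).2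
  · exact Filter.Eventually.of_forall fun x =>
      (by fun_prop : Continuous fun u => u ^ m * G (x * u)).aestronglyMeasurable
  · exact (by fun_prop : Continuous fun u => u ^ m * G (t * u)).intervalIntegrable _ _
  · exact (by fun_prop : Continuous fun u => u ^ (m + 1) * G' (t * u)).aestronglyMeasurable
  · refine Filter.Eventually.of_forall fun u hu x hx => ?_
    rw [Set.uIoc_of_le zero_le_one] at hu
    have hx1 : |x| ≤ |t| + 1 := by
      have h1 : |x - t| < 1 := by simpa [Real.dist_eq] using hx
      have h2 := abs_sub_abs_le_abs_sub x t
      linarith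
    have hxu : |x * u| ≤ |t| + 1 := by
      rw [abs_mul, abs_of_pos hu.1]
      nlinarith [abs_nonneg x, hu.2]
    have hb := hB (x * u) (abs_le.1 hxu)
    have hp : |u ^ (m + 1)| ≤ 1 := by
      rw [abs_of_nonneg (pow_nonneg hu.1.le _)]
      exact pow_le_one₀ hu.1.le hu.2
    rw [norm_mul]
    calc ‖u ^ (m + 1)‖ * ‖G' (x * u)‖ ≤ 1 * ‖G' (x * u)‖ :=
          mul_le_mul_of_nonneg_right hp (norm_nonneg _)
      _ ≤ B := by rw [one_mul]; exact hb
  · exact intervalIntegrable_const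
  · refine Filter.Eventually.of_forall fun u hu x hx => ?_
    have h1 : HasDerivAt (fun x : ℝ => x * u) u x := by simpa using (hasDerivAt_id x).mul_const u
    have h2 := ((hG (x * u)).comp x h1).const_mul (u ^ m)
    exact h2.congr_deriv (by ring)

theorem aux_H_contDiff (n : ℕ) : ∀ (m : ℕ) (G : ℝ → ℝ), ContDiff ℝ (n : ℕ∞) G →
    ContDiff ℝ (n : ℕ∞) (fun t => ∫ u in (0:ℝ)..1, u ^ m * G (t * u)) := by
  induction n with
  | zero =>
    intro m G hG
    simpa [contDiff_zero] using aux_H_cont m hG.continuous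
  | succ n ih =>
    intro m G hG
    have hG1 : ContDiff ℝ ((n : ℕ∞) + 1) G := by exact_mod_cast hG
    rw [contDiff_succ_iff_deriv] at hG1
    exact aux_contDiff_succ
      (aux_H_deriv m (fun t => (hG1.1 t).hasDerivAt) hG1.2.2.continuous) (ih _ _ hG1.2.2)

theorem aux_dw {T : ℝ} (hT : 0 < T) {s p q : ℝ → ℝ} (h1 : ∀ t, HasDerivAt s (p t) t)
    (h2 : ∀ t, HasDerivAt p (q t) t) :
    (∀ t ∈ Set.Icc 0 T, derivWithin s (Set.Icc 0 T) t = p t) ∧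
    (∀ t ∈ Set.Icc 0 T, derivWithin (derivWithin s (Set.Icc 0 T)) (Set.Icc 0 T) t = q t) := by
  have hu := uniqueDiffOn_Icc hT
  have a : ∀ t ∈ Set.Icc 0 T, derivWithin s (Set.Icc 0 T) t = p t := fun t ht =>
    (h1 t).hasDerivWithinAt.derivWithin (hu t ht)
  refine ⟨a, fun t ht => ?_⟩
  rw [derivWithin_congr a (a t ht)]
  exact (h2 t).hasDerivWithinAt.derivWithin (hu t ht)

theorem aux_sol {T : ℝ} (hT : 0 < T) {k : ℕ} {s : ℝ → ℝ}
    (hs : ContDiffOn ℝ ((k + 2 : ℕ) : ℕ∞) s (Set.Icc 0 T)) :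
    (∀ t ∈ Set.Icc 0 T, HasDerivWithinAt s (derivWithin s (Set.Icc 0 T) t) (Set.Icc 0 T) t) ∧
    (∀ t ∈ Set.Icc 0 T, HasDerivWithinAt (derivWithin s (Set.Icc 0 T))
      (derivWithin (derivWithin s (Set.Icc 0 T)) (Set.Icc 0 T) t) (Set.Icc 0 T) t) := by
  have hu := uniqueDiffOn_Icc hT
  have h1 : ContDiffOn ℝ (((k + 1 : ℕ) : ℕ∞) + 1) s (Set.Icc 0 T) := by exact_mod_cast hs
  rw [contDiffOn_succ_iff_derivWithin hu] at h1
  have h2 : ContDiffOn ℝ ((k : ℕ∞) + 1) (derivWithin s (Set.Icc 0 T)) (Set.Icc 0 T) := by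
    exact_mod_cast h1.2.2
  rw [contDiffOn_succ_iff_derivWithin hu] at h2
  exact ⟨fun t ht => (h1.1 t ht).hasDerivWithinAt, fun t ht => (h2.1 t ht).hasDerivWithinAt⟩

theorem aux_lin_zero {T : ℝ} (hT : 0 < T) {d : ℝ → ℝ} {c : ℝ}
    (h : ∀ t ∈ Set.Icc 0 T, d t = c * t) (hd : HasDerivWithinAt d 0 (Set.Icc 0 T) 0) : c = 0 := by
  have h0 : (0:ℝ) ∈ Set.Icc 0 T := Set.left_mem_Icc.2 hT.le
  have h1 : HasDerivWithinAt d c (Set.Icc 0 T) 0 := by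
    have : HasDerivWithinAt (fun t => c * t) c (Set.Icc 0 T) 0 := by
      simpa using ((hasDerivAt_id (0:ℝ)).const_mul c).hasDerivWithinAt
    exact this.congr h (h 0 h0)
  exact (uniqueDiffOn_Icc hT 0 h0).eq_deriv _ h1 hd

theorem aux_uniq1 {T : ℝ} (hT : 0 < T) {d p q : ℝ → ℝ}
    (h1 : ∀ t ∈ Set.Icc 0 T, HasDerivWithinAt d (p t) (Set.Icc 0 T) t)
    (h2 : ∀ t ∈ Set.Icc 0 T, HasDerivWithinAt p (q t) (Set.Icc 0 T) t)
    (he : ∀ t ∈ Set.Ioc 0 T, q t - p t / t = 0) (d0 : d 0 = 0) (p0 : p 0 = 0) (q0 : q 0 = 0) :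
    ∀ t ∈ Set.Icc 0 T, d t = 0 := by
  have hTm : T ∈ Set.Ioc 0 T := ⟨hT, le_rfl⟩
  have h0 : (0:ℝ) ∈ Set.Icc 0 T := Set.left_mem_Icc.2 hT.le
  have hz : ∀ t ∈ Set.Ioc 0 T, HasDerivWithinAt (fun t => p t / t) 0 (Set.Ioc 0 T) t := by
    intro t ht
    have ht0 : t ≠ 0 := ht.1.ne'
    have := ((h2 t (Set.Ioc_subset_Icc_self ht)).mono Set.Ioc_subset_Icc_self).div
      (hasDerivAt_id t).hasDerivWithinAt ht0
    refine this.congr_deriv ?_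
    have e := he t ht
    simp only [id]
    field_simp at e ⊢
    linarith
  have hp : ∀ t ∈ Set.Icc 0 T, p t = (p T / T) * t := by
    intro t ht
    rcases ht.1.eq_or_lt with h | h
    · rw [← h]; simp [p0]
    · have := aux_const (convex_Ioc 0 T) hz hTm ⟨h, ht.2⟩
      rw [← this]; field_simp
  have hc : p T / T = 0 := aux_lin_zero hT hp (by simpa [q0] using h2 0 h0)
  have hp0 : ∀ t ∈ Set.Icc 0 T, p t = 0 := fun t ht => by rw [hp t ht, hc, zero_mul]
  intro t ht
  rw [aux_const (f := d) (convex_Icc 0 T) (fun x hx => by simpa [hp0 x hx] using h1 x hx) h0 ht, d0]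

theorem aux_uniq2 {T : ℝ} (hT : 0 < T) {d p q : ℝ → ℝ}
    (h1 : ∀ t ∈ Set.Icc 0 T, HasDerivWithinAt d (p t) (Set.Icc 0 T) t)
    (h2 : ∀ t ∈ Set.Icc 0 T, HasDerivWithinAt p (q t) (Set.Icc 0 T) t)
    (he : ∀ t ∈ Set.Ioc 0 T, q t + p t / t - d t / t ^ 2 = 0) (d0 : d 0 = 0) (p0 : p 0 = 0) :
    ∀ t ∈ Set.Icc 0 T, d t = 0 := by
  have hTm : T ∈ Set.Ioc 0 T := ⟨hT, le_rfl⟩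
  have h0 : (0:ℝ) ∈ Set.Icc 0 T := Set.left_mem_Icc.2 hT.le
  have hz : ∀ t ∈ Set.Ioc 0 T, HasDerivWithinAt (fun t => p t + d t / t) 0 (Set.Ioc 0 T) t := by
    intro t ht
    have ht0 : t ≠ 0 := ht.1.ne'
    have := ((h2 t (Set.Ioc_subset_Icc_self ht)).mono Set.Ioc_subset_Icc_self).add
      (((h1 t (Set.Ioc_subset_Icc_self ht)).mono Set.Ioc_subset_Icc_self).div
        (hasDerivAt_id t).hasDerivWithinAt ht0)
    refine this.congr_deriv ?_
    have e := he t ht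
    simp only [id]
    field_simp at e ⊢
    linarith
  obtain ⟨c, hc⟩ : ∃ c, c = p T + d T / T := ⟨_, rfl⟩
  have hp : ∀ t ∈ Set.Icc 0 T, t * p t + d t = c * t := by
    intro t ht
    rcases ht.1.eq_or_lt with h | h
    · rw [← h]; simp [d0]
    · have := aux_const (convex_Ioc 0 T) hz hTm ⟨h, ht.2⟩
      rw [hc, ← this]; field_simp
  have hz2 : ∀ t ∈ Set.Icc 0 T,
      HasDerivWithinAt (fun t => t * d t - c / 2 * t ^ 2) 0 (Set.Icc 0 T) t := by
    intro t ht
    have := ((hasDerivAt_id t).hasDerivWithinAt.mul (h1 t ht)).sub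
      (((hasDerivAt_pow 2 t).const_mul (c / 2)).hasDerivWithinAt)
    refine this.congr_deriv ?_
    have e := hp t ht
    simp only [id]
    norm_num
    linarith
  have hd : ∀ t ∈ Set.Icc 0 T, d t = (c / 2) * t := by
    intro t ht
    rcases ht.1.eq_or_lt with h | h
    · rw [← h]; simp [d0]
    · have := aux_const (convex_Icc 0 T) hz2 h0 ht
      simp only [zero_mul] at this
      have h3 : t * (d t - c / 2 * t) = 0 := by linarith
      rcases mul_eq_zero.1 h3 with h4 | h4
      · exact absurd h4 h.ne'
      · linarith
  have hc0 : c / 2 = 0 := aux_lin_zero hT hd (by simpa [p0] using h1 0 h0)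
  intro t ht
  rw [hd t ht, hc0, zero_mul]

theorem aux_bound {f : ℝ → ℝ} {t B : ℝ} (ht : 0 ≤ t)
    (h : ∀ u ∈ Set.Ioc 0 t, |f u| ≤ B) : |∫ u in (0:ℝ)..t, f u| ≤ B * t := by
  have := intervalIntegral.norm_integral_le_of_norm_le_const (f := f) (a := 0) (b := t) (C := B)
    (by rw [Set.uIoc_of_le ht]; exact h)
  simpa [abs_of_nonneg ht] using this

theorem aux_one {T : ℝ} (hT : 0 < T) (k : ℕ) (S : ℝ → ℝ)
    (hS : ContDiffOn ℝ (k : ℕ∞) S (Set.Icc 0 T)) :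
    ∃ s : ℝ → ℝ, SolLin₁ T k S s ∧
      (∀ s' : ℝ → ℝ, SolLin₁ T k S s' → Set.EqOn s' s (Set.Icc 0 T)) ∧
      (∀ M : ℝ, (∀ t ∈ Set.Ioc (0 : ℝ) T, |S t| ≤ M) →
            ∀ t ∈ Set.Ioc (0 : ℝ) T,
              |s t| / t ^ 2 + |derivWithin s (Set.Icc 0 T) t| / t ≤ 3 * T * M) := by
  obtain ⟨g, hg, hge⟩ := aux_ext hT k S hS
  obtain ⟨F, hFdef⟩ : ∃ F : ℝ → ℝ, F = fun t => ∫ u in (0:ℝ)..t, g u := ⟨_, rfl⟩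
  have hF : ∀ t, HasDerivAt F (g t) t := by rw [hFdef]; exact aux_prim hg.continuous
  have hFc : ContDiff ℝ ((k + 1 : ℕ) : ℕ∞) F := aux_contDiff_succ hF hg
  have hP : ContDiff ℝ ((k + 1 : ℕ) : ℕ∞) (fun t => t * F t) := contDiff_id.mul hFc
  have hP' : ∀ t, HasDerivAt (fun t => t * F t) (F t + t * g t) t := fun t => by
    exact ((hasDerivAt_id t).mul (hF t)).congr_deriv (by simp)
  have hs := aux_prim hP.continuous
  obtain ⟨s, hsdef⟩ : ∃ s : ℝ → ℝ, s = fun x => ∫ u in (0:ℝ)..x, u * F u := ⟨_, rfl⟩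
  rw [← hsdef] at hs
  obtain ⟨e1, e2⟩ := aux_dw hT hs hP'
  have h0 : (0:ℝ) ∈ Set.Icc 0 T := Set.left_mem_Icc.2 hT.le
  have hF0 : F 0 = 0 := by simp [hFdef]
  have hsol : SolLin₁ T k S s := by
    refine ⟨(aux_contDiff_succ hs hP).contDiffOn, ?_, by simp [hsdef], ?_, ?_⟩
    · intro t ht
      have ht' := Set.Ioc_subset_Icc_self ht
      have := ht.1.ne'
      rw [e1 t ht', e2 t ht', hge ht']
      field_simp
      ring
    · rw [e1 0 h0]; simp
    · rw [e2 0 h0]; simp [hF0]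
  refine ⟨s, hsol, ?_, ?_⟩
  · intro s' h' t ht
    obtain ⟨a1, a2⟩ := aux_sol hT h'.1
    obtain ⟨b1, b2⟩ := aux_sol hT hsol.1
    obtain ⟨-, c1, c2, c3, c4⟩ := h'
    obtain ⟨-, d1, d2, d3, d4⟩ := hsol
    have := aux_uniq1 hT (fun t ht => (a1 t ht).sub (b1 t ht))
      (fun t ht => (a2 t ht).sub (b2 t ht))
      (fun t ht => by
        have x := c1 t ht
        have y := d1 t ht
        rw [sub_div]; linarith) (by simp [c2, d2]) (by simp [c3, d3]) (by simp [c4, d4]) t ht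
    exact sub_eq_zero.1 this
  · intro M hM t ht
    have ht' := Set.Ioc_subset_Icc_self ht
    have hM0 : 0 ≤ M := (abs_nonneg _).trans (hM t ht)
    have bF : ∀ x ∈ Set.Icc 0 T, |F x| ≤ M * x := by
      intro x hx
      rw [hFdef]
      refine aux_bound hx.1 fun u hu => ?_
      have hu' : u ∈ Set.Ioc 0 T := ⟨hu.1, hu.2.trans hx.2⟩
      rw [hge (Set.Ioc_subset_Icc_self hu')]
      exact hM u hu'
    have bs : |s t| ≤ (M * t ^ 2) * t := by
      rw [hsdef]
      refine aux_bound ht'.1 fun u hu => ?_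
      have b := bF u ⟨hu.1.le, hu.2.trans ht.2⟩
      rw [abs_mul, abs_of_pos hu.1]
      calc u * |F u| ≤ t * (M * t) := by
            apply mul_le_mul hu.2 (b.trans (mul_le_mul_of_nonneg_left hu.2 hM0)) (abs_nonneg _) ht'.1
        _ = M * t ^ 2 := by ring
    rw [e1 t ht', abs_mul, abs_of_pos ht.1, mul_div_cancel_left₀ _ ht.1.ne']
    have q1 : |s t| / t ^ 2 ≤ M * t := by
      rw [div_le_iff₀ (pow_pos ht.1 2)]; linarith
    have q2 := bF t ht'
    have q3 := mul_le_mul_of_nonneg_left ht.2 hM0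
    have q4 := mul_nonneg hM0 hT.le
    linarith

theorem aux_two {T : ℝ} (hT : 0 < T) (k : ℕ) (S : ℝ → ℝ)
    (hS : ContDiffOn ℝ (k : ℕ∞) (fun t => t * S t) (Set.Icc 0 T)) :
    ∃ s : ℝ → ℝ, SolLin₂ T k S s ∧
      (∀ s' : ℝ → ℝ, SolLin₂ T k S s' → Set.EqOn s' s (Set.Icc 0 T)) ∧
      (∀ M : ℝ, (∀ t ∈ Set.Ioc (0 : ℝ) T, |S t| ≤ M) →
            ∀ t ∈ Set.Ioc (0 : ℝ) T,
              |s t| / t ^ 2 + |derivWithin s (Set.Icc 0 T) t| / t ≤ 3 * T * M) := by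
  obtain ⟨g, hg, hge⟩ := aux_ext hT k _ hS
  obtain ⟨G, hGdef⟩ : ∃ F : ℝ → ℝ, F = fun t => ∫ u in (0:ℝ)..t, g u := ⟨_, rfl⟩
  have hG : ∀ t, HasDerivAt G (g t) t := by rw [hGdef]; exact aux_prim hg.continuous
  have hGc : ContDiff ℝ ((k + 1 : ℕ) : ℕ∞) G := aux_contDiff_succ hG hg
  obtain ⟨H, hHdef⟩ : ∃ H : ℝ → ℝ, H = fun t => ∫ u in (0:ℝ)..1, u ^ 1 * G (t * u) := ⟨_, rfl⟩
  obtain ⟨H', hH'def⟩ : ∃ H' : ℝ → ℝ, H' = fun t => ∫ u in (0:ℝ)..1, u ^ (1 + 1) * g (t * u) :=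
    ⟨_, rfl⟩
  have hH : ∀ t, HasDerivAt H (H' t) t := by
    rw [hHdef, hH'def]; exact aux_H_deriv 1 hG hg.continuous
  have hHc : ContDiff ℝ ((k + 1 : ℕ) : ℕ∞) H := by rw [hHdef]; exact aux_H_contDiff _ 1 _ hGc
  have hG0 : G 0 = 0 := by simp [hGdef]
  have hH0 : H 0 = 0 := by simp [hHdef, hG0]
  have hkey : ∀ t, t ^ 2 * H t = ∫ u in (0:ℝ)..t, u * G u := by
    intro t
    have := intervalIntegral.mul_integral_comp_mul_left (f := fun u => u * G u) (a := 0) (b := 1) t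
    rw [mul_zero, mul_one] at this
    rw [← this, hHdef, pow_two, mul_assoc, ← intervalIntegral.integral_const_mul]
    congr 1
    apply intervalIntegral.integral_congr
    intro u _
    simp only
    ring
  have hrel : ∀ t, 2 * H t + t * H' t = G t := by
    intro t
    by_cases h : t = 0
    · subst h; simp [hG0, hH0]
    · have a := (hasDerivAt_pow 2 t).mul (hH t)
      have b := aux_prim (continuous_id.mul hGc.continuous) t
      have e : ((fun x => x ^ 2) * H) = fun x => ∫ u in (0:ℝ)..x, (fun y => id y * G y) u := by
        funext x
        exact hkey x
      rw [e] at a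
      have := a.unique b
      simp at this
      have h3 : t * (2 * H t + t * H' t - G t) = 0 := by linarith
      rcases mul_eq_zero.1 h3 with h4 | h4
      · exact absurd h4 h
      · linarith
  obtain ⟨s, hsdef⟩ : ∃ s : ℝ → ℝ, s = fun x => x * H x := ⟨_, rfl⟩
  have hs : ∀ t, HasDerivAt s (G t - H t) t := fun t => by
    have := (hasDerivAt_id t).mul (hH t)
    rw [hsdef]
    refine this.congr_deriv ?_
    simp only [id, one_mul]
    linarith [hrel t]
  have hP' : ∀ t, HasDerivAt (fun t => G t - H t) (g t - H' t) t := fun t => (hG t).sub (hH t)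
  obtain ⟨e1, e2⟩ := aux_dw hT hs hP'
  have h0 : (0:ℝ) ∈ Set.Icc 0 T := Set.left_mem_Icc.2 hT.le
  have hsol : SolLin₂ T k S s := by
    refine ⟨(aux_contDiff_succ hs (hGc.sub hHc)).contDiffOn, ?_, by simp [hsdef], ?_⟩
    · intro t ht
      have ht' := Set.Ioc_subset_Icc_self ht
      have := ht.1.ne'
      rw [e1 t ht', e2 t ht', hge ht', ← hrel t, hsdef]
      field_simp
      ring
    · rw [e1 0 h0]; simp [hG0, hH0]
  refine ⟨s, hsol, ?_, ?_⟩
  · intro s' h' t ht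
    obtain ⟨a1, a2⟩ := aux_sol hT h'.1
    obtain ⟨b1, b2⟩ := aux_sol hT hsol.1
    obtain ⟨-, c1, c2, c3⟩ := h'
    obtain ⟨-, d1, d2, d3⟩ := hsol
    have := aux_uniq2 hT (fun t ht => (a1 t ht).sub (b1 t ht))
      (fun t ht => (a2 t ht).sub (b2 t ht))
      (fun t ht => by
        have x := c1 t ht
        have y := d1 t ht
        simp only [Pi.sub_apply]
        rw [sub_div, sub_div]; linarith) (by simp [c2, d2]) (by simp [c3, d3]) t ht
    exact sub_eq_zero.1 this
  · intro M hM t ht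
    have ht' := Set.Ioc_subset_Icc_self ht
    have hM0 : 0 ≤ M := (abs_nonneg _).trans (hM t ht)
    have bG : ∀ x ∈ Set.Icc 0 T, |G x| ≤ (x * M) * x := by
      intro x hx
      rw [hGdef]
      refine aux_bound hx.1 fun u hu => ?_
      have hu' : u ∈ Set.Ioc 0 T := ⟨hu.1, hu.2.trans hx.2⟩
      rw [hge (Set.Ioc_subset_Icc_self hu')]
      simp only
      rw [abs_mul, abs_of_pos hu.1]
      exact mul_le_mul hu.2 (hM u hu') (abs_nonneg _) hx.1
    have bH : |H t| ≤ (t * M * t) * 1 := by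
      rw [hHdef]
      refine aux_bound zero_le_one fun u hu => ?_
      have hle : t * u ≤ t := mul_le_of_le_one_right ht'.1 hu.2
      have hnn : 0 ≤ t * u := mul_nonneg ht'.1 hu.1.le
      have b := bG (t * u) ⟨hnn, hle.trans ht.2⟩
      rw [abs_mul, pow_one, abs_of_pos hu.1]
      calc u * |G (t * u)| ≤ 1 * |G (t * u)| := mul_le_mul_of_nonneg_right hu.2 (abs_nonneg _)
        _ ≤ (t * u * M) * (t * u) := by rw [one_mul]; exact b
        _ ≤ t * M * t := by
          apply mul_le_mul (mul_le_mul_of_nonneg_right hle hM0) hle hnn (mul_nonneg ht'.1 hM0)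
    have q1 : |s t| / t ^ 2 ≤ M * t := by
      rw [div_le_iff₀ (pow_pos ht.1 2), hsdef, abs_mul, abs_of_pos ht.1]
      calc t * |H t| ≤ t * ((t * M * t) * 1) := mul_le_mul_of_nonneg_left bH ht'.1
        _ = M * t * t ^ 2 := by ring
    have q2 : |derivWithin s (Set.Icc 0 T) t| / t ≤ 2 * (M * t) := by
      rw [e1 t ht', div_le_iff₀ ht.1]
      have := abs_sub (G t) (H t)
      have := bG t ht'
      linarith
    have q3 := mul_le_mul_of_nonneg_left ht.2 hM0
    linarith

/-- Lemma on the singular linear ODEs.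
For `T > 0`, `k ≥ 0`, and `S₁`, `t·S₂` of class `C^k` on `[0,T]`, there exist unique
`C^{k+2}` solutions `s₁, s₂` of the two singular problems, and a constant `C > 0`
independent of `S₁`, `S₂` and `T` such that
`sup_{(0,T]} (|sᵢ|/t² + |sᵢ'|/t) ≤ C·T·sup_{(0,T]} |Sᵢ|`. -/
theorem stmt_2 :
    ∃ C : ℝ, 0 < C ∧
      ∀ (T : ℝ), 0 < T → ∀ (k : ℕ) (S₁ S₂ : ℝ → ℝ),
        ContDiffOn ℝ (k : ℕ∞) S₁ (Set.Icc 0 T) →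
        ContDiffOn ℝ (k : ℕ∞) (fun t => t * S₂ t) (Set.Icc 0 T) →
        ∃ s₁ s₂ : ℝ → ℝ, SolLin₁ T k S₁ s₁ ∧ SolLin₂ T k S₂ s₂ ∧
          (∀ s₁' : ℝ → ℝ, SolLin₁ T k S₁ s₁' → Set.EqOn s₁' s₁ (Set.Icc 0 T)) ∧
          (∀ s₂' : ℝ → ℝ, SolLin₂ T k S₂ s₂' → Set.EqOn s₂' s₂ (Set.Icc 0 T)) ∧
          (∀ M : ℝ, (∀ t ∈ Set.Ioc (0 : ℝ) T, |S₁ t| ≤ M) →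
            ∀ t ∈ Set.Ioc (0 : ℝ) T,
              |s₁ t| / t ^ 2 + |derivWithin s₁ (Set.Icc 0 T) t| / t ≤ C * T * M) ∧
          (∀ M : ℝ, (∀ t ∈ Set.Ioc (0 : ℝ) T, |S₂ t| ≤ M) →
            ∀ t ∈ Set.Ioc (0 : ℝ) T,
              |s₂ t| / t ^ 2 + |derivWithin s₂ (Set.Icc 0 T) t| / t ≤ C * T * M) := by
  refine ⟨3, by norm_num, fun T hT k S₁ S₂ h1 h2 => ?_⟩
  obtain ⟨s₁, a1, a2, a3⟩ := aux_one hT k S₁ h1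
  obtain ⟨s₂, b1, b2, b3⟩ := aux_two hT k S₂ h2
  exact ⟨s₁, s₂, a1, b1, a2, b2, a3, b3⟩
end

section
/- For every p ∈ [0,1] and all α₁, α₂ ∈ ℝ, there exist T ∈ (0,1/2] and unique C² functions l₁, l₂ : [0,T] → ℝ satisfying, on (0,T), the system (l₁'/φ₁)' = l₁·(p·l₂ + (1−p)·sin(πt/2))²/σ and (l₂'/φ₂)' = l₂·(p·l₁ − (1−p)·cos(πt/2))²/σ, together with the conditions l₁(0) = −1, l₁'(0) = 0, l₂(0) = 0, l₁''(0) = α₁, l₂'(0) = α₂ (derivatives at 0 taken one-sided). Moreover, for each fixed t ∈ (0,T], the values l₁(t), l₁'(t), l₂(t), l₂'(t) depend continuously on (α₁, α₂, p) ∈ ℝ × ℝ × [0,1]. -/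
/-- A solution on `[0,T]` of the (possibly interpolated) cross-curvature system
`(l₁'/φ₁)' = l₁ (p l₂ + (1-p) sin(πt/2))²/σ`,
`(l₂'/φ₂)' = l₂ (p l₁ - (1-p) cos(πt/2))²/σ`,
where `φ₁ = y₁/y₂`, `φ₂ = y₂/y₁`, `σ = y₁ y₂`, of class `C²` on `[0,T]`, with the
initial conditions `l₁(0) = -1`, `l₁'(0) = 0`, `l₂(0) = 0`, `l₁''(0) = α₁`,
`l₂'(0) = α₂` (one-sided derivatives at `0`). -/
def IsSolSO2 (y₁ y₂ : ℝ → ℝ) (p α₁ α₂ T : ℝ) (l₁ l₂ : ℝ → ℝ) : Prop :=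
  ContDiffOn ℝ 2 l₁ (Set.Icc 0 T) ∧ ContDiffOn ℝ 2 l₂ (Set.Icc 0 T) ∧
  (∀ t ∈ Set.Ioo (0 : ℝ) T,
    deriv (fun s => deriv l₁ s / (y₁ s / y₂ s)) t
      = l₁ t * (p * l₂ t + (1 - p) * Real.sin (Real.pi * t / 2)) ^ 2 / (y₁ t * y₂ t)) ∧
  (∀ t ∈ Set.Ioo (0 : ℝ) T,
    deriv (fun s => deriv l₂ s / (y₂ s / y₁ s)) t
      = l₂ t * (p * l₁ t - (1 - p) * Real.cos (Real.pi * t / 2)) ^ 2 / (y₁ t * y₂ t)) ∧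
  l₁ 0 = -1 ∧ derivWithin l₁ (Set.Icc 0 T) 0 = 0 ∧ l₂ 0 = 0 ∧
  derivWithin (derivWithin l₁ (Set.Icc 0 T)) (Set.Icc 0 T) 0 = α₁ ∧
  derivWithin l₂ (Set.Icc 0 T) 0 = α₂

/-- averaged integral operator -/
noncomputable def JJ (d : ℕ) (f : ℝ → ℝ) (t : ℝ) : ℝ := ∫ τ in (0:ℝ)..1, τ ^ d * f (t * τ)

lemma JJ_cont (d : ℕ) {f : ℝ → ℝ} (hf : Continuous f) : Continuous (JJ d f) := by
  unfold JJ
  apply intervalIntegral.continuous_parametric_intervalIntegral_of_continuous'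
  fun_prop

lemma JJ_zero (d : ℕ) (f : ℝ → ℝ) : JJ d f 0 = f 0 / (d + 1) := by
  simp [JJ, integral_pow]
  field_simp

lemma JJ_int (d : ℕ) (f : ℝ → ℝ) (t : ℝ) :
    t ^ (d+1) * JJ d f t = ∫ s in (0:ℝ)..t, s ^ d * f s := by
  have h := intervalIntegral.mul_integral_comp_mul_left (a := 0) (b := 1)
    (f := fun s => s ^ d * f s) (c := t)
  simp only [mul_zero, mul_one] at h
  rw [← h, JJ, pow_succ', mul_assoc, ← intervalIntegral.integral_const_mul]
  congr 1
  apply intervalIntegral.integral_congr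
  intro x _
  simp only []
  ring

lemma hasDerivAt_id_mul_zero {g : ℝ → ℝ} (hg : ContinuousAt g 0) :
    HasDerivAt (fun t => t * g t) (g 0) 0 := by
  rw [hasDerivAt_iff_tendsto_slope]
  refine (hg.tendsto.mono_left nhdsWithin_le_nhds).congr' ?_
  filter_upwards [self_mem_nhdsWithin] with t ht
  have : t ≠ 0 := ht
  simp [slope_def_field, this]

lemma JJ_deriv (d : ℕ) {f : ℝ → ℝ} (hf : Continuous f) (t : ℝ) :
    HasDerivAt (fun t => t * JJ d f t) (f t - d * JJ d f t) t := by
  by_cases ht : t = 0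
  · subst ht
    convert hasDerivAt_id_mul_zero (JJ_cont d hf).continuousAt using 1
    rw [JJ_zero]
    field_simp
    ring
  · have hI : HasDerivAt (fun t => ∫ s in (0:ℝ)..t, s ^ d * f s) (t ^ d * f t) t := by
      apply intervalIntegral.integral_hasDerivAt_right
      · apply Continuous.intervalIntegrable; fun_prop
      · apply Continuous.stronglyMeasurableAtFilter; fun_prop
      · fun_prop
    have h2 := hI.div (hasDerivAt_pow d t) (pow_ne_zero d ht)
    have hev : (fun t => t * JJ d f t) =ᶠ[nhds t]
        ((fun t => ∫ s in (0:ℝ)..t, s ^ d * f s) / fun x => x ^ d) := by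
      filter_upwards [isOpen_ne.mem_nhds ht] with s hs
      have hs : s ≠ 0 := hs
      simp only [Pi.div_apply]
      rw [← JJ_int, pow_succ]
      field_simp
    refine (h2.congr_of_eventuallyEq hev).congr_deriv ?_
    rw [← JJ_int]
    rcases d with _ | d
    · simp
    · simp only [Nat.add_sub_cancel]
      field_simp
      ring

lemma JJ_diff (d : ℕ) {f g : ℝ → ℝ} (hf : Continuous f) (hg : Continuous g) {T t C : ℝ}
    (ht : t ∈ Set.Icc 0 T) (h : ∀ s ∈ Set.Icc 0 T, |f s - g s| ≤ C) :
    |JJ d f t - JJ d g t| ≤ C := by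
  unfold JJ
  rw [← intervalIntegral.integral_sub]
  · have := intervalIntegral.norm_integral_le_of_norm_le_const (a := 0) (b := 1) (C := C)
      (f := fun τ => τ ^ d * f (t * τ) - τ ^ d * g (t * τ)) ?_
    · simpa using this
    · intro τ hτ
      rw [Set.uIoc_of_le zero_le_one] at hτ
      rw [← mul_sub, norm_mul, Real.norm_eq_abs, Real.norm_eq_abs]
      have h1 : |τ ^ d| ≤ 1 := by
        rw [abs_of_nonneg (pow_nonneg hτ.1.le _)]
        exact pow_le_one₀ hτ.1.le hτ.2
      have h2 := h (t * τ) ⟨mul_nonneg ht.1 hτ.1.le,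
        (mul_le_of_le_one_right ht.1 hτ.2).trans ht.2⟩
      calc _ ≤ 1 * |f (t*τ) - g (t * τ)| := by gcongr
        _ ≤ C := by simpa using h2
  · apply Continuous.intervalIntegrable; fun_prop
  · apply Continuous.intervalIntegrable; fun_prop

noncomputable def clampE (R : ℝ) (x : Fin 4 → ℝ) : Fin 4 → ℝ := fun i => max (-R) (min R (x i))

lemma clampE_cont (R : ℝ) : Continuous (clampE R) := by unfold clampE; fun_prop

lemma clampE_lip (R : ℝ) (x y : Fin 4 → ℝ) : ‖clampE R x - clampE R y‖ ≤ ‖x - y‖ := by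
  refine (pi_norm_le_iff_of_nonneg (norm_nonneg _)).2 fun i => ?_
  refine le_trans ?_ (norm_le_pi_norm (x - y) i)
  simp only [clampE, Pi.sub_apply, Real.norm_eq_abs]
  grind

lemma clampE_norm {R : ℝ} (hR : 0 ≤ R) (x : Fin 4 → ℝ) : ‖clampE R x‖ ≤ R := by
  refine (pi_norm_le_iff_of_nonneg hR).2 fun i => ?_
  simp only [clampE, Real.norm_eq_abs]
  grind

lemma clampE_eq {R : ℝ} {x : Fin 4 → ℝ} (hx : ‖x‖ ≤ R) : clampE R x = x := by
  funext i
  have := (norm_le_pi_norm x i).trans hx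
  rw [Real.norm_eq_abs, abs_le] at this
  simp [clampE, this.1, this.2]

lemma exist_abs (d : Fin 4 → ℕ) (F : ℝ → (Fin 4 → ℝ) → (Fin 4 → ℝ))
    (hF : Continuous (Function.uncurry F))
    (hL : ∀ R : ℝ, ∃ K : ℝ, 0 ≤ K ∧ ∀ t ∈ Set.Icc (0:ℝ) (1/2), ∀ x y : Fin 4 → ℝ,
      ‖x‖ ≤ R → ‖y‖ ≤ R → ‖F t x - F t y‖ ≤ K * ‖x - y‖) (x0 : Fin 4 → ℝ) :
    ∃ T ∈ Set.Ioc (0:ℝ) (1/2), ∃ f : ℝ → (Fin 4 → ℝ), Continuous f ∧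
      ∀ t ∈ Set.Icc 0 T, f t = F t (fun i => x0 i + t * JJ (d i) (fun s => f s i) t) := by
  set R := ‖x0‖ + 1 with hR
  have hR0 : 0 ≤ R := by positivity
  obtain ⟨K, hK0, hK⟩ := hL R
  set T : ℝ := min (1/2) (1 / (2 * (K + 1))) with hT
  have hT0 : 0 < T := by
    apply lt_min <;> positivity
  have hT2 : T ≤ 1/2 := min_le_left _ _
  have hTK : T * K ≤ 1/2 := by
    have : T ≤ 1 / (2 * (K+1)) := min_le_right _ _
    calc T * K ≤ 1 / (2 * (K+1)) * (K + 1) := by gcongr; linarith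
      _ = 1/2 := by field_simp
  let G : C(Set.Icc 0 T, Fin 4 → ℝ) → ℝ → (Fin 4 → ℝ) := fun x s =>
    F s (clampE R (Set.IccExtend hT0.le x s))
  have hG : ∀ x, Continuous (G x) := fun x => by
    have h1 : Continuous (Set.IccExtend hT0.le x) := x.continuous.Icc_extend'
    exact hF.comp (continuous_id.prodMk ((clampE_cont R).comp h1))
  have hGi : ∀ x i, Continuous (fun s => G x s i) := fun x i =>
    (continuous_apply i).comp (hG x)
  let Φ : C(Set.Icc 0 T, Fin 4 → ℝ) → C(Set.Icc 0 T, Fin 4 → ℝ) := fun x =>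
    ⟨fun t i => x0 i + t * JJ (d i) (fun s => G x s i) t, by
      refine continuous_pi fun i => ?_
      have := (JJ_cont (d i) (hGi x i))
      fun_prop⟩
  have hΦ : ContractingWith (1/2) Φ := by
    refine ⟨by rw [← NNReal.coe_lt_coe]; norm_num, LipschitzWith.of_dist_le_mul fun x y => ?_⟩
    rw [ContinuousMap.dist_le (by positivity)]
    intro t
    rw [dist_eq_norm]
    refine (pi_norm_le_iff_of_nonneg (by positivity)).2 fun i => ?_
    have hd : |JJ (d i) (fun s => G x s i) t - JJ (d i) (fun s => G y s i) t| ≤ K * dist x y := by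
      refine JJ_diff (d i) (hGi x i) (hGi y i) t.2 fun s hs => ?_
      have h1 := hK s ⟨hs.1, hs.2.trans hT2⟩ _ _ (clampE_norm hR0 (Set.IccExtend hT0.le x s))
        (clampE_norm hR0 (Set.IccExtend hT0.le y s))
      have h2 := norm_le_pi_norm (G x s - G y s) i
      have h3 := clampE_lip R (Set.IccExtend hT0.le x s) (Set.IccExtend hT0.le y s)
      have h4 : ‖Set.IccExtend hT0.le x s - Set.IccExtend hT0.le y s‖ ≤ dist x y := by
        rw [← dist_eq_norm]
        exact ContinuousMap.dist_apply_le_dist _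
      calc _ ≤ _ := h2
        _ ≤ _ := h1
        _ ≤ _ := by gcongr; exact h3.trans h4
    simp only [Φ, ContinuousMap.coe_mk, Pi.sub_apply, add_sub_add_left_eq_sub, ← mul_sub,
      norm_mul, Real.norm_eq_abs]
    rw [abs_of_nonneg t.2.1]
    calc (t:ℝ) * _ ≤ T * (K * dist x y) := by
          gcongr
          exact t.2.2
      _ = (T * K) * dist x y := by ring
      _ ≤ _ := by
        have : ((1/2 : NNReal) : ℝ) = 1/2 := by norm_num
        rw [this]; gcongr
  let x := hΦ.fixedPoint
  have hx : Φ x = x := hΦ.fixedPoint_isFixedPt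
  have hxc : Continuous (Set.IccExtend hT0.le x) := x.continuous.Icc_extend'
  have hxt : ∀ t ∈ Set.Icc 0 T, Set.IccExtend hT0.le x t =
      fun i => x0 i + t * JJ (d i) (fun s => G x s i) t := by
    intro t ht
    rw [Set.IccExtend_of_mem _ _ ht]
    conv_lhs => rw [← hx]
    rfl
  have hx00 : Set.IccExtend hT0.le x 0 = x0 := by
    rw [hxt 0 ⟨le_rfl, hT0.le⟩]; funext i; simp
  have hev : ∀ᶠ t in nhds (0:ℝ), ‖Set.IccExtend hT0.le x t‖ < R := by
    apply (hxc.norm.continuousAt).eventually_lt_const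
    simp only [hx00, hR]; linarith
  obtain ⟨r, hr, hball⟩ := Metric.eventually_nhds_iff.1 hev
  refine ⟨min T (r/2), ⟨lt_min hT0 (by positivity), (min_le_left _ _).trans hT2⟩, G x, hG x, ?_⟩
  intro t ht
  have htT : t ∈ Set.Icc 0 T := ⟨ht.1, ht.2.trans (min_le_left _ _)⟩
  have htr : t ≤ r/2 := ht.2.trans (min_le_right _ _)
  rw [← hxt t htT]
  simp only [G]
  rw [clampE_eq]
  refine (hball ?_).le
  rw [dist_zero_right, Real.norm_eq_abs, abs_of_nonneg ht.1]
  linarith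

/-- global coefficient data -/
structure CoefD (y₁ y₂ Y Y' W : ℝ → ℝ) : Prop where
  c1 : ContDiff ℝ 1 y₁
  c2 : ContDiff ℝ 1 y₂
  y2pos : ∀ t, 0 < y₂ t
  Yd : ∀ t, HasDerivAt Y (Y' t) t
  Y'c : Continuous Y'
  Wc : Continuous W
  Ypos : ∀ t, 0 < Y t
  y1 : ∀ t, y₁ t = t * Y t
  YW : ∀ t, Y t - 1 = t * W t

lemma eq_of_hasDerivAt_eq {f g f' : ℝ → ℝ} (hf : ∀ t, HasDerivAt f (f' t) t)
    (hg : ∀ t, HasDerivAt g (f' t) t) (h0 : f 0 = g 0) : f = g := by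
  funext t
  have := is_const_of_deriv_eq_zero (f := f - g)
    (fun t => ((hf t).sub (hg t)).differentiableAt)
    (fun t => by simpa using ((hf t).sub (hg t)).deriv) t 0
  simp only [Pi.sub_apply] at this
  linarith

lemma exists_coef {y₁ y₂ : ℝ → ℝ} (h1 : ContDiff ℝ 2 y₁) (h2 : ContDiff ℝ 1 y₂)
    (hp : ∀ t, 0 < y₂ t) (h0 : y₁ 0 = 0) (h0' : deriv y₁ 0 = 1)
    (ht : ∀ t, t ≠ 0 → 0 < t * y₁ t) : ∃ Y Y' W, CoefD y₁ y₂ Y Y' W := by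
  have hd1 : ContDiff ℝ 1 (deriv y₁) := by
    have : ContDiff ℝ (1+1) y₁ := by simpa [one_add_one_eq_two] using h1
    exact (contDiff_succ_iff_deriv.1 this).2.2
  have hd2 : Continuous (deriv (deriv y₁)) := hd1.continuous_deriv le_rfl
  have e1 : ∀ t, HasDerivAt y₁ (deriv y₁ t) t := fun t =>
    (h1.differentiable (by norm_num) t).hasDerivAt
  have e2 : ∀ t, HasDerivAt (deriv y₁) (deriv (deriv y₁) t) t := fun t =>
    (hd1.differentiable (by norm_num) t).hasDerivAt
  set Y' := JJ 1 (deriv (deriv y₁)) with hY'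
  set Y : ℝ → ℝ := fun t => deriv y₁ t - t * Y' t with hY
  have hY'c : Continuous Y' := JJ_cont 1 hd2
  have hYd : ∀ t, HasDerivAt Y (Y' t) t := fun t => by
    refine ((e2 t).sub (JJ_deriv 1 hd2 t)).congr_deriv ?_
    simp [hY']
  have hy1 : y₁ = fun t => t * Y t := by
    apply eq_of_hasDerivAt_eq e1
    · intro t
      refine ((hasDerivAt_id t).mul (hYd t)).congr_deriv ?_
      simp [hY]
    · simp [h0]
  have hY0 : Y 0 = 1 := by simp [hY, h0']
  have hYW : (fun t => Y t - 1) = fun t => t * JJ 0 Y' t := by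
    apply eq_of_hasDerivAt_eq (f' := Y')
    · intro t; exact (hYd t).sub_const 1
    · intro t
      simpa using JJ_deriv 0 hY'c t
    · simp [hY0]
  refine ⟨Y, Y', JJ 0 Y', h1.of_le (by norm_num), h2, hp, hYd, hY'c, JJ_cont 0 hY'c, ?_,
    fun t => congrFun hy1 t, fun t => congrFun hYW t⟩
  intro t
  by_cases h : t = 0
  · rw [h, hY0]; norm_num
  · have := ht t h
    rw [congrFun hy1 t] at this
    have h3 : 0 < t * t := mul_self_pos.2 h
    by_contra hc
    nlinarith

noncomputable def GG (z : (Fin 8 → ℝ) × ℝ × (Fin 4 → ℝ)) : Fin 4 → ℝ :=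
  ![(-1 + z.1 0 * z.2.2 1) * (z.2.1 * ((z.2.2 2 + z.2.2 3) / 2) + (1 - z.2.1) * z.1 6) ^ 2 * z.1 1,
    z.1 2 * z.2.2 0,
    - z.1 5 * z.2.2 2 + (z.1 3 * ((z.2.2 2 - z.2.2 3) / 2) + z.1 4 *
      (-2 * (z.2.1 * z.2.2 1 + (1 - z.2.1) * z.1 7) +
        z.1 0 * (z.2.1 * z.2.2 1 + (1 - z.2.1) * z.1 7) ^ 2) * ((z.2.2 2 + z.2.2 3) / 2)),
    z.1 5 * z.2.2 3 - (z.1 3 * ((z.2.2 2 - z.2.2 3) / 2) + z.1 4 *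
      (-2 * (z.2.1 * z.2.2 1 + (1 - z.2.1) * z.1 7) +
        z.1 0 * (z.2.1 * z.2.2 1 + (1 - z.2.1) * z.1 7) ^ 2) * ((z.2.2 2 + z.2.2 3) / 2))]

lemma GG_contDiff : ContDiff ℝ 1 GG := by
  rw [contDiff_pi]
  intro i
  fin_cases i <;> simp [GG] <;> fun_prop

lemma GG_lip (R : ℝ) : ∃ K : ℝ, 0 ≤ K ∧ ∀ z z', ‖z‖ ≤ R → ‖z'‖ ≤ R →
    ‖GG z - GG z'‖ ≤ K * ‖z - z'‖ := by
  obtain ⟨K, hK⟩ := GG_contDiff.contDiffOn.exists_lipschitzOnWith (s := Metric.closedBall 0 R)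
    (by norm_num) (convex_closedBall _ _) (isCompact_closedBall _ _)
  refine ⟨K, K.2, fun z z' hz hz' => ?_⟩
  have := hK.dist_le_mul z (by simpa using hz) z' (by simpa using hz')
  simpa [dist_eq_norm] using this

noncomputable def SS (t : ℝ) : ℝ := Real.pi / 2 * Real.sinc (Real.pi * t / 2)
noncomputable def CC (t : ℝ) : ℝ := 2 * t * (Real.pi / 4 * Real.sinc (Real.pi * t / 4)) ^ 2

lemma SS_eq (t : ℝ) : Real.sin (Real.pi * t / 2) = t * SS t := by
  by_cases h : t = 0
  · simp [h]
  · rw [SS, Real.sinc_of_ne_zero (by have := Real.pi_ne_zero; positivity)]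
    have := Real.pi_ne_zero
    field_simp

lemma CC_eq (t : ℝ) : Real.cos (Real.pi * t / 2) = 1 - t * CC t := by
  by_cases h : t = 0
  · simp [h]
  · rw [CC, Real.sinc_of_ne_zero (by have := Real.pi_ne_zero; positivity)]
    have h1 : Real.pi * t / 2 = 2 * (Real.pi * t / 4) := by ring
    rw [h1, Real.cos_two_mul, Real.cos_sq']
    have := Real.pi_ne_zero
    field_simp
    ring

noncomputable def cvec (y₂ Y W : ℝ → ℝ) (t : ℝ) : Fin 8 → ℝ :=
  ![t, t / (Y t * y₂ t), Y t / y₂ t, deriv y₂ t / y₂ t, 1 / Y t, W t / Y t, SS t, CC t]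

lemma cvec_cont {y₁ y₂ Y Y' W : ℝ → ℝ} (h : CoefD y₁ y₂ Y Y' W) : Continuous (cvec y₂ Y W) := by
  have h1 : Continuous Y := continuous_iff_continuousAt.2 fun t => (h.Yd t).continuousAt
  have h2 := h.c2.continuous
  have h3 : Continuous (deriv y₂) := h.c2.continuous_deriv le_rfl
  have h4 := h.Wc
  have h5 : ∀ t, Y t ≠ 0 := fun t => (h.Ypos t).ne'
  have h6 : ∀ t, y₂ t ≠ 0 := fun t => (h.y2pos t).ne'
  have h8 := Real.continuous_sinc
  rw [continuous_pi_iff]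
  intro i
  fin_cases i
  · simp [cvec]; fun_prop
  · simp [cvec]; exact continuous_id.div (h1.mul h2) fun t => mul_ne_zero (h5 t) (h6 t)
  · simp [cvec]; exact h1.div h2 h6
  · simp [cvec]; exact h3.div h2 h6
  · simp [cvec]; exact h1.inv₀ h5
  · simp [cvec]; exact h4.div h1 h5
  · simp [cvec, SS]; fun_prop
  · simp [cvec, CC]; fun_prop

lemma cvec_bdd {y₁ y₂ Y Y' W : ℝ → ℝ} (h : CoefD y₁ y₂ Y Y' W) :
    ∃ M : ℝ, ∀ t ∈ Set.Icc (0:ℝ) (1/2), ‖cvec y₂ Y W t‖ ≤ M :=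
  isCompact_Icc.exists_bound_of_continuousOn (cvec_cont h).continuousOn

def dvec : Fin 4 → ℕ := ![0, 1, 0, 2]

/-- energy lemma -/
lemma energy {E E' : ℝ → ℝ} {t C η : ℝ} (ht : 0 < t) (hη : 0 ≤ η) (hC : 0 ≤ C)
    (hE0 : ∀ s, 0 ≤ E s)
    (hc : ContinuousOn E (Set.Icc 0 t)) (hd : ∀ s ∈ Set.Ioo 0 t, HasDerivAt E (E' s) s)
    (hb : ∀ s ∈ Set.Ioo 0 t, E s ≤ 1 → E' s ≤ C * (E s + η))
    (hsm : Real.exp (C * t) * (E 0 + η) < 1) : E t + η ≤ Real.exp (C * t) * (E 0 + η) := by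
  have key : ∀ s ∈ Set.Icc 0 t, (∀ r ∈ Set.Ioo 0 s, E r ≤ 1) →
      E s + η ≤ Real.exp (C * t) * (E 0 + η) := by
    intro s hs hr
    have hanti : AntitoneOn (fun r => Real.exp (-(C * r)) * (E r + η)) (Set.Icc 0 s) := by
      have hD : ∀ r ∈ Set.Ioo 0 s, HasDerivAt (fun r => Real.exp (-(C * r)) * (E r + η))
          (Real.exp (-(C * r)) * (-(C * 1)) * (E r + η) + Real.exp (-(C * r)) * E' r) r := by
        intro r hrs
        have h1 := (((hasDerivAt_id r).const_mul C).neg).exp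
        exact h1.mul ((hd r ⟨hrs.1, hrs.2.trans_le hs.2⟩).add_const η)
      apply antitoneOn_of_deriv_nonpos (convex_Icc _ _)
      · refine ContinuousOn.mul (by fun_prop) (ContinuousOn.add ?_ continuousOn_const)
        exact hc.mono (Set.Icc_subset_Icc_right hs.2)
      · rw [interior_Icc]
        intro r hrs
        exact (hD r hrs).differentiableAt.differentiableWithinAt
      · rw [interior_Icc]
        intro r hrs
        rw [(hD r hrs).deriv]
        have := hb r ⟨hrs.1, hrs.2.trans_le hs.2⟩ (hr r hrs)
        have h2 := Real.exp_pos (-(C * r))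
        have h3 := mul_le_mul_of_nonneg_left this h2.le
        linarith
    have h4 := hanti (Set.left_mem_Icc.2 hs.1) (Set.right_mem_Icc.2 hs.1) hs.1
    simp only [mul_zero, neg_zero, Real.exp_zero, one_mul] at h4
    have h5 : E s + η ≤ Real.exp (C * s) * (E 0 + η) := by
      rw [Real.exp_neg] at h4
      rwa [inv_mul_le_iff₀ (Real.exp_pos _)] at h4
    refine h5.trans ?_
    have := hE0 0
    have := hs.2
    gcongr
  have hlt : ∀ s ∈ Set.Icc 0 t, E s < 1 := by
    by_contra! hcon
    obtain ⟨s1, hs1, hs1'⟩ := hcon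
    let A := Set.Icc 0 t ∩ E ⁻¹' Set.Ici 1
    have hA : IsClosed A := hc.preimage_isClosed_of_isClosed isClosed_Icc isClosed_Ici
    have hAne : A.Nonempty := ⟨s1, hs1, hs1'⟩
    have hAb : BddBelow A := ⟨0, fun x hx => hx.1.1⟩
    have hmem := hA.csInf_mem hAne hAb
    have := key (sInf A) hmem.1 (fun r hr => by
      by_contra! hr1
      have : sInf A ≤ r := csInf_le hAb ⟨⟨hr.1.le, hr.2.le.trans hmem.1.2⟩, hr1.le⟩
      linarith [hr.2])
    have h1 : 1 ≤ E (sInf A) := hmem.2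
    linarith
  exact key t ⟨ht.le, le_rfl⟩ fun r hr => (hlt r ⟨hr.1.le, hr.2.le⟩).le

lemma contDiffOn_two_of {f g : ℝ → ℝ} {T : ℝ} (hT : 0 < T)
    (hf : ∀ t ∈ Set.Icc 0 T, HasDerivWithinAt f (g t) (Set.Icc 0 T) t)
    (hg : ContDiff ℝ 1 g) : ContDiffOn ℝ 2 f (Set.Icc 0 T) := by
  have hu := uniqueDiffOn_Icc hT
  have : ContDiffOn ℝ (1 + 1) f (Set.Icc 0 T) := by
    rw [contDiffOn_succ_iff_derivWithin hu]
    refine ⟨fun t ht => (hf t ht).differentiableWithinAt, by simp, ?_⟩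
    refine hg.contDiffOn.congr fun t ht => ?_
    exact (hf t ht).derivWithin (hu t ht)
  simpa [one_add_one_eq_two] using this

lemma contDiff_one_of {f g : ℝ → ℝ} (hf : ∀ t, HasDerivAt f (g t) t) (hg : Continuous g) :
    ContDiff ℝ 1 f := by
  rw [contDiff_one_iff_deriv]
  refine ⟨fun t => (hf t).differentiableAt, ?_⟩
  have : deriv f = g := funext fun t => (hf t).deriv
  rwa [this]

lemma exist_sol {y₁ y₂ Y Y' W : ℝ → ℝ} (h : CoefD y₁ y₂ Y Y' W) (p α₁ α₂ : ℝ) :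
    ∃ T ∈ Set.Ioc (0:ℝ) (1/2), ∃ l₁ l₂, IsSolSO2 y₁ y₂ p α₁ α₂ T l₁ l₂ := by
  obtain ⟨M, hM⟩ := cvec_bdd h
  obtain ⟨T, hT, f, hfc, hf⟩ := exist_abs dvec (fun t x => GG (cvec y₂ Y W t, p, x))
    (by
      have := cvec_cont h
      have h2 := GG_contDiff.continuous
      simp only [Function.uncurry_def]
      fun_prop)
    (by
      intro R
      obtain ⟨K, hK0, hK⟩ := GG_lip (max M (max |p| R))
      refine ⟨K, hK0, fun t ht x y hx hy => ?_⟩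
      have := hK (cvec y₂ Y W t, p, x) (cvec y₂ Y W t, p, y)
        (by simp only [Prod.norm_mk, Real.norm_eq_abs]; exact max_le_max (hM t ht) (max_le_max le_rfl hx))
        (by simp only [Prod.norm_mk, Real.norm_eq_abs]; exact max_le_max (hM t ht) (max_le_max le_rfl hy))
      simpa using this)
    ![y₂ 0 * α₁, 0, 2 * α₂, 0]
  have hT0 := hT.1
  have hfi : ∀ i, Continuous (fun s => f s i) := fun i => (continuous_apply i).comp hfc
  set j1 := JJ 1 (fun s => f s 1) with hj1
  set j2 := JJ 2 (fun s => f s 3) with hj2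
  have hj1c : Continuous j1 := JJ_cont 1 (hfi 1)
  have hj2c : Continuous j2 := JJ_cont 2 (hfi 3)
  set u : ℝ → ℝ := fun t => y₂ 0 * α₁ + t * JJ 0 (fun s => f s 0) t with hu
  set k : ℝ → ℝ := fun t => t * j1 t with hk
  set a : ℝ → ℝ := fun t => 2 * α₂ + t * JJ 0 (fun s => f s 2) t with ha
  set b : ℝ → ℝ := fun t => t * j2 t with hb
  have du : ∀ t, HasDerivAt u (f t 0) t := fun t => by
    refine ((JJ_deriv 0 (hfi 0) t).const_add (y₂ 0 * α₁)).congr_deriv (by simp)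
  have dk : ∀ t, HasDerivAt k (f t 1 - j1 t) t := fun t => by
    refine (JJ_deriv 1 (hfi 1) t).congr_deriv (by simp [hj1])
  have da : ∀ t, HasDerivAt a (f t 2) t := fun t => by
    refine ((JJ_deriv 0 (hfi 2) t).const_add (2 * α₂)).congr_deriv (by simp)
  have db : ∀ t, HasDerivAt b (f t 3 - 2 * j2 t) t := fun t => by
    refine (JJ_deriv 2 (hfi 3) t).congr_deriv (by simp [hj2])
  have hx : ∀ t ∈ Set.Icc 0 T, f t = GG (cvec y₂ Y W t, p, ![u t, k t, a t, b t]) := by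
    intro t ht
    rw [hf t ht]
    congr 3
    funext i
    fin_cases i <;> simp [dvec, hu, hk, ha, hb, hj1, hj2]
  have uc : ContDiff ℝ 1 u := contDiff_one_of du (hfi 0)
  have ac : ContDiff ℝ 1 a := contDiff_one_of da (hfi 2)
  have bc : ContDiff ℝ 1 b := contDiff_one_of db ((hfi 3).sub (continuous_const.mul hj2c))
  have Yc : ContDiff ℝ 1 Y := contDiff_one_of h.Yd h.Y'c
  have Y0 : ∀ t, Y t ≠ 0 := fun t => (h.Ypos t).ne'
  have y20 : ∀ t, y₂ t ≠ 0 := fun t => (h.y2pos t).ne'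
  have Y00 : Y 0 = 1 := by have := h.YW 0; simp at this; linarith
  set l₁ : ℝ → ℝ := fun t => -1 + t * k t with hl1
  set l₂ : ℝ → ℝ := fun t => t * ((a t + b t) / 2) with hl2
  have f0 : ∀ t ∈ Set.Icc 0 T, f t 0 = (-1 + t * k t) * (p * ((a t + b t) / 2) + (1 - p) * SS t) ^ 2
      * (t / (Y t * y₂ t)) := fun t ht => by rw [hx t ht]; simp [GG, cvec]
  have f1 : ∀ t ∈ Set.Icc 0 T, f t 1 = Y t / y₂ t * u t := fun t ht => by
    rw [hx t ht]; simp [GG, cvec]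
  have f2 : ∀ t ∈ Set.Icc 0 T, f t 2 = - (W t / Y t) * a t + (deriv y₂ t / y₂ t * ((a t - b t) / 2)
      + 1 / Y t * (-2 * (p * k t + (1 - p) * CC t) + t * (p * k t + (1 - p) * CC t) ^ 2)
        * ((a t + b t) / 2)) := fun t ht => by rw [hx t ht]; simp [GG, cvec]
  have f3 : ∀ t ∈ Set.Icc 0 T, f t 3 = (W t / Y t) * b t - (deriv y₂ t / y₂ t * ((a t - b t) / 2)
      + 1 / Y t * (-2 * (p * k t + (1 - p) * CC t) + t * (p * k t + (1 - p) * CC t) ^ 2)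
        * ((a t + b t) / 2)) := fun t ht => by rw [hx t ht]; simp [GG, cvec]
  have dl1 : ∀ t ∈ Set.Icc 0 T, HasDerivAt l₁ (y₁ t / y₂ t * u t) t := by
    intro t ht
    refine (((hasDerivAt_id t).mul (dk t)).const_add (-1)).congr_deriv ?_
    rw [f1 t ht, h.y1 t]
    simp only [hk, id]
    have := y20 t
    field_simp
    ring
  have dl2 : ∀ t ∈ Set.Icc 0 T, HasDerivAt l₂ ((a t - b t) / (2 * Y t)) t := by
    intro t ht
    refine ((hasDerivAt_id t).mul (((da t).add (db t)).div_const 2)).congr_deriv ?_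
    rw [f2 t ht, f3 t ht]
    have e1 := h.YW t
    have e2 := Y0 t
    have e3 : b t = t * j2 t := rfl
    simp only [id, Pi.add_apply]
    have e4 : W t / Y t * t = (Y t - 1) / Y t := by rw [e1]; ring
    have e5 : (a t - b t) / (2 * Y t) = (a t - b t) / 2 * (1 - (Y t - 1) / Y t) := by
      field_simp; ring
    rw [e5, ← e4]
    linear_combination (-1 : ℝ) * e3
  have g1c : ContDiff ℝ 1 (fun t => y₁ t / y₂ t * u t) := (h.c1.div h.c2 y20).mul uc
  have g2c : ContDiff ℝ 1 (fun t => (a t - b t) / (2 * Y t)) :=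
    (ac.sub bc).div (contDiff_const.mul Yc) fun t => mul_ne_zero two_ne_zero (Y0 t)
  have hud := uniqueDiffOn_Icc hT0
  have h0m : (0:ℝ) ∈ Set.Icc 0 T := ⟨le_rfl, hT0.le⟩
  have dw1 : ∀ t ∈ Set.Icc 0 T, derivWithin l₁ (Set.Icc 0 T) t = y₁ t / y₂ t * u t :=
    fun t ht => (dl1 t ht).hasDerivWithinAt.derivWithin (hud t ht)
  have hy10 : y₁ 0 = 0 := by simp [h.y1 0]
  refine ⟨T, hT, l₁, l₂, contDiffOn_two_of hT0 (fun t ht => (dl1 t ht).hasDerivWithinAt) g1c,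
    contDiffOn_two_of hT0 (fun t ht => (dl2 t ht).hasDerivWithinAt) g2c, ?_, ?_,
    by simp [hl1], ?_, by simp [hl2], ?_, ?_⟩
  · intro t ht
    have hev : (fun s => deriv l₁ s / (y₁ s / y₂ s)) =ᶠ[nhds t] u := by
      filter_upwards [Ioo_mem_nhds ht.1 ht.2] with s hs
      rw [(dl1 s ⟨hs.1.le, hs.2.le⟩).deriv, h.y1 s]
      have := hs.1.ne'
      have := Y0 s
      have := y20 s
      field_simp
    rw [hev.deriv_eq, (du t).deriv, f0 t ⟨ht.1.le, ht.2.le⟩, SS_eq, h.y1 t]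
    simp only [hl1, hl2]
    have := ht.1.ne'
    have := Y0 t
    have := y20 t
    field_simp
  · intro t ht
    have hev : (fun s => deriv l₂ s / (y₂ s / y₁ s)) =ᶠ[nhds t]
        fun s => s * ((a s - b s) / 2) / y₂ s := by
      filter_upwards [Ioo_mem_nhds ht.1 ht.2] with s hs
      rw [(dl2 s ⟨hs.1.le, hs.2.le⟩).deriv, h.y1 s]
      have := hs.1.ne'
      have := Y0 s
      have := y20 s
      field_simp
    have dy2 : HasDerivAt y₂ (deriv y₂ t) t := (h.c2.differentiable (by norm_num) t).hasDerivAt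
    have hD := ((hasDerivAt_id t).mul (((da t).sub (db t)).div_const 2)).div dy2 (y20 t)
    have htI : t ∈ Set.Icc 0 T := ⟨ht.1.le, ht.2.le⟩
    rw [hev.deriv_eq]
    refine hD.deriv.trans ?_
    rw [f2 t htI, f3 t htI, CC_eq, h.y1 t]
    have e1 := h.YW t
    have e2 := Y0 t
    have e3 : b t = t * j2 t := rfl
    have e6 := ht.1.ne'
    have e7 := y20 t
    simp only [id, Pi.sub_apply, Pi.mul_apply, hl1, hl2]
    have e8 : j2 t = b t / t := by rw [e3]; field_simp
    have e9 : W t = (Y t - 1) / t := by rw [e1]; field_simp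
    rw [e8, e9]
    generalize j2 t = J at *
    generalize CC t = c at *
    generalize b t = B at *
    generalize a t = A at *
    generalize k t = k' at *
    generalize Y t = YY at *
    generalize deriv y₂ t = dy at *
    generalize y₂ t = yy at *
    field_simp
    ring
  · rw [dw1 0 h0m, hy10]; simp
  · have : derivWithin (derivWithin l₁ (Set.Icc 0 T)) (Set.Icc 0 T) 0 =
        derivWithin (fun t => y₁ t / y₂ t * u t) (Set.Icc 0 T) 0 :=
      derivWithin_congr (fun t ht => dw1 t ht) (dw1 0 h0m)
    rw [this]
    have hg : ContinuousAt (fun t => Y t / y₂ t * u t) 0 := by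
      exact ((Yc.continuous.div h.c2.continuous y20).mul uc.continuous).continuousAt
    have := hasDerivAt_id_mul_zero hg
    have h2 : (fun t => y₁ t / y₂ t * u t) = fun t => t * (Y t / y₂ t * u t) := by
      funext t; rw [h.y1 t]; ring
    rw [h2, this.hasDerivWithinAt.derivWithin (hud 0 h0m), Y00]
    simp only [hu]
    have := y20 0
    field_simp
    ring
  · rw [(dl2 0 h0m).hasDerivWithinAt.derivWithin (hud 0 h0m), Y00]
    simp [ha, hb]

lemma tendsto_div_of_hasDerivWithinAt {f : ℝ → ℝ} {f' T : ℝ}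
    (h : HasDerivWithinAt f f' (Set.Icc 0 T) 0) (h0 : f 0 = 0) :
    Filter.Tendsto (fun t => f t / t) (nhdsWithin 0 (Set.Ioc 0 T)) (nhds f') := by
  rw [hasDerivWithinAt_iff_tendsto_slope] at h
  have : Set.Icc 0 T \ {0} = Set.Ioc 0 T := by
    ext x; simp only [Set.mem_sdiff, Set.mem_Icc, Set.mem_singleton_iff, Set.mem_Ioc]
    constructor
    · rintro ⟨⟨h1, h2⟩, h3⟩; exact ⟨lt_of_le_of_ne h1 (Ne.symm h3), h2⟩
    · rintro ⟨h1, h2⟩; exact ⟨⟨h1.le, h2⟩, h1.ne'⟩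
  rw [this] at h
  refine h.congr fun t => ?_
  simp [slope_def_field, h0]

/-- extension by a value at zero is continuous -/
lemma continuousOn_ite_zero {g : ℝ → ℝ} {c T : ℝ} (hT : 0 < T)
    (hg : ContinuousOn g (Set.Ioc 0 T))
    (hl : Filter.Tendsto g (nhdsWithin 0 (Set.Ioc 0 T)) (nhds c)) :
    ContinuousOn (fun t => if t = 0 then c else g t) (Set.Icc 0 T) := by
  have e : Set.Icc 0 T = insert 0 (Set.Ioc 0 T) := (Set.Ioc_insert_left hT.le).symm
  intro t ht
  by_cases h0 : t = 0
  · subst h0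
    rw [e, continuousWithinAt_insert_self]
    simp only [ContinuousWithinAt, if_true]
    refine hl.congr' ?_
    filter_upwards [self_mem_nhdsWithin] with s hs
    rw [if_neg hs.1.ne']
  · have htp : 0 < t := lt_of_le_of_ne ht.1 (Ne.symm h0)
    have h1 : ContinuousWithinAt g (Set.Icc 0 T) t := by
      have := hg t ⟨htp, ht.2⟩
      rw [e]
      exact (continuousWithinAt_insert).2 this
    refine h1.congr_of_eventuallyEq ?_ (if_neg h0)
    filter_upwards [mem_nhdsWithin_of_mem_nhds (isOpen_ne.mem_nhds h0)] with s hs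
    exact if_neg hs

/-- the desingularised system -/
structure SysSol (y₂ Y W : ℝ → ℝ) (p α₁ α₂ T : ℝ) (l₁ l₂ : ℝ → ℝ) (x : ℝ → Fin 4 → ℝ) : Prop where
  cont : ∀ i, ContinuousOn (fun t => x t i) (Set.Icc 0 T)
  ival : x 0 = ![y₂ 0 * α₁, 0, 2 * α₂, 0]
  ode : ∀ t ∈ Set.Ioo 0 T, ∀ i, HasDerivAt (fun s => x s i)
    (GG (cvec y₂ Y W t, p, x t) i - dvec i / t * x t i) t
  e1 : ∀ t ∈ Set.Ioc 0 T, l₁ t = -1 + t * x t 1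
  e2 : ∀ t ∈ Set.Ioc 0 T, derivWithin l₁ (Set.Icc 0 T) t = t * Y t / y₂ t * x t 0
  e3 : ∀ t ∈ Set.Ioc 0 T, l₂ t = t * ((x t 2 + x t 3) / 2)
  e4 : ∀ t ∈ Set.Ioc 0 T, derivWithin l₂ (Set.Icc 0 T) t = (x t 2 - x t 3) / (2 * Y t)

lemma sys_of_sol {y₁ y₂ Y Y' W : ℝ → ℝ} (h : CoefD y₁ y₂ Y Y' W) {p α₁ α₂ T : ℝ} (hT : 0 < T)
    {l₁ l₂ : ℝ → ℝ} (hs : IsSolSO2 y₁ y₂ p α₁ α₂ T l₁ l₂) :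
    ∃ x, SysSol y₂ Y W p α₁ α₂ T l₁ l₂ x := by
  obtain ⟨hc1, hc2, ho1, ho2, hi1, hi2, hi3, hi4, hi5⟩ := hs
  have hud := uniqueDiffOn_Icc hT
  have Y0 : ∀ t, Y t ≠ 0 := fun t => (h.Ypos t).ne'
  have y20 : ∀ t, y₂ t ≠ 0 := fun t => (h.y2pos t).ne'
  have Y00 : Y 0 = 1 := by have := h.YW 0; simp at this; linarith
  have Yc : ContDiff ℝ 1 Y := contDiff_one_of h.Yd h.Y'c
  have h0m : (0:ℝ) ∈ Set.Icc 0 T := ⟨le_rfl, hT.le⟩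
  have hc1' : ContDiffOn ℝ (1+1) l₁ (Set.Icc 0 T) := by simpa [one_add_one_eq_two] using hc1
  have hc2' : ContDiffOn ℝ (1+1) l₂ (Set.Icc 0 T) := by simpa [one_add_one_eq_two] using hc2
  rw [contDiffOn_succ_iff_derivWithin hud] at hc1' hc2'
  set D1 := derivWithin l₁ (Set.Icc 0 T) with hD1
  set D2 := derivWithin l₂ (Set.Icc 0 T) with hD2
  obtain ⟨dl1, -, cD1⟩ := hc1'
  obtain ⟨dl2, -, cD2⟩ := hc2'
  have dD1 : DifferentiableOn ℝ D1 (Set.Icc 0 T) := cD1.differentiableOn (by norm_num)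
  have dD2 : DifferentiableOn ℝ D2 (Set.Icc 0 T) := cD2.differentiableOn (by norm_num)
  have hsub : Set.Ioc 0 T ⊆ Set.Icc 0 T := Set.Ioc_subset_Icc_self
  -- limits at zero
  have L1 : Filter.Tendsto (fun t => D1 t / t) (nhdsWithin 0 (Set.Ioc 0 T)) (nhds α₁) := by
    apply tendsto_div_of_hasDerivWithinAt _ hi2
    rw [← hi4]; exact (dD1 0 h0m).hasDerivWithinAt
  have L2 : Filter.Tendsto (fun t => (l₁ t + 1) / t) (nhdsWithin 0 (Set.Ioc 0 T)) (nhds 0) := by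
    apply tendsto_div_of_hasDerivWithinAt _ (by rw [hi1]; norm_num)
    have := (dl1 0 h0m).hasDerivWithinAt.add_const 1
    rwa [← hD1, hi2] at this
  have L3 : Filter.Tendsto (fun t => l₂ t / t) (nhdsWithin 0 (Set.Ioc 0 T)) (nhds α₂) := by
    apply tendsto_div_of_hasDerivWithinAt _ hi3
    rw [← hi5]; exact (dl2 0 h0m).hasDerivWithinAt
  have LY : Filter.Tendsto Y (nhdsWithin 0 (Set.Ioc 0 T)) (nhds 1) := by
    have := Yc.continuous.tendsto 0
    rw [Y00] at this
    exact this.mono_left nhdsWithin_le_nhds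
  have Ly2 : Filter.Tendsto y₂ (nhdsWithin 0 (Set.Ioc 0 T)) (nhds (y₂ 0)) :=
    (h.c2.continuous.tendsto 0).mono_left nhdsWithin_le_nhds
  have LD2 : Filter.Tendsto D2 (nhdsWithin 0 (Set.Ioc 0 T)) (nhds α₂) := by
    have := (cD2.continuousOn 0 h0m).mono hsub
    rwa [ContinuousWithinAt, hi5] at this
  set gu : ℝ → ℝ := fun t => D1 t / t * (y₂ t / Y t) with hgu
  set gk : ℝ → ℝ := fun t => (l₁ t + 1) / t with hgk
  set ga : ℝ → ℝ := fun t => l₂ t / t + Y t * D2 t with hga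
  set gb : ℝ → ℝ := fun t => l₂ t / t - Y t * D2 t with hgb
  have Lu : Filter.Tendsto gu (nhdsWithin 0 (Set.Ioc 0 T)) (nhds (y₂ 0 * α₁)) := by
    have := L1.mul (Ly2.div LY one_ne_zero)
    rw [div_one, mul_comm] at this
    exact this
  have La : Filter.Tendsto ga (nhdsWithin 0 (Set.Ioc 0 T)) (nhds (2 * α₂)) := by
    have := L3.add (LY.mul LD2)
    convert this using 2; ring
  have Lb : Filter.Tendsto gb (nhdsWithin 0 (Set.Ioc 0 T)) (nhds 0) := by
    have := L3.sub (LY.mul LD2)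
    convert this using 2; ring
  have hne : ∀ t ∈ Set.Ioc 0 T, t ≠ 0 := fun t ht => ht.1.ne'
  have cl1 := hc1.continuousOn.mono hsub
  have cl2 := hc2.continuousOn.mono hsub
  have cd1 := cD1.continuousOn.mono hsub
  have cd2 := cD2.continuousOn.mono hsub
  have cY : ContinuousOn Y (Set.Ioc 0 T) := Yc.continuous.continuousOn
  have cy2 : ContinuousOn y₂ (Set.Ioc 0 T) := h.c2.continuous.continuousOn
  have cu : ContinuousOn gu (Set.Ioc 0 T) :=
    (cd1.div continuousOn_id hne).mul (cy2.div cY fun t _ => Y0 t)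
  have ck : ContinuousOn gk (Set.Ioc 0 T) := (cl1.add continuousOn_const).div continuousOn_id hne
  have ca : ContinuousOn ga (Set.Ioc 0 T) := (cl2.div continuousOn_id hne).add (cY.mul cd2)
  have cb : ContinuousOn gb (Set.Ioc 0 T) := (cl2.div continuousOn_id hne).sub (cY.mul cd2)
  set x : ℝ → Fin 4 → ℝ := fun t => ![if t = 0 then y₂ 0 * α₁ else gu t,
    if t = 0 then 0 else gk t, if t = 0 then 2 * α₂ else ga t, if t = 0 then 0 else gb t] with hx
  have hxt : ∀ t, t ≠ 0 → x t = ![gu t, gk t, ga t, gb t] := by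
    intro t ht; simp [hx, ht]
  refine ⟨x, ?_, by simp [hx], ?_, ?_, ?_, ?_, ?_⟩
  · intro i
    fin_cases i
    · exact continuousOn_ite_zero hT cu Lu
    · exact continuousOn_ite_zero hT ck L2
    · exact continuousOn_ite_zero hT ca La
    · exact continuousOn_ite_zero hT cb Lb
  · intro t ht
    have htI : t ∈ Set.Icc 0 T := ⟨ht.1.le, ht.2.le⟩
    have ht0 : t ≠ 0 := ht.1.ne'
    have hnb : Set.Icc 0 T ∈ nhds t := Icc_mem_nhds ht.1 ht.2
    have q1 : HasDerivAt l₁ (D1 t) t := (dl1 t htI).hasDerivWithinAt.hasDerivAt hnb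
    have q2 : HasDerivAt l₂ (D2 t) t := (dl2 t htI).hasDerivWithinAt.hasDerivAt hnb
    have d1eq : ∀ᶠ s in nhds t, deriv l₁ s = D1 s := by
      filter_upwards [Ioo_mem_nhds ht.1 ht.2] with s hs
      exact (derivWithin_of_mem_nhds (Icc_mem_nhds hs.1 hs.2)).symm
    have d2eq : ∀ᶠ s in nhds t, deriv l₂ s = D2 s := by
      filter_upwards [Ioo_mem_nhds ht.1 ht.2] with s hs
      exact (derivWithin_of_mem_nhds (Icc_mem_nhds hs.1 hs.2)).symm
    have q3 : DifferentiableAt ℝ D1 t := (dD1 t htI).differentiableAt hnb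
    have q4 : DifferentiableAt ℝ D2 t := (dD2 t htI).differentiableAt hnb
    have dy2 : HasDerivAt y₂ (deriv y₂ t) t := (h.c2.differentiable (by norm_num) t).hasDerivAt
    have dY := h.Yd t
    have hnn : ∀ᶠ s in nhds t, s ≠ 0 := isOpen_ne.mem_nhds ht0
    have hev : ∀ i, (fun s => x s i) =ᶠ[nhds t] fun s => (![gu s, gk s, ga s, gb s] : Fin 4 → ℝ) i := by
      intro i
      filter_upwards [hnn] with s hs
      rw [hxt s hs]
    -- derivative of u
    have Du : HasDerivAt gu (l₁ t * (p * l₂ t + (1 - p) * Real.sin (Real.pi * t / 2)) ^ 2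
        / (y₁ t * y₂ t)) t := by
      have e : (fun s => deriv l₁ s / (y₁ s / y₂ s)) =ᶠ[nhds t] gu := by
        filter_upwards [d1eq, hnn] with s hs hs0
        rw [hs, h.y1 s]
        simp only [hgu]
        have := Y0 s
        have := y20 s
        field_simp
      rw [← ho1 t ht, e.deriv_eq]
      apply DifferentiableAt.hasDerivAt
      exact (q3.div differentiableAt_id ht0).mul (dy2.differentiableAt.div dY.differentiableAt (Y0 t))
    have Dv : HasDerivAt (fun s => s * Y s * D2 s / y₂ s)
        (l₂ t * (p * l₁ t - (1 - p) * Real.cos (Real.pi * t / 2)) ^ 2 / (y₁ t * y₂ t)) t := by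
      have e : (fun s => deriv l₂ s / (y₂ s / y₁ s)) =ᶠ[nhds t] fun s => s * Y s * D2 s / y₂ s := by
        filter_upwards [d2eq, hnn] with s hs hs0
        rw [hs, h.y1 s]
        have := Y0 s
        have := y20 s
        field_simp
      rw [← ho2 t ht, e.deriv_eq]
      apply DifferentiableAt.hasDerivAt
      exact ((differentiableAt_id.mul dY.differentiableAt).mul q4).div dy2.differentiableAt (y20 t)
    have DV : HasDerivAt (fun s => Y s * D2 s)
        (deriv y₂ t / y₂ t * (Y t * D2 t) + l₂ t * (p * l₁ t - (1 - p) * Real.cos (Real.pi * t / 2)) ^ 2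
          / (y₁ t * t) - Y t * D2 t / t) t := by
      have e : (fun s => Y s * D2 s) =ᶠ[nhds t] fun s => (s * Y s * D2 s / y₂ s) * y₂ s / s := by
        filter_upwards [hnn] with s hs0
        have := y20 s
        field_simp
      refine (((Dv.mul dy2).div (hasDerivAt_id t) ht0).congr_of_eventuallyEq e).congr_deriv ?_
      rw [h.y1 t]
      have := y20 t
      have := Y0 t
      simp only [id, Pi.mul_apply]
      field_simp
      ring
    have Dm : HasDerivAt (fun s => l₂ s / s) ((D2 t - l₂ t / t) / t) t := by
      refine (q2.div (hasDerivAt_id t) ht0).congr_deriv ?_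
      simp only [id]
      field_simp
    have Dk : HasDerivAt gk ((D1 t - gk t) / t) t := by
      refine ((q1.add_const 1).div (hasDerivAt_id t) ht0).congr_deriv ?_
      simp only [id, hgk]
      field_simp
    have e1 := h.YW t
    have e9 : W t = (Y t - 1) / t := by rw [e1]; field_simp
    have e2 := Y0 t
    have e7 := y20 t
    have k1 : l₁ t = -1 + t * gk t := by simp only [hgk]; field_simp; ring
    have k2 : l₂ t = t * ((ga t + gb t) / 2) := by simp only [hga, hgb]; field_simp; ring
    have k3 : D2 t = (ga t - gb t) / (2 * Y t) := by simp only [hga, hgb]; field_simp; ring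
    have k4 : D1 t = t * Y t / y₂ t * gu t := by simp only [hgu]; field_simp
    intro i
    refine HasDerivAt.congr_of_eventuallyEq ?_ (hev i)
    rw [hxt t ht0]
    fin_cases i
    · refine Du.congr_deriv ?_
      rw [k1, k2, SS_eq, h.y1 t]
      simp [GG, cvec, dvec]
      field_simp
    · refine Dk.congr_deriv ?_
      rw [k4]
      simp [GG, cvec, dvec]
      field_simp
    · refine (Dm.add DV).congr_deriv ?_
      rw [k1, k2, k3, CC_eq, h.y1 t]
      simp [GG, cvec, dvec, e9]
      generalize CC t = c at *
      generalize gb t = B at *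
      generalize ga t = A at *
      generalize gk t = k' at *
      generalize Y t = YY at *
      generalize deriv y₂ t = dy at *
      generalize y₂ t = yy at *
      field_simp
      ring
    · refine (Dm.sub DV).congr_deriv ?_
      rw [k1, k2, k3, CC_eq, h.y1 t]
      simp [GG, cvec, dvec, e9]
      generalize CC t = c at *
      generalize gb t = B at *
      generalize ga t = A at *
      generalize gk t = k' at *
      generalize Y t = YY at *
      generalize deriv y₂ t = dy at *
      generalize y₂ t = yy at *
      field_simp
      ring
  · intro t ht
    have := hne t ht
    rw [hxt t this]
    simp [hgk]
    field_simp
    ring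
  · intro t ht
    have := hne t ht
    have e2 := Y0 t
    have e7 := y20 t
    rw [hxt t this]
    simp [hgu]
    field_simp
    rfl
  · intro t ht
    have := hne t ht
    rw [hxt t this]
    simp [hga, hgb]
    field_simp
    try ring
  · intro t ht
    have := hne t ht
    have e2 := Y0 t
    rw [hxt t this]
    simp [hga, hgb]
    field_simp
    ring

set_option maxHeartbeats 1000000 in
lemma depend {y₁ y₂ Y Y' W : ℝ → ℝ} (h : CoefD y₁ y₂ Y Y' W) {p α₁ α₂ T : ℝ}
    (hp : p ∈ Set.Icc (0:ℝ) 1)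
    (hT : T ∈ Set.Ioc (0:ℝ) (1/2)) {l₁ l₂ : ℝ → ℝ} (hs : IsSolSO2 y₁ y₂ p α₁ α₂ T l₁ l₂) :
    ∀ t ∈ Set.Ioc (0 : ℝ) T, ∀ ε > (0 : ℝ), ∃ δ > (0 : ℝ),
          ∀ p' ∈ Set.Icc (0 : ℝ) 1, ∀ α₁' α₂' T' : ℝ, ∀ l₁' l₂' : ℝ → ℝ,
            |p' - p| < δ → |α₁' - α₁| < δ → |α₂' - α₂| < δ →
            T' ∈ Set.Ioc (0 : ℝ) (1 / 2) → t ≤ T' →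
            IsSolSO2 y₁ y₂ p' α₁' α₂' T' l₁' l₂' →
            |l₁' t - l₁ t| < ε ∧
            |derivWithin l₁' (Set.Icc 0 T') t - derivWithin l₁ (Set.Icc 0 T) t| < ε ∧
            |l₂' t - l₂ t| < ε ∧
            |derivWithin l₂' (Set.Icc 0 T') t - derivWithin l₂ (Set.Icc 0 T) t| < ε := by
  intro t ht ε hε
  obtain ⟨x, hx⟩ := sys_of_sol h hT.1 hs
  obtain ⟨Mc, hMc⟩ := cvec_bdd h
  obtain ⟨Mx, hMx⟩ := isCompact_Icc.exists_bound_of_continuousOn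
    (continuousOn_pi.2 hx.cont)
  obtain ⟨K, hK0, hK⟩ := GG_lip (max Mc (max 1 (Mx + 1)))
  set C := 1 + 4 * K ^ 2 with hC
  have hC0 : 0 ≤ C := by positivity
  have Ypos := h.Ypos t
  have y2pos := h.y2pos t
  have htp := ht.1
  set B := 1 + t + t * Y t / y₂ t + 1 / Y t with hB
  have hBp : 0 < B := by positivity
  set μ := min 1 ((ε / B) ^ 2) with hμ
  have hμp : 0 < μ := lt_min one_pos (by positivity)
  set N := Real.exp (C * t) * (y₂ 0 ^ 2 + 5) with hN
  have hNp : 0 < N := by positivity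
  refine ⟨Real.sqrt (μ / (2 * N)), Real.sqrt_pos.2 (by positivity), ?_⟩
  intro p' hp' α₁' α₂' T' l₁' l₂' hdp hd1 hd2 hT' htT' hs'
  obtain ⟨x', hx'⟩ := sys_of_sol h hT'.1 hs'
  have hsq : Real.sqrt (μ / (2 * N)) ^ 2 = μ / (2 * N) := Real.sq_sqrt (by positivity)
  have sq : ∀ z : ℝ, |z| < Real.sqrt (μ / (2 * N)) → z ^ 2 ≤ μ / (2 * N) := by
    intro z hz
    rw [← hsq, ← sq_abs z]
    gcongr
  set z : ℝ → Fin 4 → ℝ := fun s i => x' s i - x s i with hz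
  set E : ℝ → ℝ := fun s => ∑ i, (z s i) ^ 2 with hE
  have hE0 : E 0 ≤ (y₂ 0 ^ 2 + 4) * (μ / (2 * N)) := by
    simp only [hE, hz, hx.ival, hx'.ival, Fin.sum_univ_four]
    simp
    have h1 := sq _ hd1
    have h2 := sq _ hd2
    have h3 := mul_le_mul_of_nonneg_left h1 (sq_nonneg (y₂ 0))
    nlinarith
  have hzE : ∀ s i, (z s i) ^ 2 ≤ E s := fun s i =>
    Finset.single_le_sum (f := fun i => (z s i) ^ 2) (fun i _ => sq_nonneg _) (Finset.mem_univ i)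
  have hEnn : ∀ s, 0 ≤ E s := fun s => Finset.sum_nonneg fun i _ => sq_nonneg _
  have hzn : ∀ s, ‖x' s - x s‖ ^ 2 ≤ E s := by
    intro s
    have : ‖x' s - x s‖ ≤ Real.sqrt (E s) := by
      refine (pi_norm_le_iff_of_nonneg (Real.sqrt_nonneg _)).2 fun i => ?_
      exact Real.abs_le_sqrt (hzE s i)
    calc _ ≤ Real.sqrt (E s) ^ 2 := by gcongr
      _ = E s := Real.sq_sqrt (hEnn s)
  have hfin : Real.exp (C * t) * (E 0 + (p' - p) ^ 2) ≤ μ / 2 := by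
    have h1 := sq _ hdp
    calc _ ≤ Real.exp (C * t) * ((y₂ 0 ^ 2 + 4) * (μ / (2 * N)) + μ / (2 * N)) := by gcongr
      _ = N * (μ / (2 * N)) := by rw [hN]; ring
      _ = μ / 2 := by field_simp
  have hμ1 : μ ≤ 1 := min_le_left _ _
  set G : ℝ → Fin 4 → ℝ := fun s => GG (cvec y₂ Y W s, p, x s) with hG
  set G' : ℝ → Fin 4 → ℝ := fun s => GG (cvec y₂ Y W s, p', x' s) with hG'
  have hEt : E t + (p' - p) ^ 2 ≤ Real.exp (C * t) * (E 0 + (p' - p) ^ 2) := by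
    refine energy (E' := fun s => ∑ i, 2 * z s i * ((G' s i - dvec i / s * x' s i)
      - (G s i - dvec i / s * x s i))) htp (sq_nonneg _) hC0 hEnn ?_ ?_ ?_ (by linarith)
    · refine continuousOn_finsetSum _ fun i _ => ContinuousOn.pow ?_ 2
      exact ((hx'.cont i).mono (Set.Icc_subset_Icc_right htT')).sub
        ((hx.cont i).mono (Set.Icc_subset_Icc_right ht.2))
    · intro s hs
      refine HasDerivAt.fun_sum fun i _ => ?_
      have h1 := (hx'.ode s ⟨hs.1, hs.2.trans_le htT'⟩ i).sub
        (hx.ode s ⟨hs.1, hs.2.trans_le ht.2⟩ i)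
      refine (h1.pow 2).congr_deriv ?_
      simp [hz, hG, hG']
    · intro s hs hE1
      have hsI : s ∈ Set.Icc (0:ℝ) (1/2) := ⟨hs.1.le, (hs.2.le.trans ht.2).trans hT.2⟩
      have hxs : ‖x s‖ ≤ Mx := hMx s ⟨hs.1.le, hs.2.le.trans ht.2⟩
      have hd : ‖x' s - x s‖ ≤ 1 := by
        have := (hzn s).trans hE1
        rwa [sq_le_one_iff₀ (norm_nonneg _)] at this
      have hx's : ‖x' s‖ ≤ Mx + 1 := by
        have := norm_add_le (x s) (x' s - x s)
        rw [add_sub_cancel] at this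
        linarith
      have hab : ∀ q ∈ Set.Icc (0:ℝ) 1, |q| ≤ 1 := fun q hq => by
        rw [abs_of_nonneg hq.1]; exact hq.2
      have hL := hK (cvec y₂ Y W s, p', x' s) (cvec y₂ Y W s, p, x s)
        (by simp only [Prod.norm_mk, Real.norm_eq_abs]
            exact max_le_max (hMc s hsI) (max_le_max (hab _ hp') hx's))
        (by simp only [Prod.norm_mk, Real.norm_eq_abs]
            exact max_le_max (hMc s hsI) (max_le_max (hab _ hp) (by linarith)))
      have hL2 : ‖G' s - G s‖ ^ 2 ≤ K ^ 2 * (E s + (p' - p) ^ 2) := by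
        have h1 : ‖((cvec y₂ Y W s, p', x' s) : (Fin 8 → ℝ) × ℝ × (Fin 4 → ℝ))
            - (cvec y₂ Y W s, p, x s)‖ = max |p' - p| ‖x' s - x s‖ := by
          simp
        rw [h1] at hL
        have h2 : (max |p' - p| ‖x' s - x s‖) ^ 2 ≤ E s + (p' - p) ^ 2 := by
          rcases max_choice |p' - p| ‖x' s - x s‖ with h | h <;> rw [h]
          · rw [sq_abs]; linarith [hEnn s]
          · linarith [hzn s, sq_nonneg (p' - p)]
        calc _ ≤ (K * max |p' - p| ‖x' s - x s‖) ^ 2 := by gcongr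
          _ = K ^ 2 * (max |p' - p| ‖x' s - x s‖) ^ 2 := by ring
          _ ≤ _ := by gcongr
      have hterm : ∀ i, 2 * z s i * ((G' s i - dvec i / s * x' s i)
          - (G s i - dvec i / s * x s i)) ≤ z s i ^ 2 + K ^ 2 * (E s + (p' - p) ^ 2) := by
        intro i
        have h1 : (G' s i - G s i) ^ 2 ≤ K ^ 2 * (E s + (p' - p) ^ 2) := by
          refine le_trans ?_ hL2
          rw [← sq_abs]
          gcongr
          exact norm_le_pi_norm (G' s - G s) i
        have h2 : 0 ≤ (dvec i : ℝ) / s * z s i ^ 2 := by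
          have := hs.1
          positivity
        have h3 : 2 * z s i * ((G' s i - dvec i / s * x' s i) - (G s i - dvec i / s * x s i))
            = 2 * z s i * (G' s i - G s i) - 2 * ((dvec i : ℝ) / s * z s i ^ 2) := by
          simp only [hz]; ring
        rw [h3]
        have h4 := two_mul_le_add_sq (z s i) (G' s i - G s i)
        linarith
      calc _ ≤ ∑ i, (z s i ^ 2 + K ^ 2 * (E s + (p' - p) ^ 2)) :=
            Finset.sum_le_sum fun i _ => hterm i
        _ = E s + 4 * K ^ 2 * (E s + (p' - p) ^ 2) := by
            rw [Finset.sum_add_distrib]; simp [hE]; ring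
        _ ≤ C * (E s + (p' - p) ^ 2) := by
            have h5 : C * (E s + (p' - p) ^ 2) = E s + (p' - p) ^ 2
              + 4 * K ^ 2 * (E s + (p' - p) ^ 2) := by rw [hC]; ring
            rw [h5]
            have h6 := sq_nonneg (p' - p)
            generalize 4 * K ^ 2 * (E s + (p' - p) ^ 2) = Z
            linarith
  have hzt : ∀ i, |z t i| < ε / B := by
    intro i
    apply abs_lt_of_sq_lt_sq _ (by positivity)
    have h1 := hzE t i
    have h2 : μ ≤ (ε / B) ^ 2 := min_le_right _ _
    linarith [sq_nonneg (p' - p)]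
  have fin : ∀ c w : ℝ, 0 ≤ c → c ≤ B → |w| < ε / B → |c * w| < ε := by
    intro c w hc hcB hw
    rw [abs_mul, abs_of_nonneg hc]
    calc c * |w| ≤ B * |w| := by gcongr
      _ < B * (ε / B) := by gcongr
      _ = ε := by field_simp
  have ht' : t ∈ Set.Ioc 0 T' := ⟨ht.1, htT'⟩
  have b1 : 0 ≤ t * Y t / y₂ t := by positivity
  have b2 : 0 ≤ 1 / Y t := by positivity
  refine ⟨?_, ?_, ?_, ?_⟩
  · rw [hx.e1 t ht, hx'.e1 t ht']
    have := fin t (z t 1) htp.le (by linarith) (hzt 1)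
    convert this using 2
    simp only [hz]; ring
  · rw [hx.e2 t ht, hx'.e2 t ht']
    have := fin (t * Y t / y₂ t) (z t 0) b1 (by linarith) (hzt 0)
    convert this using 2
    simp only [hz]; ring
  · rw [hx.e3 t ht, hx'.e3 t ht']
    have := fin t ((z t 2 + z t 3) / 2) htp.le (by linarith) (by
      have h2 := abs_lt.1 (hzt 2)
      have h3 := abs_lt.1 (hzt 3)
      rw [abs_lt]; constructor <;> linarith [h2.1, h2.2, h3.1, h3.2])
    convert this using 2
    simp only [hz]; ring
  · rw [hx.e4 t ht, hx'.e4 t ht']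
    have := fin (1 / Y t) ((z t 2 - z t 3) / 2) b2 (by linarith) (by
      have h2 := abs_lt.1 (hzt 2)
      have h3 := abs_lt.1 (hzt 3)
      rw [abs_lt]; constructor <;> linarith [h2.1, h2.2, h3.1, h3.2])
    convert this using 2
    simp only [hz]; field_simp; ring

lemma isSol_congr {y₁ y₂ z₁ z₂ : ℝ → ℝ} (h1 : ∀ t ∈ Set.Ioo (0:ℝ) (1/2), y₁ t = z₁ t)
    (h2 : ∀ t ∈ Set.Ioo (0:ℝ) (1/2), y₂ t = z₂ t) {p α₁ α₂ T : ℝ} (hT : T ≤ 1/2) {l₁ l₂ : ℝ → ℝ} :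
    IsSolSO2 y₁ y₂ p α₁ α₂ T l₁ l₂ ↔ IsSolSO2 z₁ z₂ p α₁ α₂ T l₁ l₂ := by
  unfold IsSolSO2
  have k : ∀ t ∈ Set.Ioo (0:ℝ) T, Set.Ioo (0:ℝ) (1/2) ∈ nhds t := fun t ht =>
    Ioo_mem_nhds ht.1 (ht.2.trans_le hT)
  have e1 : ∀ t ∈ Set.Ioo (0:ℝ) T, deriv (fun s => deriv l₁ s / (y₁ s / y₂ s)) t
      = deriv (fun s => deriv l₁ s / (z₁ s / z₂ s)) t := by
    intro t ht
    apply Filter.EventuallyEq.deriv_eq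
    filter_upwards [k t ht] with s hs
    rw [h1 s hs, h2 s hs]
  have e2 : ∀ t ∈ Set.Ioo (0:ℝ) T, deriv (fun s => deriv l₂ s / (y₂ s / y₁ s)) t
      = deriv (fun s => deriv l₂ s / (z₂ s / z₁ s)) t := by
    intro t ht
    apply Filter.EventuallyEq.deriv_eq
    filter_upwards [k t ht] with s hs
    rw [h1 s hs, h2 s hs]
  have f1 : ∀ t ∈ Set.Ioo (0:ℝ) T, y₁ t = z₁ t := fun t ht => h1 t ⟨ht.1, ht.2.trans_le hT⟩
  have f2 : ∀ t ∈ Set.Ioo (0:ℝ) T, y₂ t = z₂ t := fun t ht => h2 t ⟨ht.1, ht.2.trans_le hT⟩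
  refine and_congr Iff.rfl (and_congr Iff.rfl (and_congr ?_ (and_congr ?_ Iff.rfl)))
  · refine forall₂_congr fun t ht => ?_
    rw [e1 t ht, f1 t ht, f2 t ht]
  · refine forall₂_congr fun t ht => ?_
    rw [e2 t ht, f1 t ht, f2 t ht]

/-- interpolation of a function smooth on an open interval with a global smooth function -/
lemma glue_contDiff {a b : ℝ} {y g : ℝ → ℝ} (hy : ContDiffOn ℝ (⊤ : ℕ∞) y (Set.Ioo a b))
    (hg : ContDiff ℝ 2 g) {c : ℝ} (χ : ContDiffBump c)
    (hχ : Metric.closedBall c χ.rOut ⊆ Set.Ioo a b) :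
    ContDiff ℝ 2 (fun t => g t + χ t * (y t - g t)) := by
  rw [contDiff_iff_contDiffAt]
  intro t
  by_cases ht : t ∈ Set.Ioo a b
  · have h1 : ContDiffAt ℝ 2 y t :=
      (contDiffOn_infty.1 hy 2 t ht).contDiffAt (Ioo_mem_nhds ht.1 ht.2)
    have h2 : ContDiffAt ℝ 2 χ t := χ.contDiff.contDiffAt
    exact hg.contDiffAt.add (h2.mul (h1.sub hg.contDiffAt))
  · have h3 : t ∈ (Metric.closedBall c χ.rOut)ᶜ := fun h => ht (hχ h)
    refine hg.contDiffAt.congr_of_eventuallyEq ?_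
    filter_upwards [Metric.isClosed_closedBall.isOpen_compl.mem_nhds h3] with s hs
    have : χ s = 0 := χ.zero_of_le_dist (by
      have : ¬ dist s c ≤ χ.rOut := hs
      linarith)
    simp [this]

lemma exists_global (a b : ℝ) (ha : a < 0) (hb : 1 < b) (y₁ y₂ : ℝ → ℝ)
    (hy₁ : ContDiffOn ℝ (⊤ : ℕ∞) y₁ (Set.Ioo a b))
    (hy₂ : ContDiffOn ℝ (⊤ : ℕ∞) y₂ (Set.Ioo a b))
    (hy₁pos : ∀ r ∈ Set.Ioo (0 : ℝ) 1, 0 < y₁ r)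
    (hy₂pos : ∀ r ∈ Set.Ioo (0 : ℝ) 1, 0 < y₂ r)
    (hodd : ∀ t, t ∈ Set.Ioo a b → -t ∈ Set.Ioo a b → y₁ (-t) = - y₁ t)
    (heven : ∀ t, t ∈ Set.Ioo a b → -t ∈ Set.Ioo a b → y₂ (-t) = y₂ t)
    (hy₁' : deriv y₁ 0 = 1) (hy₂0 : 0 < y₂ 0) :
    ∃ z₁ z₂ Y Y' W : ℝ → ℝ, CoefD z₁ z₂ Y Y' W ∧
      (∀ t ∈ Set.Ioo (0:ℝ) (1/2), y₁ t = z₁ t) ∧ (∀ t ∈ Set.Ioo (0:ℝ) (1/2), y₂ t = z₂ t) := by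
  set e := min (1/4) (-a/2) with he
  have he0 : 0 < e := lt_min (by norm_num) (by linarith)
  have he1 : e ≤ 1/4 := min_le_left _ _
  have he2 : e ≤ -a/2 := min_le_right _ _
  let χ : ContDiffBump (1/4 : ℝ) := ⟨1/4 + e/2, 1/4 + e, by linarith, by linarith⟩
  have hball : Metric.closedBall (1/4 : ℝ) χ.rOut ⊆ Set.Ioo a b := by
    rw [Real.closedBall_eq_Icc]
    intro s hs
    have h1 : 1/4 - (1/4 + e) ≤ s := hs.1
    have h2 : s ≤ 1/4 + (1/4 + e) := hs.2
    constructor <;> linarith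
  have hone : ∀ s, -(e/2) ≤ s → s ≤ 1/2 → χ s = 1 := by
    intro s h1 h2
    apply χ.one_of_mem_closedBall
    rw [Real.closedBall_eq_Icc]
    have : χ.rIn = 1/4 + e/2 := rfl
    rw [this]
    constructor <;> linarith
  have hzero : ∀ s, (s ≤ -e ∨ 1/2 + e ≤ s) → χ s = 0 := by
    intro s hs
    apply χ.zero_of_le_dist
    have : χ.rOut = 1/4 + e := rfl
    rw [this, Real.dist_eq]
    rcases hs with hs | hs
    · rw [abs_of_nonpos (by linarith)]; linarith
    · rw [abs_of_nonneg (by linarith)]; linarith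
  set z₁ : ℝ → ℝ := fun t => t + χ t * (y₁ t - t) with hz1
  set z₂ : ℝ → ℝ := fun t => 1 + χ t * (y₂ t - 1) with hz2
  have c1 : ContDiff ℝ 2 z₁ := glue_contDiff (g := fun t => t) hy₁ contDiff_id χ hball
  have c2 : ContDiff ℝ 2 z₂ := glue_contDiff (g := fun _ => 1) hy₂ contDiff_const χ hball
  have hp2 : ∀ s, -e < s → s < 1/2 + e → 0 < y₂ s := by
    intro s h1 h2
    rcases lt_trichotomy s 0 with h | h | h
    · have := heven (-s) ⟨by linarith, by linarith⟩ ⟨by linarith, by linarith⟩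
      rw [neg_neg] at this
      rw [this]; exact hy₂pos _ ⟨by linarith, by linarith⟩
    · rw [h]; exact hy₂0
    · exact hy₂pos _ ⟨by linarith, by linarith⟩
  have hp1 : ∀ s, -e < s → s < 1/2 + e → s ≠ 0 → 0 < s * y₁ s := by
    intro s h1 h2 h3
    rcases lt_trichotomy s 0 with h | h | h
    · have := hodd (-s) ⟨by linarith, by linarith⟩ ⟨by linarith, by linarith⟩
      rw [neg_neg] at this
      rw [this]
      have := hy₁pos (-s) ⟨by linarith, by linarith⟩
      nlinarith
    · exact absurd h h3
    · exact mul_pos h (hy₁pos _ ⟨by linarith, by linarith⟩)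
  have y10 : y₁ 0 = 0 := by
    have := hodd 0 ⟨by linarith, by linarith⟩ ⟨by linarith, by linarith⟩
    rw [neg_zero] at this; linarith
  have eq1 : ∀ s, -(e/2) ≤ s → s ≤ 1/2 → z₁ s = y₁ s := fun s h1 h2 => by
    simp [hz1, hone s h1 h2]
  have eq2 : ∀ s, -(e/2) ≤ s → s ≤ 1/2 → z₂ s = y₂ s := fun s h1 h2 => by
    simp [hz2, hone s h1 h2]
  have d0 : deriv z₁ 0 = 1 := by
    rw [← hy₁']
    apply Filter.EventuallyEq.deriv_eq
    filter_upwards [Ioo_mem_nhds (show -(e/2) < 0 by linarith) (show (0:ℝ) < 1/2 by norm_num)]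
      with s hs
    exact eq1 s hs.1.le hs.2.le
  obtain ⟨Y, Y', W, hc⟩ := exists_coef c1 (c2.of_le (by norm_num)) (y₂ := z₂) (fun t => by
      simp only [hz2]
      by_cases ht : -e < t ∧ t < 1/2 + e
      · have h1 := hp2 t ht.1 ht.2
        have h2 : 0 ≤ χ t := χ.nonneg
        have h3 : χ t ≤ 1 := χ.le_one
        rcases h2.eq_or_lt with h | h
        · rw [← h]; norm_num
        · nlinarith [mul_pos h h1]
      · rw [hzero t (by by_contra! hcon; exact ht hcon)]; norm_num)
    (by rw [eq1 0 (by linarith) (by norm_num), y10]) d0 (fun t ht0 => by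
      simp only [hz1]
      have hsq : 0 < t * t := mul_self_pos.2 ht0
      by_cases ht : -e < t ∧ t < 1/2 + e
      · have h1 := hp1 t ht.1 ht.2 ht0
        have h2 : 0 ≤ χ t := χ.nonneg
        have h3 : χ t ≤ 1 := χ.le_one
        rcases h2.eq_or_lt with h | h
        · rw [← h]; linarith
        · nlinarith [mul_pos h h1, mul_nonneg (sub_nonneg.2 h3) hsq.le]
      · rw [hzero t (by by_contra! hcon; exact ht hcon)]; linarith)
  exact ⟨z₁, z₂, Y, Y', W, hc, fun t ht => (eq1 t (by linarith [ht.1]) ht.2.le).symm,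
    fun t ht => (eq2 t (by linarith [ht.1]) ht.2.le).symm⟩

/-- short-time existence, uniqueness and continuous dependence for the
`SO(2)×SO(2)` system near the singular orbit.  Here `y₁, y₂` are smooth on an open
interval `(a,b) ⊇ [0,1]`, positive on `(0,1)`, `y₁` odd about `0` with `y₁'(0) = 1`,
`y₂` even about `0` with `y₂(0) > 0`. -/
theorem stmt_3 (a b : ℝ) (ha : a < 0) (hb : 1 < b) (y₁ y₂ : ℝ → ℝ)
    (hy₁ : ContDiffOn ℝ (⊤ : ℕ∞) y₁ (Set.Ioo a b))
    (hy₂ : ContDiffOn ℝ (⊤ : ℕ∞) y₂ (Set.Ioo a b))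
    (hy₁pos : ∀ r ∈ Set.Ioo (0 : ℝ) 1, 0 < y₁ r)
    (hy₂pos : ∀ r ∈ Set.Ioo (0 : ℝ) 1, 0 < y₂ r)
    (hodd : ∀ t, t ∈ Set.Ioo a b → -t ∈ Set.Ioo a b → y₁ (-t) = - y₁ t)
    (heven : ∀ t, t ∈ Set.Ioo a b → -t ∈ Set.Ioo a b → y₂ (-t) = y₂ t)
    (hy₁' : deriv y₁ 0 = 1) (hy₂0 : 0 < y₂ 0)
    (p : ℝ) (hp : p ∈ Set.Icc (0 : ℝ) 1) (α₁ α₂ : ℝ) :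
    ∃ T, T ∈ Set.Ioc (0 : ℝ) (1 / 2) ∧
      ∃ l₁ l₂ : ℝ → ℝ, IsSolSO2 y₁ y₂ p α₁ α₂ T l₁ l₂ ∧
        (∀ l₁' l₂' : ℝ → ℝ, IsSolSO2 y₁ y₂ p α₁ α₂ T l₁' l₂' →
          Set.EqOn l₁' l₁ (Set.Icc 0 T) ∧ Set.EqOn l₂' l₂ (Set.Icc 0 T)) ∧
        (∀ t ∈ Set.Ioc (0 : ℝ) T, ∀ ε > (0 : ℝ), ∃ δ > (0 : ℝ),
          ∀ p' ∈ Set.Icc (0 : ℝ) 1, ∀ α₁' α₂' T' : ℝ, ∀ l₁' l₂' : ℝ → ℝ,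
            |p' - p| < δ → |α₁' - α₁| < δ → |α₂' - α₂| < δ →
            T' ∈ Set.Ioc (0 : ℝ) (1 / 2) → t ≤ T' →
            IsSolSO2 y₁ y₂ p' α₁' α₂' T' l₁' l₂' →
            |l₁' t - l₁ t| < ε ∧
            |derivWithin l₁' (Set.Icc 0 T') t - derivWithin l₁ (Set.Icc 0 T) t| < ε ∧
            |l₂' t - l₂ t| < ε ∧
            |derivWithin l₂' (Set.Icc 0 T') t - derivWithin l₂ (Set.Icc 0 T) t| < ε) := by
  obtain ⟨z₁, z₂, Y, Y', W, hc, g1, g2⟩ := exists_global a b ha hb y₁ y₂ hy₁ hy₂ hy₁pos hy₂pos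
    hodd heven hy₁' hy₂0
  obtain ⟨T, hT, l₁, l₂, hs⟩ := exist_sol hc p α₁ α₂
  have hdep := depend hc hp hT hs
  refine ⟨T, hT, l₁, l₂, (isSol_congr g1 g2 hT.2).2 hs, ?_, ?_⟩
  · intro l₁' l₂' hs'
    have hs'' := (isSol_congr g1 g2 hT.2).1 hs'
    have key : ∀ t ∈ Set.Ioc 0 T, ∀ ε > (0:ℝ), |l₁' t - l₁ t| < ε ∧ |l₂' t - l₂ t| < ε := by
      intro t ht ε hε
      obtain ⟨δ, hδ, hh⟩ := hdep t ht ε hε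
      obtain ⟨q1, -, q2, -⟩ := hh p hp α₁ α₂ T l₁' l₂' (by simpa) (by simpa) (by simpa) hT ht.2 hs''
      exact ⟨q1, q2⟩
    have i1 : l₁' 0 = l₁ 0 := by rw [hs''.2.2.2.2.1, hs.2.2.2.2.1]
    have i2 : l₂' 0 = l₂ 0 := by rw [hs''.2.2.2.2.2.2.1, hs.2.2.2.2.2.2.1]
    constructor
    · intro t ht
      rcases ht.1.eq_or_lt with h | h
      · rw [← h, i1]
      · by_contra hne
        exact lt_irrefl _ (key t ⟨h, ht.2⟩ _ (abs_pos.2 (sub_ne_zero.2 hne))).1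
    · intro t ht
      rcases ht.1.eq_or_lt with h | h
      · rw [← h, i2]
      · by_contra hne
        exact lt_irrefl _ (key t ⟨h, ht.2⟩ _ (abs_pos.2 (sub_ne_zero.2 hne))).2
  · intro t ht ε hε
    obtain ⟨δ, hδ, hh⟩ := hdep t ht ε hε
    refine ⟨δ, hδ, fun p' hp' α₁' α₂' T' l₁' l₂' h1 h2 h3 hT' htT' hs' => ?_⟩
    exact hh p' hp' α₁' α₂' T' l₁' l₂' h1 h2 h3 hT' htT' ((isSol_congr g1 g2 hT'.2).1 hs')
end

section
/- Let p ∈ [0,1]. Suppose l₁, l₂ : [0,1] → ℝ are continuous on [0,1], twice continuously differentiable on (0,1), and satisfy on (0,1) the system (l₁'/φ₁)' = l₁·F(p·l₂ + (1−p)·sin(πt/2))/σ and (l₂'/φ₂)' = F(p·l₁ − (1−p)·cos(πt/2))·l₂/σ, with the boundary conditions l₁(0) = −1, l₂(0) = 0, l₁(1) = 0, l₂(1) = 1. Then −1 < l₁(t) < 0 and 0 < l₂(t) < 1 for all t ∈ (0,1). -/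
theorem aux_max (l g φ q : ℝ → ℝ) (hlc : ContinuousOn l (Set.Icc 0 1))
    (hφc : ContinuousOn φ (Set.Ioo 0 1)) (hqc : ContinuousOn q (Set.Ioo 0 1))
    (hφ : ∀ t ∈ Set.Ioo (0 : ℝ) 1, 0 < φ t) (hq : ∀ t ∈ Set.Ioo (0 : ℝ) 1, 0 ≤ q t)
    (hl : ∀ t ∈ Set.Ioo (0 : ℝ) 1, HasDerivAt l (φ t * g t) t)
    (hg : ∀ t ∈ Set.Ioo (0 : ℝ) 1, HasDerivAt g (q t * l t) t)
    (h0 : l 0 = -1) (h1 : l 1 = 0) :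
    ∀ t ∈ Set.Ioo (0 : ℝ) 1, -1 < l t ∧ l t < 0 := by
  have hmul : ∀ t ∈ Set.Ioo (0 : ℝ) 1,
      HasDerivAt (fun s => l s * g s) (φ t * g t * g t + l t * (q t * l t)) t :=
    fun t ht => (hl t ht).mul (hg t ht)
  have hmono : MonotoneOn (fun s => l s * g s) (Set.Ioo 0 1) := by
    apply monotoneOn_of_deriv_nonneg (convex_Ioo 0 1)
    · exact fun t ht => (hmul t ht).continuousAt.continuousWithinAt
    · rw [interior_Ioo]
      exact fun t ht => (hmul t ht).differentiableAt.differentiableWithinAt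
    · rw [interior_Ioo]
      intro t ht
      rw [(hmul t ht).deriv]
      have := mul_nonneg (hφ t ht).le (mul_self_nonneg (g t))
      have := mul_nonneg (hq t ht) (mul_self_nonneg (l t))
      nlinarith
  have hsq : ∀ t ∈ Set.Ioo (0 : ℝ) 1,
      HasDerivAt (fun s => l s * l s) (φ t * g t * l t + l t * (φ t * g t)) t :=
    fun t ht => (hl t ht).mul (hl t ht)
  -- where the product is nonnegative, `l` vanishes
  have key : ∀ t ∈ Set.Ioo (0 : ℝ) 1, 0 ≤ l t * g t → ∀ s ∈ Set.Icc t 1, l s = 0 := by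
    intro t ht h s hs
    have hm : MonotoneOn (fun s => l s * l s) (Set.Icc t 1) := by
      apply monotoneOn_of_deriv_nonneg (convex_Icc t 1)
      · have : ContinuousOn l (Set.Icc t 1) := hlc.mono (Set.Icc_subset_Icc_left ht.1.le)
        exact this.mul this
      · rw [interior_Icc]
        exact fun u hu =>
          (hsq u ⟨ht.1.trans hu.1, hu.2⟩).differentiableAt.differentiableWithinAt
      · rw [interior_Icc]
        intro u hu
        have hu' : u ∈ Set.Ioo (0 : ℝ) 1 := ⟨ht.1.trans hu.1, hu.2⟩
        rw [(hsq u hu').deriv]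
        have h2 : l t * g t ≤ l u * g u := hmono ht hu' hu.1.le
        have := mul_nonneg (hφ u hu').le (h.trans h2)
        nlinarith
    have h3 : l s * l s ≤ l 1 * l 1 := hm hs ⟨ht.2.le, le_rfl⟩ hs.2
    rw [h1] at h3
    nlinarith
  have hE : ∀ t ∈ Set.Ioo (0 : ℝ) 1, l t = 0 → g t = 0 → False := by
    intro t ht hlt hgt
    have hz : ∀ a ∈ Set.Ioo 0 t, l a = 0 := by
      intro a ha
      have hsub : Set.Icc a t ⊆ Set.Ioo 0 1 :=
        fun x hx => ⟨ha.1.trans_le hx.1, hx.2.trans_lt ht.2⟩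
      obtain ⟨K, hK⟩ := (isCompact_Icc (a := a) (b := t)).bddAbove_image
        ((hφc.add hqc).mono hsub)
      have hK' : ∀ x ∈ Set.Icc a t, φ x + q x ≤ K := fun x hx => hK ⟨x, hx, rfl⟩
      have hd : ∀ x ∈ Set.Icc a t,
          HasDerivAt (fun s => (l s * l s + g s * g s) * Real.exp (K * s))
            (((φ x * g x * l x + l x * (φ x * g x)) +
              (q x * l x * g x + g x * (q x * l x))) * Real.exp (K * x) +
              (l x * l x + g x * g x) * (Real.exp (K * x) * (K * 1))) x := by
        intro x hx
        have hx' := hsub hx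
        exact ((hsq x hx').add ((hg x hx').mul (hg x hx'))).mul
          (((hasDerivAt_id x).const_mul K).exp)
      have hm : MonotoneOn (fun s => (l s * l s + g s * g s) * Real.exp (K * s))
          (Set.Icc a t) := by
        apply monotoneOn_of_deriv_nonneg (convex_Icc a t)
        · exact fun x hx => (hd x hx).continuousAt.continuousWithinAt
        · exact fun x hx =>
            (hd x (interior_subset hx)).differentiableAt.differentiableWithinAt
        · intro x hx
          have hx := interior_subset hx
          rw [(hd x hx).deriv]
          have e := Real.exp_pos (K * x)
          have k := hK' x hx
          have f := (hφ x (hsub hx)).le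
          have f2 := hq x (hsub hx)
          have : 0 ≤ (φ x + q x) * (l x + g x) ^ 2 + (K - (φ x + q x)) *
            (l x ^ 2 + g x ^ 2) := by
            have : 0 ≤ K - (φ x + q x) := by linarith
            positivity
          have := mul_nonneg this e.le
          nlinarith
      have h3 := hm ⟨le_rfl, ha.2.le⟩ ⟨ha.2.le, le_rfl⟩ ha.2.le
      simp only [hlt, hgt] at h3
      have e := Real.exp_pos (K * a)
      have h4 : l a * l a + g a * g a ≤ 0 := by
        by_contra hc
        push Not at hc
        have := mul_pos hc e
        linarith
      nlinarith [mul_self_nonneg (l a), mul_self_nonneg (g a)]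
    have hc0 : ContinuousOn l (Set.Icc 0 t) := hlc.mono (Set.Icc_subset_Icc_right ht.2.le)
    have hmin : ∃ x, x ∈ Set.Icc 0 t ∧ l x = -1 / 2 :=
      intermediate_value_Icc ht.1.le hc0 ⟨by rw [h0]; norm_num, by rw [hlt]; norm_num⟩
    obtain ⟨x, hx, hxe⟩ := hmin
    rcases hx.1.eq_or_lt with h | h
    · rw [← h, h0] at hxe; norm_num at hxe
    rcases hx.2.eq_or_lt with h' | h'
    · rw [h', hlt] at hxe; norm_num at hxe
    rw [hz x ⟨h, h'⟩] at hxe; norm_num at hxe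
  have hneg : ∀ t ∈ Set.Ioo (0 : ℝ) 1, l t * g t < 0 := by
    intro t ht
    by_contra hc
    push Not at hc
    have hz := key t ht hc
    obtain ⟨s, hs⟩ := exists_between ht.2
    have hs' : s ∈ Set.Ioo (0 : ℝ) 1 := ⟨ht.1.trans hs.1, hs.2⟩
    refine hE s hs' (hz s ⟨hs.1.le, hs.2.le⟩) ?_
    have hev : l =ᶠ[nhds s] fun _ => 0 := by
      filter_upwards [Ioo_mem_nhds hs.1 hs.2] with x hx
      exact hz x ⟨hx.1.le, hx.2.le⟩
    have h5 := (hl s hs').unique ((hasDerivAt_const s (0 : ℝ)).congr_of_eventuallyEq hev)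
    exact (mul_eq_zero.mp h5).resolve_left (hφ s hs').ne'
  have hlneg : ∀ t ∈ Set.Ioo (0 : ℝ) 1, l t < 0 := by
    intro t ht
    by_contra hc
    push Not at hc
    obtain ⟨x, hx, hxe⟩ := intermediate_value_Icc ht.1.le
      (hlc.mono (Set.Icc_subset_Icc_right ht.2.le)) (show (0 : ℝ) ∈ Set.Icc (l 0) (l t) from
        ⟨by rw [h0]; norm_num, hc⟩)
    rcases hx.1.eq_or_lt with h | h
    · rw [← h, h0] at hxe; norm_num at hxe
    have := hneg x ⟨h, hx.2.trans_lt ht.2⟩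
    rw [hxe] at this
    simp at this
  have hsm : StrictMonoOn l (Set.Icc 0 1) := by
    apply strictMonoOn_of_deriv_pos (convex_Icc 0 1) hlc
    rw [interior_Icc]
    intro t ht
    rw [(hl t ht).deriv]
    exact mul_pos (hφ t ht) (pos_of_mul_neg_right (hneg t ht) (hlneg t ht).le)
  intro t ht
  refine ⟨?_, hlneg t ht⟩
  rw [← h0]
  exact hsm ⟨le_rfl, zero_le_one⟩ ⟨ht.1.le, ht.2.le⟩ ht.1

theorem aux_deriv (y z l : ℝ → ℝ)
    (hy : ContDiffOn ℝ (⊤ : ℕ∞) y (Set.Ioo (-1 : ℝ) 2))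
    (hz : ContDiffOn ℝ (⊤ : ℕ∞) z (Set.Ioo (-1 : ℝ) 2))
    (hypos : ∀ r ∈ Set.Ioo (0 : ℝ) 1, 0 < y r)
    (hzpos : ∀ r ∈ Set.Ioo (0 : ℝ) 1, 0 < z r)
    (hld : ContDiffOn ℝ 2 l (Set.Ioo 0 1)) :
    ∀ t ∈ Set.Ioo (0 : ℝ) 1,
      HasDerivAt l (y t / z t * (deriv l t / (y t / z t))) t ∧
      DifferentiableAt ℝ (fun s => deriv l s / (y s / z s)) t := by
  intro t ht
  have hn : Set.Ioo (0 : ℝ) 1 ∈ nhds t := Ioo_mem_nhds ht.1 ht.2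
  have hn' : Set.Ioo (-1 : ℝ) 2 ∈ nhds t :=
    Ioo_mem_nhds (by linarith [ht.1]) (by linarith [ht.2])
  have hy' := hypos t ht
  have hz' := hzpos t ht
  have dy : DifferentiableAt ℝ y t := (hy.contDiffAt hn').differentiableAt (by simp)
  have dz : DifferentiableAt ℝ z t := (hz.contDiffAt hn').differentiableAt (by simp)
  have dl : DifferentiableAt ℝ l t := (hld.contDiffAt hn).differentiableAt (by simp)
  have dl' : DifferentiableAt ℝ (deriv l) t :=
    (((contDiffOn_succ_iff_deriv_of_isOpen (n := 1) isOpen_Ioo).mp hld).2.2.contDiffAt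
      hn).differentiableAt (by simp)
  constructor
  · rw [mul_div_cancel₀ _ (div_pos hy' hz').ne']
    exact dl.hasDerivAt
  · exact dl'.div (dy.div dz hz'.ne') (div_pos hy' hz').ne'


/-- maximum principle for the truncated `SO(2)×SO(2)` system.
Here `y₁, y₂` are smooth on `(-1,2)`, positive on `(0,1)`, with the stated parity and
boundary behaviour, `φ₁ = y₁/y₂`, `φ₂ = y₂/y₁`, `σ = y₁ y₂`, and `F` is the fixed
nonnegative smooth truncation of `x ↦ x²`.  If `l₁, l₂` are continuous on `[0,1]`,
`C²` on `(0,1)`, solve the system on `(0,1)` and satisfy the boundary conditions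
`l₁(0) = -1`, `l₂(0) = 0`, `l₁(1) = 0`, `l₂(1) = 1`, then `-1 < l₁ < 0` and
`0 < l₂ < 1` on `(0,1)`. -/
theorem stmt_4 (y₁ y₂ : ℝ → ℝ)
    (hy₁ : ContDiffOn ℝ (⊤ : ℕ∞) y₁ (Set.Ioo (-1 : ℝ) 2))
    (hy₂ : ContDiffOn ℝ (⊤ : ℕ∞) y₂ (Set.Ioo (-1 : ℝ) 2))
    (hy₁pos : ∀ r ∈ Set.Ioo (0 : ℝ) 1, 0 < y₁ r)
    (hy₂pos : ∀ r ∈ Set.Ioo (0 : ℝ) 1, 0 < y₂ r)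
    (h₁odd : ∀ t ∈ Set.Ioo (-1 : ℝ) 1, y₁ (-t) = - y₁ t)
    (h₁even : ∀ t ∈ Set.Ioo (-1 : ℝ) 1, y₁ (1 + t) = y₁ (1 - t))
    (h₂even : ∀ t ∈ Set.Ioo (-1 : ℝ) 1, y₂ (-t) = y₂ t)
    (h₂odd : ∀ t ∈ Set.Ioo (-1 : ℝ) 1, y₂ (1 + t) = - y₂ (1 - t))
    (hy₁'0 : deriv y₁ 0 = 1) (hy₁1 : 0 < y₁ 1) (hy₂0 : 0 < y₂ 0)
    (hy₂'1 : deriv y₂ 1 = -1)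
    (F : ℝ → ℝ) (hF : ContDiff ℝ (⊤ : ℕ∞) F) (hFnn : ∀ x, 0 ≤ F x)
    (hFsq : ∀ x : ℝ, |x| ≤ 2 → F x = x ^ 2) (hFcpt : ∀ x : ℝ, 3 ≤ |x| → F x = 0)
    (hFbd : ∀ x, F x ≤ 8)
    (p : ℝ) (hp : p ∈ Set.Icc (0 : ℝ) 1) (l₁ l₂ : ℝ → ℝ)
    (hl₁c : ContinuousOn l₁ (Set.Icc 0 1)) (hl₂c : ContinuousOn l₂ (Set.Icc 0 1))
    (hl₁d : ContDiffOn ℝ 2 l₁ (Set.Ioo 0 1)) (hl₂d : ContDiffOn ℝ 2 l₂ (Set.Ioo 0 1))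
    (heq₁ : ∀ t ∈ Set.Ioo (0 : ℝ) 1,
      deriv (fun s => deriv l₁ s / (y₁ s / y₂ s)) t
        = l₁ t * F (p * l₂ t + (1 - p) * Real.sin (Real.pi * t / 2)) / (y₁ t * y₂ t))
    (heq₂ : ∀ t ∈ Set.Ioo (0 : ℝ) 1,
      deriv (fun s => deriv l₂ s / (y₂ s / y₁ s)) t
        = F (p * l₁ t - (1 - p) * Real.cos (Real.pi * t / 2)) * l₂ t / (y₁ t * y₂ t))
    (hbc₁ : l₁ 0 = -1) (hbc₂ : l₂ 0 = 0) (hbc₃ : l₁ 1 = 0) (hbc₄ : l₂ 1 = 1) :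
    ∀ t ∈ Set.Ioo (0 : ℝ) 1, -1 < l₁ t ∧ l₁ t < 0 ∧ 0 < l₂ t ∧ l₂ t < 1 := by
  have hsub : Set.Ioo (0 : ℝ) 1 ⊆ Set.Ioo (-1 : ℝ) 2 :=
    fun x hx => ⟨by linarith [hx.1], by linarith [hx.2]⟩
  have c1 : ContinuousOn y₁ (Set.Ioo 0 1) := hy₁.continuousOn.mono hsub
  have c2 : ContinuousOn y₂ (Set.Ioo 0 1) := hy₂.continuousOn.mono hsub
  have cl1 : ContinuousOn l₁ (Set.Ioo 0 1) := hl₁d.continuousOn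
  have cl2 : ContinuousOn l₂ (Set.Ioo 0 1) := hl₂d.continuousOn
  have cF := hF.continuous
  have D1 := aux_deriv y₁ y₂ l₁ hy₁ hy₂ hy₁pos hy₂pos hl₁d
  have D2 := aux_deriv y₂ y₁ l₂ hy₂ hy₁ hy₂pos hy₁pos hl₂d
  have A := aux_max l₁ (fun s => deriv l₁ s / (y₁ s / y₂ s)) (fun s => y₁ s / y₂ s)
    (fun t => F (p * l₂ t + (1 - p) * Real.sin (Real.pi * t / 2)) / (y₁ t * y₂ t))
    hl₁c (c1.div c2 fun t ht => (hy₂pos t ht).ne')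
    (ContinuousOn.div (cF.comp_continuousOn (by fun_prop)) (c1.mul c2)
      fun t ht => (mul_pos (hy₁pos t ht) (hy₂pos t ht)).ne')
    (fun t ht => div_pos (hy₁pos t ht) (hy₂pos t ht))
    (fun t ht => div_nonneg (hFnn _) (mul_pos (hy₁pos t ht) (hy₂pos t ht)).le)
    (fun t ht => (D1 t ht).1)
    (fun t ht => by
      have h := (D1 t ht).2.hasDerivAt
      rw [heq₁ t ht] at h
      refine h.congr_deriv ?_
      beta_reduce
      ring) hbc₁ hbc₃
  have hr : Set.MapsTo (fun t : ℝ => 1 - t) (Set.Ioo 0 1) (Set.Ioo 0 1) :=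
    fun t ht => ⟨by linarith [ht.2], by linarith [ht.1]⟩
  have hr' : Set.MapsTo (fun t : ℝ => 1 - t) (Set.Icc 0 1) (Set.Icc 0 1) :=
    fun t ht => ⟨by linarith [ht.2], by linarith [ht.1]⟩
  have cr : Continuous (fun t : ℝ => 1 - t) := by fun_prop
  have hφc : ContinuousOn (fun s => y₂ s / y₁ s) (Set.Ioo 0 1) :=
    c2.div c1 fun t ht => (hy₁pos t ht).ne'
  have hqc : ContinuousOn (fun t => F (p * l₁ t - (1 - p) * Real.cos (Real.pi * t / 2)) /
      (y₁ t * y₂ t)) (Set.Ioo 0 1) :=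
    ContinuousOn.div (cF.comp_continuousOn (by fun_prop)) (c1.mul c2)
      fun t ht => (mul_pos (hy₁pos t ht) (hy₂pos t ht)).ne'
  have dr : ∀ t : ℝ, HasDerivAt (fun t : ℝ => 1 - t) (-1) t :=
    fun t => (hasDerivAt_id t).const_sub 1
  have B := aux_max (fun t => - l₂ (1 - t))
    (fun t => (fun s => deriv l₂ s / (y₂ s / y₁ s)) (1 - t))
    (fun t => (fun s => y₂ s / y₁ s) (1 - t))
    (fun t => (fun t => F (p * l₁ t - (1 - p) * Real.cos (Real.pi * t / 2)) /
      (y₁ t * y₂ t)) (1 - t))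
    (hl₂c.comp cr.continuousOn hr').neg
    (hφc.comp cr.continuousOn hr) (hqc.comp cr.continuousOn hr)
    (fun t ht => div_pos (hy₂pos _ (hr ht)) (hy₁pos _ (hr ht)))
    (fun t ht => div_nonneg (hFnn _) (mul_pos (hy₁pos _ (hr ht)) (hy₂pos _ (hr ht))).le)
    (fun t ht => by
      have h := ((D2 (1 - t) (hr ht)).1.comp t (dr t)).neg
      refine h.congr_deriv ?_
      beta_reduce
      ring)
    (fun t ht => by
      have h := (D2 (1 - t) (hr ht)).2.hasDerivAt
      rw [heq₂ (1 - t) (hr ht)] at h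
      have h := h.comp t (dr t)
      refine h.congr_deriv ?_
      beta_reduce
      ring) (by simp [hbc₄]) (by simp [hbc₂])
  intro t ht
  have b := B (1 - t) (hr ht)
  simp only [sub_sub_cancel] at b
  exact ⟨(A t ht).1, (A t ht).2, by linarith [b.2], by linarith [b.1]⟩
end

section
/- There exists a number R₀ > 0, independent of p ∈ [0,1], with the following property: if l₁, l₂ : [0,1] → ℝ are C² functions satisfying on (0,1) the system (l₁'/φ₁)' = l₁·F(p·l₂ + (1−p)·sin(πt/2))/σ and (l₂'/φ₂)' = F(p·l₁ − (1−p)·cos(πt/2))·l₂/σ, together with the boundary conditions l₁(0) = −1, l₁'(0) = 0, l₂(0) = 0, l₁(1) = 0, l₂(1) = 1, l₂'(1) = 0, then |l₁''(0)| < R₀, |l₂'(0)| < R₀, |l₁'(1)| < R₀ and |l₂''(1)| < R₀ (derivatives at the endpoints taken one-sided). -/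
open Set Filter Topology

lemma mono_aux {f f' : ℝ → ℝ} {a b : ℝ}
    (h : ∀ x ∈ Icc a b, HasDerivAt f (f' x) x) (h0 : ∀ x ∈ Icc a b, 0 ≤ f' x) (hab : a ≤ b) :
    f a ≤ f b := by
  have : MonotoneOn f (Icc a b) := by
    apply monotoneOn_of_deriv_nonneg (convex_Icc a b)
    · exact fun x hx => (h x hx).continuousAt.continuousWithinAt
    · intro x hx
      exact (h x (interior_subset hx)).differentiableAt.differentiableWithinAt
    · intro x hx
      rw [(h x (interior_subset hx)).deriv]
      exact h0 x (interior_subset hx)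
  exact this (left_mem_Icc.2 hab) (right_mem_Icc.2 hab) hab

lemma mp_aux {l w b Q : ℝ → ℝ} (hl : ContinuousOn l (Icc 0 1))
    (hl' : ∀ t ∈ Ioo (0:ℝ) 1, HasDerivAt l (w t * b t) t)
    (hw' : ∀ t ∈ Ioo (0:ℝ) 1, HasDerivAt w (l t * Q t) t)
    (hb : ∀ t ∈ Ioo (0:ℝ) 1, 0 < b t) (hQ : ∀ t ∈ Ioo (0:ℝ) 1, 0 ≤ Q t)
    (h0 : l 0 = -1) (h1 : l 1 = 0) (hw : Tendsto w (𝓝[<] 1) (𝓝 0)) :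
    ∀ t ∈ Ioo (0:ℝ) 1, -1 ≤ l t ∧ l t ≤ 0 ∧ 0 ≤ w t := by
  have hev : ∀ t ∈ Ioo (0:ℝ) 1, ∀ᶠ s in 𝓝[<] (1:ℝ), s ∈ Ioo t 1 := fun t ht =>
    Ioo_mem_nhdsLT ht.2
  have hl1 : Tendsto l (𝓝[<] 1) (𝓝 0) := by
    have := (hl 1 (by simp)).mono_left (nhdsWithin_mono _ (Ioo_subset_Icc_self : Ioo (0:ℝ) 1 ⊆ Icc 0 1))
    rwa [h1, nhdsWithin_Ioo_eq_nhdsLT (by norm_num)] at this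
  have hlw : ∀ t ∈ Ioo (0:ℝ) 1, l t * w t ≤ 0 := by
    intro t ht
    have h2 : Tendsto (fun s => l s * w s) (𝓝[<] 1) (𝓝 0) := by simpa using hl1.mul hw
    apply ge_of_tendsto h2
    filter_upwards [hev t ht] with s hs
    have hsub : ∀ x ∈ Icc t s, x ∈ Ioo (0:ℝ) 1 := fun x hx =>
      ⟨ht.1.trans_le hx.1, hx.2.trans_lt hs.2⟩
    refine mono_aux (f := fun s => l s * w s)
      (fun x hx => (hl' x (hsub x hx)).mul (hw' x (hsub x hx))) ?_ hs.1.le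
    intro x hx
    have e1 := hb x (hsub x hx)
    have e2 := hQ x (hsub x hx)
    have : w x * b x * w x + l x * (l x * Q x) = b x * (w x)^2 + Q x * (l x)^2 := by ring
    rw [this]; positivity
  have hanti : AntitoneOn (fun s => l s ^ 2) (Icc 0 1) := by
    apply antitoneOn_of_deriv_nonpos (convex_Icc 0 1)
    · exact hl.pow 2
    · intro x hx; rw [interior_Icc] at hx
      exact ((hl' x hx).pow 2).differentiableAt.differentiableWithinAt
    · intro x hx; rw [interior_Icc] at hx
      have := (hl' x hx).pow 2
      have e : deriv (fun s => l s ^ 2) x = _ := this.deriv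
      rw [e]
      have h3 := hlw x hx
      have h4 := hb x hx
      norm_num
      nlinarith
  have hle : ∀ t ∈ Ioo (0:ℝ) 1, l t ≤ 0 := by
    intro t ht
    by_contra hc
    push Not at hc
    obtain ⟨s, hs, hs0⟩ : (0:ℝ) ∈ l '' Icc 0 t := by
      apply intermediate_value_Icc ht.1.le (hl.mono (Icc_subset_Icc_right ht.2.le))
      rw [h0]; constructor <;> linarith
    have := hanti ⟨hs.1, hs.2.trans ht.2.le⟩ ⟨ht.1.le, ht.2.le⟩ hs.2
    simp only [hs0] at this
    nlinarith
  intro t ht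
  refine ⟨?_, hle t ht, ?_⟩
  · have := hanti ⟨le_rfl, zero_le_one⟩ ⟨ht.1.le, ht.2.le⟩ ht.1.le
    simp only [h0] at this
    nlinarith [hle t ht]
  · apply le_of_tendsto hw
    filter_upwards [hev t ht] with s hs
    have hsub : ∀ x ∈ Icc t s, x ∈ Ioo (0:ℝ) 1 := fun x hx =>
      ⟨ht.1.trans_le hx.1, hx.2.trans_lt hs.2⟩
    have := mono_aux (f := fun s => - w s) (fun x hx => (hw' x (hsub x hx)).neg)
      (fun x hx => by nlinarith [hle x (hsub x hx), hQ x (hsub x hx)]) hs.1.le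
    simpa using this

/-- elementary bounds for the coefficient functions near zero. -/
lemma const_aux (y₁ y₂ : ℝ → ℝ)
    (hy₁ : ContDiffOn ℝ (⊤ : ℕ∞) y₁ (Set.Ioo (-1 : ℝ) 2))
    (hy₂ : ContDiffOn ℝ (⊤ : ℕ∞) y₂ (Set.Ioo (-1 : ℝ) 2))
    (hy₁pos : ∀ r ∈ Set.Ioo (0 : ℝ) 1, 0 < y₁ r)
    (hy₂pos : ∀ r ∈ Set.Ioo (0 : ℝ) 1, 0 < y₂ r)
    (hy₁0 : y₁ 0 = 0) (hy₁'0 : deriv y₁ 0 = 1) (hy₂0 : 0 < y₂ 0) :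
    ∃ C : ℝ, 1 ≤ C ∧ ∀ t ∈ Ioc (0:ℝ) (1/2), t ≤ C * y₁ t ∧ y₁ t ≤ C * t ∧ y₁ t ≤ t + C * t^2 ∧
      deriv y₁ t ≤ 1 + C * t ∧ 1 ≤ C * y₂ t ∧ y₂ t ≤ C ∧ |deriv y₂ t| ≤ C := by
  have hsub : Icc (0:ℝ) (1/2) ⊆ Ioo (-1) 2 := fun x hx => ⟨by linarith [hx.1], by linarith [hx.2]⟩
  have hd1 : ContDiffOn ℝ (⊤ : ℕ∞) (deriv y₁) (Ioo (-1 : ℝ) 2) :=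
    hy₁.deriv_of_isOpen isOpen_Ioo (by simp)
  have hd2 : ContDiffOn ℝ (⊤ : ℕ∞) (deriv y₂) (Ioo (-1 : ℝ) 2) :=
    hy₂.deriv_of_isOpen isOpen_Ioo (by simp)
  have hdd1 : ContDiffOn ℝ (⊤ : ℕ∞) (deriv (deriv y₁)) (Ioo (-1 : ℝ) 2) :=
    hd1.deriv_of_isOpen isOpen_Ioo (by simp)
  have hne : (Icc (0:ℝ) (1/2)).Nonempty := ⟨0, by norm_num⟩
  obtain ⟨A, hA⟩ := isCompact_Icc.exists_bound_of_continuousOn (hdd1.continuousOn.mono hsub)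
  obtain ⟨B, hB⟩ := isCompact_Icc.exists_bound_of_continuousOn (hd2.continuousOn.mono hsub)
  obtain ⟨D, hD⟩ := isCompact_Icc.exists_bound_of_continuousOn (hy₂.continuousOn.mono hsub)
  obtain ⟨x0, hx0, hmin⟩ := isCompact_Icc.exists_isMinOn hne (hy₂.continuousOn.mono hsub)
  have hx0p : 0 < y₂ x0 := by
    rcases hx0.1.eq_or_lt with h | h
    · rwa [← h]
    · exact hy₂pos _ ⟨h, by linarith [hx0.2]⟩
  have hdiff1 : ∀ x ∈ Icc (0:ℝ) (1/2), DifferentiableAt ℝ y₁ x := fun x hx =>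
    (hy₁.differentiableOn (by simp)).differentiableAt (isOpen_Ioo.mem_nhds (hsub hx))
  have hdiffd1 : ∀ x ∈ Icc (0:ℝ) (1/2), DifferentiableAt ℝ (deriv y₁) x := fun x hx =>
    (hd1.differentiableOn (by simp)).differentiableAt (isOpen_Ioo.mem_nhds (hsub hx))
  have hds : ContinuousOn (dslope y₁ 0) (Icc (0:ℝ) (1/2)) := by
    intro x hx
    apply ContinuousAt.continuousWithinAt
    rcases eq_or_ne x 0 with h | h
    · subst h
      exact continuousAt_dslope_same.2 (hdiff1 0 hx)
    · exact (continuousAt_dslope_of_ne h).2 (hdiff1 x hx).continuousAt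
  obtain ⟨x1, hx1, hmin1⟩ := isCompact_Icc.exists_isMinOn hne hds
  have hx1p : 0 < dslope y₁ 0 x1 := by
    rcases hx1.1.eq_or_lt with h | h
    · rw [← h]; simp [hy₁'0]
    · rw [dslope_of_ne _ h.ne', slope_def_field, hy₁0]
      have := hy₁pos x1 ⟨h, by linarith [hx1.2]⟩
      simp only [sub_zero]; positivity
  set m := y₂ x0
  set k := dslope y₁ 0 x1
  have hA0 : 0 ≤ A := (norm_nonneg _).trans (hA 0 ⟨le_rfl, by norm_num⟩)
  have hB0 : 0 ≤ B := (norm_nonneg _).trans (hB 0 ⟨le_rfl, by norm_num⟩)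
  have hD0 : 0 ≤ D := (norm_nonneg _).trans (hD 0 ⟨le_rfl, by norm_num⟩)
  have hm : 0 < m⁻¹ := by positivity
  have hk : 0 < k⁻¹ := by positivity
  have hder : ∀ t ∈ Icc (0:ℝ) (1/2), deriv y₁ t ≤ 1 + A * t := by
    intro t ht
    have hs : ∀ x ∈ Icc 0 t, x ∈ Icc (0:ℝ) (1/2) := fun x hx => ⟨hx.1, hx.2.trans ht.2⟩
    have := mono_aux (f := fun s => A * s - deriv y₁ s) (f' := fun s => A * 1 - deriv (deriv y₁) s)
      (fun x hx => ((hasDerivAt_id x).const_mul A).sub (hdiffd1 x (hs x hx)).hasDerivAt)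
      (fun x hx => by
        have := hA x (hs x hx); rw [Real.norm_eq_abs] at this
        linarith [le_abs_self (deriv (deriv y₁) x)]) ht.1
    simp only [hy₁'0] at this
    linarith
  have hy : ∀ t ∈ Icc (0:ℝ) (1/2), y₁ t ≤ t + A * t^2 := by
    intro t ht
    have hs : ∀ x ∈ Icc 0 t, x ∈ Icc (0:ℝ) (1/2) := fun x hx => ⟨hx.1, hx.2.trans ht.2⟩
    have := mono_aux (f := fun s => s + A * s^2 - y₁ s)
      (f' := fun s => 1 + A * (((2:ℕ):ℝ) * s^(2-1) * 1) - deriv y₁ s)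
      (fun x hx => ((hasDerivAt_id x).add (((hasDerivAt_id x).pow 2).const_mul A)).sub
        (hdiff1 x (hs x hx)).hasDerivAt)
      (fun x hx => by
        have := hder x (hs x hx)
        have h2 : 0 ≤ A * x := mul_nonneg hA0 hx.1
        norm_num; linarith) ht.1
    simp only [hy₁0] at this
    linarith
  refine ⟨1 + A + B + D + m⁻¹ + k⁻¹, by linarith, ?_⟩
  intro t ht
  have ht' : t ∈ Icc (0:ℝ) (1/2) := ⟨ht.1.le, ht.2⟩
  have ht0 := ht.1
  have hyp := hy₁pos t ⟨ht.1, by linarith [ht.2]⟩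
  have hyp2 := hy₂pos t ⟨ht.1, by linarith [ht.2]⟩
  refine ⟨?_, ?_, ?_, ?_, ?_, ?_, ?_⟩
  · have h : k ≤ dslope y₁ 0 t := hmin1 ht'
    rw [dslope_of_ne _ ht.1.ne', slope_def_field, hy₁0, sub_zero, sub_zero, le_div_iff₀ ht0] at h
    have : t ≤ k⁻¹ * y₁ t := by
      rw [inv_mul_eq_div, le_div_iff₀ hx1p]; linarith
    nlinarith
  · have := hy t ht'
    have h3 : A * t^2 ≤ A * t := by
      apply mul_le_mul_of_nonneg_left _ hA0; nlinarith [ht.2]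
    nlinarith
  · have := hy t ht'
    nlinarith [sq_nonneg t]
  · have := hder t ht'
    nlinarith
  · have h : m ≤ y₂ t := hmin ht'
    have : 1 ≤ m⁻¹ * y₂ t := by
      rw [inv_mul_eq_div, le_div_iff₀ hx0p]; linarith
    nlinarith
  · have := hD t ht'; rw [Real.norm_eq_abs] at this
    linarith [le_abs_self (y₂ t)]
  · have := hB t ht'; rw [Real.norm_eq_abs] at this
    linarith

set_option maxHeartbeats 4000000 in
lemma half_aux (y₁ y₂ : ℝ → ℝ)
    (hy₁ : ContDiffOn ℝ (⊤ : ℕ∞) y₁ (Set.Ioo (-1 : ℝ) 2))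
    (hy₂ : ContDiffOn ℝ (⊤ : ℕ∞) y₂ (Set.Ioo (-1 : ℝ) 2))
    (hy₁pos : ∀ r ∈ Set.Ioo (0 : ℝ) 1, 0 < y₁ r)
    (hy₂pos : ∀ r ∈ Set.Ioo (0 : ℝ) 1, 0 < y₂ r)
    (hy₁0 : y₁ 0 = 0) (hy₁'0 : deriv y₁ 0 = 1) (hy₂0 : 0 < y₂ 0) :
    ∃ R : ℝ, 0 < R ∧ ∀ p ∈ Icc (0:ℝ) 1, ∀ l₁ l₂ w₁ w₂ : ℝ → ℝ,
      ContinuousOn l₁ (Icc 0 1) → ContinuousOn l₂ (Icc 0 1) →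
      (∀ t ∈ Ioo (0:ℝ) 1, HasDerivAt l₁ (w₁ t * (y₁ t / y₂ t)) t) →
      (∀ t ∈ Ioo (0:ℝ) 1, HasDerivAt l₂ (w₂ t * (y₂ t / y₁ t)) t) →
      (∀ t ∈ Ioo (0:ℝ) 1, HasDerivAt w₁
        (l₁ t * (p * l₂ t + (1 - p) * Real.sin (Real.pi * t / 2))^2 / (y₁ t * y₂ t)) t) →
      (∀ t ∈ Ioo (0:ℝ) 1, HasDerivAt w₂
        ((p * l₁ t - (1 - p) * Real.cos (Real.pi * t / 2))^2 * l₂ t / (y₁ t * y₂ t)) t) →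
      (∀ t ∈ Ioo (0:ℝ) 1, -1 ≤ l₁ t ∧ l₁ t ≤ 0 ∧ 0 ≤ w₁ t) →
      (∀ t ∈ Ioo (0:ℝ) 1, 0 ≤ l₂ t ∧ l₂ t ≤ 1 ∧ 0 ≤ w₂ t) →
      l₁ 0 = -1 → l₂ 0 = 0 → Tendsto w₂ (𝓝[>] 0) (𝓝 0) →
      ∀ t ∈ Ioc (0:ℝ) (1/2), l₂ t ≤ R * t ∧ w₁ t * (y₁ t / y₂ t) ≤ R * t := by
  obtain ⟨C, hC1, hC⟩ := const_aux y₁ y₂ hy₁ hy₂ hy₁pos hy₂pos hy₁0 hy₁'0 hy₂0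
  have hC0 : 0 < C := by linarith
  have hin : ∀ t ∈ Ioc (0:ℝ) (1/2), t ∈ Ioo (0:ℝ) 1 := fun t ht => ⟨ht.1, by linarith [ht.2]⟩
  -- bounds for b = y₁ / y₂
  have hbu : ∀ t ∈ Ioc (0:ℝ) (1/2), y₁ t / y₂ t ≤ C^2 * t := by
    intro t ht
    obtain ⟨h1, h2, h3, h4, h5, h6, h7⟩ := hC t ht
    rw [div_le_iff₀ (hy₂pos t (hin t ht))]
    have : C * t * 1 ≤ C * t * (C * y₂ t) :=
      mul_le_mul_of_nonneg_left h5 (mul_nonneg hC0.le ht.1.le)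
    nlinarith
  have hbl : ∀ t ∈ Ioc (0:ℝ) (1/2), t ≤ C^2 * (y₁ t / y₂ t) := by
    intro t ht
    obtain ⟨h1, h2, h3, h4, h5, h6, h7⟩ := hC t ht
    rw [← mul_div_assoc, le_div_iff₀ (hy₂pos t (hin t ht))]
    have : t * y₂ t ≤ (C * y₁ t) * C :=
      mul_le_mul h1 h6 (hy₂pos t (hin t ht)).le (mul_nonneg hC0.le (hy₁pos t (hin t ht)).le)
    nlinarith
  have hsig : ∀ t ∈ Ioc (0:ℝ) (1/2), t ≤ C^2 * (y₁ t * y₂ t) := by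
    intro t ht
    obtain ⟨h1, h2, h3, h4, h5, h6, h7⟩ := hC t ht
    have : t * 1 ≤ (C * y₁ t) * (C * y₂ t) :=
      mul_le_mul h1 h5 zero_le_one (mul_nonneg hC0.le (hy₁pos t (hin t ht)).le)
    nlinarith
  obtain ⟨D, hDdef⟩ : ∃ D, D = 9 * C^4 := ⟨_, rfl⟩
  have hD1 : 1 ≤ D := by
    have : 1 ≤ C^4 := one_le_pow₀ hC1
    linarith
  obtain ⟨M, hMdef⟩ : ∃ M, M = (2 * C + 2 * D * C) * C + C^4 := ⟨_, rfl⟩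
  have hM0 : 0 < M := by rw [hMdef]; positivity
  obtain ⟨K, hKdef⟩ : ∃ K, K = 2 * Real.exp (M * C^2 * (1/2)) := ⟨_, rfl⟩
  have hK0 : 0 < K := by rw [hKdef]; positivity
  obtain ⟨N, hNdef⟩ : ∃ N, N = (K + 2)^2 * C^2 := ⟨_, rfl⟩
  have hN0 : 0 < N := by rw [hNdef]; positivity
  refine ⟨K + (16 * C^2 + N) * C^2, by positivity, ?_⟩
  intro p hp l₁ l₂ w₁ w₂ hc1 hc2 hl1 hl2 hw1 hw2 hb1 hb2 hl10 hl20 hw20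
  have hp0 := hp.1
  have hp1 : 0 ≤ 1 - p := by linarith [hp.2]
  have hpi0 := Real.pi_pos
  have hpi4 := Real.pi_le_four
  have hsin : ∀ t ∈ Ioo (0:ℝ) 1, 0 ≤ Real.sin (Real.pi * t / 2) ∧
      Real.sin (Real.pi * t / 2) ≤ 1 ∧ Real.sin (Real.pi * t / 2) ≤ 2 * t := by
    intro t ht
    have h0 : 0 ≤ Real.pi * t / 2 := by have := ht.1; positivity
    refine ⟨Real.sin_nonneg_of_nonneg_of_le_pi h0 (by nlinarith [ht.2]), Real.sin_le_one _, ?_⟩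
    have := Real.sin_le h0
    nlinarith [ht.1]
  -- w₁ is antitone
  have hw1anti : ∀ s t, 0 < s → s ≤ t → t ≤ 1/2 → w₁ t ≤ w₁ s := by
    intro s t hs hst ht
    have hsub : ∀ x ∈ Icc s t, x ∈ Ioo (0:ℝ) 1 := fun x hx =>
      ⟨hs.trans_le hx.1, by linarith [hx.2]⟩
    have := mono_aux (f := fun s => - w₁ s) (fun x hx => (hw1 x (hsub x hx)).neg)
      (fun x hx => by
        have e1 := hy₁pos x (hsub x hx)
        have e2 := hy₂pos x (hsub x hx)
        rw [neg_nonneg]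
        exact div_nonpos_of_nonpos_of_nonneg
          (mul_nonpos_of_nonpos_of_nonneg (hb1 x (hsub x hx)).2.1 (sq_nonneg _)) (by positivity)) hst
    linarith
  -- bound at 1/2
  have hw1h : w₁ (1/2) ≤ 16 * C^2 := by
    obtain ⟨s, hs, hseq⟩ := exists_hasDerivAt_eq_slope l₁ (fun t => w₁ t * (y₁ t / y₂ t))
      (show (1/4:ℝ) < 1/2 by norm_num)
      (hc1.mono (Icc_subset_Icc (by norm_num) (by norm_num)))
      (fun x hx => hl1 x ⟨by linarith [hx.1], by linarith [hx.2]⟩)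
    have hs' : s ∈ Ioc (0:ℝ) (1/2) := ⟨by linarith [hs.1], hs.2.le⟩
    have h1 := (hb1 (1/2) (by norm_num)).2.1
    have h2 := (hb1 (1/4) (by norm_num)).1
    have h3 : w₁ s * (y₁ s / y₂ s) ≤ 4 := by
      rw [hseq, div_le_iff₀ (by norm_num)]; linarith
    have h4 := hw1anti s (1/2) hs'.1 hs'.2 le_rfl
    have h5 := hbl s hs'
    have h6 := (hb1 s (hin s hs')).2.2
    have h7 : w₁ s * s ≤ w₁ s * (C^2 * (y₁ s / y₂ s)) := mul_le_mul_of_nonneg_left h5 h6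
    have h8 : w₁ s * (1/4) ≤ w₁ s * s := mul_le_mul_of_nonneg_left hs.1.le h6
    have h9 : C^2 * (w₁ s * (y₁ s / y₂ s)) ≤ C^2 * 4 :=
      mul_le_mul_of_nonneg_left h3 (by positivity)
    nlinarith
  -- crude bound for w₁
  have hw1crude : ∀ t ∈ Ioc (0:ℝ) (1/2), w₁ t ≤ C^2 / t + 16 * C^2 := by
    intro t ht
    have hsub : ∀ x ∈ Icc t (1/2), x ∈ Ioc (0:ℝ) (1/2) := fun x hx =>
      ⟨ht.1.trans_le hx.1, hx.2⟩
    have := mono_aux (f := fun s => w₁ s - C^2 * s⁻¹)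
      (fun x hx => (hw1 x (hin x (hsub x hx))).sub
        ((hasDerivAt_inv (hsub x hx).1.ne').const_mul (C^2)))
      (fun x hx => by
        have hx' := hin x (hsub x hx)
        have hx0 := hx'.1
        have e1 := hy₁pos x hx'
        have e2 := hy₂pos x hx'
        have e3 := hsig x (hsub x hx)
        obtain ⟨s0, s1, s2⟩ := hsin x hx'
        obtain ⟨b1, b2, b3⟩ := hb1 x hx'
        obtain ⟨c1, c2, c3⟩ := hb2 x hx'
        set q := p * l₂ x + (1 - p) * Real.sin (Real.pi * x / 2) with hq
        have q0 : 0 ≤ q := by positivity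
        have q1 : q ≤ 1 := by nlinarith
        have q2 : q^2 ≤ 1 := by nlinarith
        have q3 : -1 ≤ l₁ x * q^2 := by nlinarith [sq_nonneg q]
        have e4 : -(C^2 / x) ≤ l₁ x * q^2 / (y₁ x * y₂ x) := by
          have : 1 / (y₁ x * y₂ x) ≤ C^2 / x := by
            rw [div_le_div_iff₀ (by positivity) hx0]; linarith
          have h5 : (-1) / (y₁ x * y₂ x) ≤ l₁ x * q^2 / (y₁ x * y₂ x) :=
            div_le_div_of_nonneg_right q3 (by positivity)
          rw [neg_div] at h5
          linarith
        have e5 : C^2 / x ≤ C^2 * (x^2)⁻¹ := by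
          rw [← div_eq_mul_inv]
          apply div_le_div_of_nonneg_left (by positivity) (by positivity)
          nlinarith [hx'.2]
        linarith) ht.2
    have h2 : (0:ℝ) < C^2 * (1/2 : ℝ)⁻¹ := by positivity
    rw [div_eq_mul_inv]
    linarith
  have hl1' : ∀ t ∈ Ioc (0:ℝ) (1/2), w₁ t * (y₁ t / y₂ t) ≤ D := by
    intro t ht
    have h1 := hw1crude t ht
    have h2 := hbu t ht
    have ht0 := ht.1
    have h4 : w₁ t * (y₁ t / y₂ t) ≤ (C^2 / t + 16 * C^2) * (C^2 * t) :=
      mul_le_mul h1 h2 (div_nonneg (hy₁pos t (hin t ht)).le (hy₂pos t (hin t ht)).le)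
        (by positivity)
    have h5 : (C^2 / t + 16 * C^2) * (C^2 * t) = C^4 + 16 * C^4 * t := by
      field_simp
    have h6 : C^4 * t ≤ C^4 * (1/2) := mul_le_mul_of_nonneg_left ht.2 (by positivity)
    rw [hDdef]; linarith
  have hl1lin : ∀ t ∈ Ioc (0:ℝ) (1/2), l₁ t ≤ -1 + D * t := by
    intro t ht
    obtain ⟨s, hs, hseq⟩ := exists_hasDerivAt_eq_slope l₁ (fun t => w₁ t * (y₁ t / y₂ t))
      ht.1 (hc1.mono (Icc_subset_Icc le_rfl (by linarith [ht.2])))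
      (fun x hx => hl1 x ⟨by linarith [hx.1], by linarith [hx.2, ht.2]⟩)
    have := hl1' s ⟨hs.1, by linarith [hs.2, ht.2]⟩
    rw [hseq, div_le_iff₀ (by linarith [ht.1]), hl10] at this
    linarith
  have hF1 : ∀ t ∈ Ioc (0:ℝ) (1/2),
      1 - 2 * D * t ≤ (p * l₁ t - (1 - p) * Real.cos (Real.pi * t / 2))^2 := by
    intro t ht
    have h1 := hl1lin t ht
    have h2 := Real.one_sub_sq_div_two_le_cos (x := Real.pi * t / 2)
    have h3 : (Real.pi * t / 2)^2 / 2 ≤ t := by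
      have : (Real.pi * t / 2)^2 ≤ (2 * t)^2 := by
        apply pow_le_pow_left₀
        · have := ht.1; positivity
        · nlinarith [ht.1]
      nlinarith [ht.1, ht.2]
    have h4 : 1 - D * t ≤ Real.cos (Real.pi * t / 2) := by nlinarith [ht.1]
    have h5 : 1 - D * t ≤ -(p * l₁ t - (1 - p) * Real.cos (Real.pi * t / 2)) := by
      have e1 := mul_le_mul_of_nonneg_left h1 hp0
      have e2 := mul_le_mul_of_nonneg_left h4 hp1
      linarith
    set q := p * l₁ t - (1 - p) * Real.cos (Real.pi * t / 2)
    nlinarith [sq_nonneg (q + 1)]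
  -- Wronskian-type function
  have hyd : ∀ t ∈ Ioo (0:ℝ) 1, HasDerivAt y₁ (deriv y₁ t) t := fun t ht =>
    ((hy₁.differentiableOn (by simp)).differentiableAt
      (isOpen_Ioo.mem_nhds ⟨by linarith [ht.1], by linarith [ht.2]⟩)).hasDerivAt
  have hyd2 : ∀ t ∈ Ioo (0:ℝ) 1, HasDerivAt y₂ (deriv y₂ t) t := fun t ht =>
    ((hy₂.differentiableOn (by simp)).differentiableAt
      (isOpen_Ioo.mem_nhds ⟨by linarith [ht.1], by linarith [ht.2]⟩)).hasDerivAt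
  have hWpos : ∀ t ∈ Ioc (0:ℝ) (1/2), 0 ≤ w₂ t * t - y₁ t / y₂ t * l₂ t + M * t^2 * l₂ t := by
    intro t ht
    have hlim : Tendsto (fun t => w₂ t * t - y₁ t / y₂ t * l₂ t + M * t^2 * l₂ t)
        (𝓝[>] 0) (𝓝 0) := by
      have i1 : Tendsto (fun t : ℝ => t) (𝓝[>] 0) (𝓝 0) := tendsto_nhdsWithin_of_tendsto_nhds tendsto_id
      have c1 : ContinuousAt y₁ 0 := (hy₁.continuousOn).continuousAt (isOpen_Ioo.mem_nhds (by norm_num))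
      have c2 : ContinuousAt y₂ 0 := (hy₂.continuousOn).continuousAt (isOpen_Ioo.mem_nhds (by norm_num))
      have i2 : Tendsto y₁ (𝓝[>] 0) (𝓝 (y₁ 0)) := tendsto_nhdsWithin_of_tendsto_nhds c1
      have i3 : Tendsto y₂ (𝓝[>] 0) (𝓝 (y₂ 0)) := tendsto_nhdsWithin_of_tendsto_nhds c2
      have i4 : Tendsto l₂ (𝓝[>] 0) (𝓝 (l₂ 0)) := by
        have := (hc2 0 (by simp)).mono_left
          (nhdsWithin_mono _ (Ioo_subset_Icc_self : Ioo (0:ℝ) 1 ⊆ Icc 0 1))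
        rwa [nhdsWithin_Ioo_eq_nhdsGT (by norm_num)] at this
      have := ((hw20.mul i1).sub ((i2.div i3 hy₂0.ne').mul i4)).add (((i1.pow 2).const_mul M).mul i4)
      simpa [hl20] using this
    apply le_of_tendsto hlim
    filter_upwards [Ioo_mem_nhdsGT ht.1] with s hs
    have hsub : ∀ x ∈ Icc s t, x ∈ Ioc (0:ℝ) (1/2) := fun x hx =>
      ⟨hs.1.trans_le hx.1, hx.2.trans ht.2⟩
    refine mono_aux (f := fun t => w₂ t * t - y₁ t / y₂ t * l₂ t + M * t^2 * l₂ t)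
      (fun x hx => by
        have hx' := hin x (hsub x hx)
        exact (((hw2 x hx').mul (hasDerivAt_id x)).sub
          (((hyd x hx').div (hyd2 x hx') (hy₂pos x hx').ne').mul (hl2 x hx'))).add
          ((((hasDerivAt_id x).pow 2).const_mul M).mul (hl2 x hx'))) ?_ hs.2.le
    intro x hx
    have hx' := hin x (hsub x hx)
    have hx0 := hx'.1
    have e1 := hy₁pos x hx'
    have e2 := hy₂pos x hx'
    obtain ⟨h1, h2, h3, h4, h5, h6, h7⟩ := hC x (hsub x hx)
    obtain ⟨c1, c2, c3⟩ := hb2 x hx'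
    have f1 := hF1 x (hsub x hx)
    set q := (p * l₁ x - (1 - p) * Real.cos (Real.pi * x / 2))^2 with hq
    -- key coefficient
    have key : -(M * x) ≤ q * x / (y₁ x * y₂ x) -
        (deriv y₁ x * y₂ x - y₁ x * deriv y₂ x) / (y₂ x)^2 := by
      have k1 : 1 - C * x ≤ x / y₁ x := by
        rw [le_div_iff₀ e1]
        rcases le_total (1 - C * x) 0 with h | h
        · nlinarith
        · have := mul_le_mul_of_nonneg_left h3 h
          have h8 : 0 ≤ C^2 * x^3 := by positivity
          nlinarith
      have k2 : x / y₁ x ≤ C := by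
        rw [div_le_iff₀ e1]; exact h1
      have k0 : 0 ≤ x / y₁ x := by positivity
      have k3 : 1 - (C + 2 * D * C) * x ≤ q * (x / y₁ x) := by
        have a1 := mul_le_mul_of_nonneg_right f1 k0
        have a2 : 2 * D * x * (x / y₁ x) ≤ 2 * D * x * C :=
          mul_le_mul_of_nonneg_left k2 (by positivity)
        linarith
      have k4 : 1 / y₂ x ≤ C := by rw [div_le_iff₀ e2]; exact h5
      have k40 : 0 ≤ 1 / y₂ x := by positivity
      have k5 : -(C^4 * x) ≤ y₁ x * deriv y₂ x * (1 / y₂ x)^2 := by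
        have a1 : |y₁ x * deriv y₂ x * (1 / y₂ x)^2| ≤ (C * x) * C * C^2 := by
          rw [abs_mul, abs_mul, abs_of_pos e1, abs_of_nonneg (sq_nonneg (1 / y₂ x))]
          gcongr
        have := neg_le_of_abs_le a1
        linarith
      have k6 : q * x / (y₁ x * y₂ x) - (deriv y₁ x * y₂ x - y₁ x * deriv y₂ x) / (y₂ x)^2
          = (q * (x / y₁ x) - deriv y₁ x) * (1 / y₂ x) + y₁ x * deriv y₂ x * (1 / y₂ x)^2 := by
        field_simp
        ring
      have k7 : -((2 * C + 2 * D * C) * x) ≤ q * (x / y₁ x) - deriv y₁ x := by linarith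
      have k8 := mul_le_mul_of_nonneg_right k7 k40
      have k9 : (2 * C + 2 * D * C) * x * (1 / y₂ x) ≤ (2 * C + 2 * D * C) * x * C :=
        mul_le_mul_of_nonneg_left k4 (by positivity)
      rw [k6, hMdef]
      linarith
    have key2 := mul_le_mul_of_nonneg_right key c1
    have key3 : 0 ≤ M * x^2 * (w₂ x * (y₂ x / y₁ x)) := by positivity
    have key4 : 0 ≤ M * x * l₂ x := by positivity
    have expand : q * l₂ x / (y₁ x * y₂ x) * x + w₂ x * 1 -
        ((deriv y₁ x * y₂ x - y₁ x * deriv y₂ x) / y₂ x ^ 2 * l₂ x +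
          y₁ x / y₂ x * (w₂ x * (y₂ x / y₁ x))) +
        (M * (2 * x) * l₂ x + M * x^2 * (w₂ x * (y₂ x / y₁ x))) =
        (q * x / (y₁ x * y₂ x) -
        (deriv y₁ x * y₂ x - y₁ x * deriv y₂ x) / (y₂ x)^2) * l₂ x + 2 * (M * x * l₂ x) +
         M * x^2 * (w₂ x * (y₂ x / y₁ x)) := by
      field_simp
      ring
    have goal' : 0 ≤ q * l₂ x / (y₁ x * y₂ x) * x + w₂ x * 1 -
        ((deriv y₁ x * y₂ x - y₁ x * deriv y₂ x) / y₂ x ^ 2 * l₂ x +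
          y₁ x / y₂ x * (w₂ x * (y₂ x / y₁ x))) +
        (M * (2 * x) * l₂ x + M * x^2 * (w₂ x * (y₂ x / y₁ x))) := by
      rw [expand]; linarith
    refine goal'.trans_eq ?_
    simp
  have hl2lin : ∀ t ∈ Ioc (0:ℝ) (1/2), l₂ t ≤ K * t := by
    intro t ht
    have hsub : ∀ x ∈ Icc t (1/2), x ∈ Ioc (0:ℝ) (1/2) := fun x hx =>
      ⟨ht.1.trans_le hx.1, hx.2⟩
    have := mono_aux (f := fun s => Real.exp (M * C^2 * s) * (l₂ s / s))
      (f' := fun s => Real.exp (M * C^2 * s) * (M * C^2 * 1) * (l₂ s / s) +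
        Real.exp (M * C^2 * s) * ((w₂ s * (y₂ s / y₁ s) * s - l₂ s * 1) / s^2))
      (fun x hx => (((hasDerivAt_id x).const_mul (M * C^2)).exp).mul
        ((hl2 x (hin x (hsub x hx))).div (hasDerivAt_id x) (hsub x hx).1.ne'))
      (fun x hx => by
        have hx' := hin x (hsub x hx)
        have hx0 := hx'.1
        have e1 := hy₁pos x hx'
        have e2 := hy₂pos x hx'
        have hW := hWpos x (hsub x hx)
        have hb := hbl x (hsub x hx)
        obtain ⟨c1, c2, c3⟩ := hb2 x hx'
        have g1 : 0 ≤ M * C^2 * x * l₂ x + (w₂ x * (y₂ x / y₁ x) * x - l₂ x) := by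
          have j1 : M * x * l₂ x * x ≤ M * x * l₂ x * (C^2 * (y₁ x / y₂ x)) :=
            mul_le_mul_of_nonneg_left hb (by positivity)
          have j2 : 0 ≤ (y₁ x / y₂ x) *
              (M * C^2 * x * l₂ x + (w₂ x * (y₂ x / y₁ x) * x - l₂ x)) := by
            have : (y₁ x / y₂ x) * (M * C^2 * x * l₂ x + (w₂ x * (y₂ x / y₁ x) * x - l₂ x))
              = M * x * l₂ x * (C^2 * (y₁ x / y₂ x)) + w₂ x * x - y₁ x / y₂ x * l₂ x := by
              field_simp
              ring
            rw [this]; nlinarith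
          exact nonneg_of_mul_nonneg_right j2 (by positivity)
        have g2 : Real.exp (M * C^2 * x) * (M * C^2 * 1) * (l₂ x / x) +
            Real.exp (M * C^2 * x) * ((w₂ x * (y₂ x / y₁ x) * x - l₂ x * 1) / x^2)
            = Real.exp (M * C^2 * x) *
              (M * C^2 * x * l₂ x + (w₂ x * (y₂ x / y₁ x) * x - l₂ x)) / x^2 := by
          field_simp
        rw [g2]
        exact div_nonneg (mul_nonneg (Real.exp_pos _).le g1) (sq_nonneg _)) ht.2
    have ht0 := ht.1
    obtain ⟨c1, c2, c3⟩ := hb2 t (hin t ht)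
    have h1 : 1 ≤ Real.exp (M * C^2 * t) := Real.one_le_exp (by positivity)
    have h2 : l₂ t / t ≤ Real.exp (M * C^2 * t) * (l₂ t / t) :=
      le_mul_of_one_le_left (by positivity) h1
    have h3 : l₂ (1/2) ≤ 1 := (hb2 (1/2) (by norm_num)).2.1
    have h4 : Real.exp (M * C^2 * (1/2)) * (l₂ (1/2) / (1/2)) ≤ K := by
      rw [hKdef]
      nlinarith [Real.exp_pos (M * C^2 * (1/2))]
    rw [← div_le_iff₀ ht0]
    linarith
  have hw1fin : ∀ t ∈ Ioc (0:ℝ) (1/2), w₁ t ≤ 16 * C^2 + N := by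
    intro t ht
    have hsub : ∀ x ∈ Icc t (1/2), x ∈ Ioc (0:ℝ) (1/2) := fun x hx =>
      ⟨ht.1.trans_le hx.1, hx.2⟩
    have := mono_aux (f := fun s => w₁ s + N * s)
      (fun x hx => (hw1 x (hin x (hsub x hx))).add ((hasDerivAt_id x).const_mul N))
      (fun x hx => by
        have hx' := hin x (hsub x hx)
        have hx0 := hx'.1
        have e1 := hy₁pos x hx'
        have e2 := hy₂pos x hx'
        have e3 := hsig x (hsub x hx)
        obtain ⟨s0, s1, s2⟩ := hsin x hx'
        obtain ⟨b1, b2, b3⟩ := hb1 x hx'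
        obtain ⟨c1, c2, c3⟩ := hb2 x hx'
        have c4 := hl2lin x (hsub x hx)
        set q := p * l₂ x + (1 - p) * Real.sin (Real.pi * x / 2) with hq
        have q0 : 0 ≤ q := by positivity
        have q1 : q ≤ (K + 2) * x := by
          have a1 : p * l₂ x ≤ 1 * (K * x) := mul_le_mul hp.2 c4 c1 zero_le_one
          have a2 : (1 - p) * Real.sin (Real.pi * x / 2) ≤ 1 * (2 * x) :=
            mul_le_mul (by linarith) s2 s0 zero_le_one
          linarith
        have q2 : q^2 ≤ (K+2)^2 * x^2 := by
          rw [← mul_pow]; exact pow_le_pow_left₀ q0 q1 2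
        have q3 : -((K+2)^2 * x^2) ≤ l₁ x * q^2 := by nlinarith [sq_nonneg q]
        have e4 : -N ≤ l₁ x * q^2 / (y₁ x * y₂ x) := by
          rw [le_div_iff₀ (by positivity)]
          have a1 : (K+2)^2 * x ≤ (K+2)^2 * (C^2 * (y₁ x * y₂ x)) :=
            mul_le_mul_of_nonneg_left e3 (by positivity)
          have a2 : (K+2)^2 * x^2 ≤ (K+2)^2 * x := 
            mul_le_mul_of_nonneg_left (by nlinarith [hx'.2]) (by positivity)
          rw [hNdef]; linarith
        linarith) ht.2
    have : 0 ≤ N * t := mul_nonneg hN0.le ht.1.le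
    linarith
  intro t ht
  have ht0 := ht.1
  constructor
  · have := hl2lin t ht
    have h2 : 0 ≤ (16 * C^2 + N) * C^2 * t := by positivity
    linarith
  · have h1 := hw1fin t ht
    have h2 := hbu t ht
    have h4 : w₁ t * (y₁ t / y₂ t) ≤ (16 * C^2 + N) * (C^2 * t) :=
      mul_le_mul h1 h2 (div_nonneg (hy₁pos t (hin t ht)).le (hy₂pos t (hin t ht)).le)
        (by positivity)
    have h5 : 0 ≤ K * t := by positivity
    linarith

lemma dw_bound {g : ℝ → ℝ} {x R : ℝ} (hx : x ∈ Icc (0:ℝ) 1) (hR : 0 ≤ R)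
    (h : ∀ᶠ t in 𝓝[Icc (0:ℝ) 1 \ {x}] x, |g t - g x| ≤ R * |t - x|) :
    |derivWithin g (Icc 0 1) x| ≤ R := by
  by_cases hd : DifferentiableWithinAt ℝ g (Icc 0 1) x
  · have hne : (𝓝[Icc (0:ℝ) 1 \ {x}] x).NeBot := by
      have := (uniqueDiffOn_Icc (zero_lt_one' ℝ)) x hx
      exact accPt_principal_iff_nhdsWithin.1 this.accPt
    have := (hasDerivWithinAt_iff_tendsto_slope.1 hd.hasDerivWithinAt).abs
    apply le_of_tendsto this
    filter_upwards [h, self_mem_nhdsWithin] with t ht htm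
    have : 0 < |t - x| := abs_pos.2 (sub_ne_zero.2 htm.2)
    rw [slope_def_field, abs_div, div_le_iff₀ this]
    exact ht
  · rw [derivWithin_zero_of_not_differentiableWithinAt hd]; simpa using hR

lemma ev0 : ∀ᶠ t in 𝓝[Icc (0:ℝ) 1 \ {0}] (0:ℝ), t ∈ Ioc (0:ℝ) (1/2) := by
  have : ∀ᶠ t in 𝓝[Icc (0:ℝ) 1 \ {0}] (0:ℝ), t < 1/2 :=
    mem_nhdsWithin_of_mem_nhds (Iio_mem_nhds (by norm_num))
  filter_upwards [this, self_mem_nhdsWithin] with t h1 h2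
  exact ⟨lt_of_le_of_ne h2.1.1 (Ne.symm h2.2), h1.le⟩

lemma ev1 : ∀ᶠ t in 𝓝[Icc (0:ℝ) 1 \ {1}] (1:ℝ), 1 - t ∈ Ioc (0:ℝ) (1/2) := by
  have : ∀ᶠ t in 𝓝[Icc (0:ℝ) 1 \ {1}] (1:ℝ), 1/2 < t :=
    mem_nhdsWithin_of_mem_nhds (Ioi_mem_nhds (by norm_num))
  filter_upwards [this, self_mem_nhdsWithin] with t h1 h2
  have : t < 1 := lt_of_le_of_ne h2.1.2 h2.2
  exact ⟨by linarith, by linarith⟩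

lemma reg_aux {l u v : ℝ → ℝ} (hl : ContDiffOn ℝ 2 l (Icc 0 1))
    (hu : ContDiffOn ℝ (⊤ : ℕ∞) u (Set.Ioo (-1 : ℝ) 2))
    (hv : ContDiffOn ℝ (⊤ : ℕ∞) v (Set.Ioo (-1 : ℝ) 2))
    (hup : ∀ r ∈ Set.Ioo (0 : ℝ) 1, 0 < u r)
    (hvp : ∀ r ∈ Set.Ioo (0 : ℝ) 1, 0 < v r) :
    (∀ t ∈ Ioo (0:ℝ) 1, HasDerivAt l (deriv l t / (u t / v t) * (u t / v t)) t) ∧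
    (∀ t ∈ Ioo (0:ℝ) 1, DifferentiableAt ℝ (fun s => deriv l s / (u s / v s)) t) ∧
    (∀ t ∈ Ioo (0:ℝ) 1, derivWithin l (Icc 0 1) t = deriv l t / (u t / v t) * (u t / v t)) ∧
    (v 0 = 0 → 0 < u 0 → Tendsto (fun s => deriv l s / (u s / v s)) (𝓝[>] 0) (𝓝 0)) ∧
    (v 1 = 0 → 0 < u 1 → Tendsto (fun s => deriv l s / (u s / v s)) (𝓝[<] 1) (𝓝 0)) := by
  have hcancel : ∀ t ∈ Ioo (0:ℝ) 1, deriv l t / (u t / v t) * (u t / v t) = deriv l t := by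
    intro t ht
    exact div_mul_cancel₀ _ (div_pos (hup t ht) (hvp t ht)).ne'
  have hnh : ∀ t ∈ Ioo (0:ℝ) 1, Icc (0:ℝ) 1 ∈ 𝓝 t := fun t ht => Icc_mem_nhds ht.1 ht.2
  have hdw : ∀ t ∈ Ioo (0:ℝ) 1, derivWithin l (Icc 0 1) t = deriv l t := fun t ht =>
    derivWithin_of_mem_nhds (hnh t ht)
  have hc : ContinuousOn (derivWithin l (Icc 0 1)) (Icc 0 1) :=
    hl.continuousOn_derivWithin (uniqueDiffOn_Icc zero_lt_one) (by norm_num)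
  have hyd : ∀ {y : ℝ → ℝ}, ContDiffOn ℝ (⊤ : ℕ∞) y (Set.Ioo (-1 : ℝ) 2) → 
      ∀ t ∈ Icc (0:ℝ) 1, DifferentiableAt ℝ y t := fun hy t ht =>
    ((hy.differentiableOn (by simp)).differentiableAt
      (isOpen_Ioo.mem_nhds ⟨by linarith [ht.1], by linarith [ht.2]⟩))
  refine ⟨?_, ?_, ?_, ?_, ?_⟩
  · intro t ht
    rw [hcancel t ht]
    exact ((hl.differentiableOn (by norm_num)).differentiableAt (hnh t ht)).hasDerivAt
  · intro t ht
    have h1 : ContDiffOn ℝ 1 (deriv l) (Ioo 0 1) :=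
      (hl.mono Ioo_subset_Icc_self).deriv_of_isOpen isOpen_Ioo (by norm_num)
    have h2 := (h1.differentiableOn (by norm_num)).differentiableAt (isOpen_Ioo.mem_nhds ht)
    have ht' := Ioo_subset_Icc_self ht
    exact h2.div ((hyd hu t ht').div (hyd hv t ht') (hvp t ht).ne') (div_pos (hup t ht) (hvp t ht)).ne'
  · intro t ht
    rw [hcancel t ht, hdw t ht]
  · intro hv0 hu0
    have i1 : Tendsto (derivWithin l (Icc 0 1)) (𝓝[>] 0) (𝓝 (derivWithin l (Icc 0 1) 0)) := by
      have := (hc 0 (by simp)).mono_left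
        (nhdsWithin_mono _ (Ioo_subset_Icc_self : Ioo (0:ℝ) 1 ⊆ Icc 0 1))
      rwa [nhdsWithin_Ioo_eq_nhdsGT (by norm_num)] at this
    have i2 : Tendsto u (𝓝[>] 0) (𝓝 (u 0)) :=
      tendsto_nhdsWithin_of_tendsto_nhds (hyd hu 0 (by simp)).continuousAt
    have i3 : Tendsto v (𝓝[>] 0) (𝓝 (v 0)) :=
      tendsto_nhdsWithin_of_tendsto_nhds (hyd hv 0 (by simp)).continuousAt
    have := i1.mul (i3.div i2 hu0.ne')
    rw [hv0, zero_div, mul_zero] at this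
    refine this.congr' ?_
    filter_upwards [Ioo_mem_nhdsGT (zero_lt_one' ℝ)] with t ht
    rw [hdw t ht]
    simp [div_eq_mul_inv]
  · intro hv0 hu0
    have i1 : Tendsto (derivWithin l (Icc 0 1)) (𝓝[<] 1) (𝓝 (derivWithin l (Icc 0 1) 1)) := by
      have := (hc 1 (by simp)).mono_left
        (nhdsWithin_mono _ (Ioo_subset_Icc_self : Ioo (0:ℝ) 1 ⊆ Icc 0 1))
      rwa [nhdsWithin_Ioo_eq_nhdsLT (by norm_num)] at this
    have i2 : Tendsto u (𝓝[<] 1) (𝓝 (u 1)) :=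
      tendsto_nhdsWithin_of_tendsto_nhds (hyd hu 1 (by simp)).continuousAt
    have i3 : Tendsto v (𝓝[<] 1) (𝓝 (v 1)) :=
      tendsto_nhdsWithin_of_tendsto_nhds (hyd hv 1 (by simp)).continuousAt
    have := i1.mul (i3.div i2 hu0.ne')
    rw [hv0, zero_div, mul_zero] at this
    refine this.congr' ?_
    filter_upwards [Ioo_mem_nhdsLT (zero_lt_one' ℝ)] with t ht
    rw [hdw t ht]
    simp [div_eq_mul_inv]

lemma refl_deriv {f : ℝ → ℝ} {f' t : ℝ} (h : HasDerivAt f f' (1 - t)) :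
    HasDerivAt (fun s => f (1 - s)) (-f') t := by
  have h2 : HasDerivAt (fun s : ℝ => 1 - s) (-1) t := by
    simpa using (hasDerivAt_id t).const_sub 1
  have := HasDerivAt.comp t h h2
  rw [mul_neg_one] at this
  exact this

lemma refl_smooth {y : ℝ → ℝ} (hy : ContDiffOn ℝ (⊤ : ℕ∞) y (Set.Ioo (-1 : ℝ) 2)) :
    ContDiffOn ℝ (⊤ : ℕ∞) (fun s => y (1 - s)) (Set.Ioo (-1 : ℝ) 2) := by
  apply hy.comp (contDiff_const.sub contDiff_id).contDiffOn
  intro x hx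
  exact ⟨by simp; linarith [hx.2], by simp; linarith [hx.1]⟩

lemma refl_cont {l : ℝ → ℝ} (hl : ContinuousOn l (Icc 0 1)) :
    ContinuousOn (fun s => - l (1 - s)) (Icc 0 1) := by
  apply ContinuousOn.neg
  apply hl.comp (continuous_const.sub continuous_id).continuousOn
  intro x hx
  exact ⟨by simp; linarith [hx.2], by simp; linarith [hx.1]⟩

lemma refl_lim0 {w : ℝ → ℝ} (h : Tendsto w (𝓝[>] 0) (𝓝 0)) :
    Tendsto (fun s => w (1 - s)) (𝓝[<] 1) (𝓝 0) := by
  apply h.comp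
  apply tendsto_nhdsWithin_of_tendsto_nhds_of_eventually_within
  · apply tendsto_nhdsWithin_of_tendsto_nhds
    have : Continuous (fun s : ℝ => 1 - s) := by fun_prop
    simpa using this.tendsto 1
  · filter_upwards [self_mem_nhdsWithin] with t ht
    have : t < 1 := ht
    simpa using this

lemma refl_lim1 {w : ℝ → ℝ} (h : Tendsto w (𝓝[<] 1) (𝓝 0)) :
    Tendsto (fun s => w (1 - s)) (𝓝[>] 0) (𝓝 0) := by
  apply h.comp
  apply tendsto_nhdsWithin_of_tendsto_nhds_of_eventually_within
  · apply tendsto_nhdsWithin_of_tendsto_nhds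
    have : Continuous (fun s : ℝ => 1 - s) := by fun_prop
    simpa using this.tendsto 0
  · filter_upwards [self_mem_nhdsWithin] with t ht
    have : 0 < t := ht
    simpa using this


/-- uniform a priori bounds on the shooting parameters for the
truncated `SO(2)×SO(2)` system.  Here `y₁, y₂` are smooth on `(-1,2)`, positive on
`(0,1)`, with the stated parity and boundary behaviour, `φ₁ = y₁/y₂`, `φ₂ = y₂/y₁`,
`σ = y₁ y₂`, and `F` is the fixed nonnegative smooth truncation of `x ↦ x²`.
There is `R₀ > 0`, independent of `p ∈ [0,1]`, bounding `|l₁''(0)|`, `|l₂'(0)|`,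
`|l₁'(1)|`, `|l₂''(1)|` for every `C²` solution of the boundary-value problem
(one-sided derivatives at the endpoints, i.e. derivatives within `[0,1]`). -/
theorem stmt_5 (y₁ y₂ : ℝ → ℝ)
    (hy₁ : ContDiffOn ℝ (⊤ : ℕ∞) y₁ (Set.Ioo (-1 : ℝ) 2))
    (hy₂ : ContDiffOn ℝ (⊤ : ℕ∞) y₂ (Set.Ioo (-1 : ℝ) 2))
    (hy₁pos : ∀ r ∈ Set.Ioo (0 : ℝ) 1, 0 < y₁ r)
    (hy₂pos : ∀ r ∈ Set.Ioo (0 : ℝ) 1, 0 < y₂ r)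
    (h₁odd : ∀ t ∈ Set.Ioo (-1 : ℝ) 1, y₁ (-t) = - y₁ t)
    (h₁even : ∀ t ∈ Set.Ioo (-1 : ℝ) 1, y₁ (1 + t) = y₁ (1 - t))
    (h₂even : ∀ t ∈ Set.Ioo (-1 : ℝ) 1, y₂ (-t) = y₂ t)
    (h₂odd : ∀ t ∈ Set.Ioo (-1 : ℝ) 1, y₂ (1 + t) = - y₂ (1 - t))
    (hy₁'0 : deriv y₁ 0 = 1) (hy₁1 : 0 < y₁ 1) (hy₂0 : 0 < y₂ 0)
    (hy₂'1 : deriv y₂ 1 = -1)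
    (F : ℝ → ℝ) (hF : ContDiff ℝ (⊤ : ℕ∞) F) (hFnn : ∀ x, 0 ≤ F x)
    (hFsq : ∀ x : ℝ, |x| ≤ 2 → F x = x ^ 2) (hFcpt : ∀ x : ℝ, 3 ≤ |x| → F x = 0)
    (hFbd : ∀ x, F x ≤ 8) :
    ∃ R₀ : ℝ, 0 < R₀ ∧
      ∀ p ∈ Set.Icc (0 : ℝ) 1, ∀ l₁ l₂ : ℝ → ℝ,
        ContDiffOn ℝ 2 l₁ (Set.Icc 0 1) → ContDiffOn ℝ 2 l₂ (Set.Icc 0 1) →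
        (∀ t ∈ Set.Ioo (0 : ℝ) 1,
          deriv (fun s => deriv l₁ s / (y₁ s / y₂ s)) t
            = l₁ t * F (p * l₂ t + (1 - p) * Real.sin (Real.pi * t / 2)) / (y₁ t * y₂ t)) →
        (∀ t ∈ Set.Ioo (0 : ℝ) 1,
          deriv (fun s => deriv l₂ s / (y₂ s / y₁ s)) t
            = F (p * l₁ t - (1 - p) * Real.cos (Real.pi * t / 2)) * l₂ t / (y₁ t * y₂ t)) →
        l₁ 0 = -1 → derivWithin l₁ (Set.Icc 0 1) 0 = 0 → l₂ 0 = 0 →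
        l₁ 1 = 0 → l₂ 1 = 1 → derivWithin l₂ (Set.Icc 0 1) 1 = 0 →
        |derivWithin (derivWithin l₁ (Set.Icc 0 1)) (Set.Icc 0 1) 0| < R₀ ∧
        |derivWithin l₂ (Set.Icc 0 1) 0| < R₀ ∧
        |derivWithin l₁ (Set.Icc 0 1) 1| < R₀ ∧
        |derivWithin (derivWithin l₂ (Set.Icc 0 1)) (Set.Icc 0 1) 1| < R₀ := by
  have hy₁0 : y₁ 0 = 0 := by
    have := h₁odd 0 (by norm_num)
    rw [neg_zero] at this; linarith
  have hy₂1 : y₂ 1 = 0 := by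
    have := h₂odd 0 (by norm_num)
    rw [add_zero, sub_zero] at this; linarith
  have hI : ∀ t ∈ Ioo (0:ℝ) 1, 1 - t ∈ Ioo (0:ℝ) 1 := fun t ht =>
    ⟨by linarith [ht.2], by linarith [ht.1]⟩
  have hz' : deriv (fun s => y₂ (1 - s)) 0 = 1 := by
    have hd : DifferentiableAt ℝ y₂ (1 - 0) :=
      (hy₂.differentiableOn (by simp)).differentiableAt (isOpen_Ioo.mem_nhds (by norm_num))
    rw [(refl_deriv hd.hasDerivAt).deriv, sub_zero, hy₂'1, neg_neg]
  obtain ⟨R, hR, hhalf⟩ := half_aux y₁ y₂ hy₁ hy₂ hy₁pos hy₂pos hy₁0 hy₁'0 hy₂0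
  obtain ⟨R', hR', hhalf'⟩ := half_aux (fun s => y₂ (1 - s)) (fun s => y₁ (1 - s))
    (refl_smooth hy₂) (refl_smooth hy₁) (fun r hr => hy₂pos _ (hI r hr))
    (fun r hr => hy₁pos _ (hI r hr)) (by simpa using hy₂1) hz' (by simpa using hy₁1)
  refine ⟨R + R' + 1, by positivity, ?_⟩
  intro p hp l₁ l₂ hl₁ hl₂ heq₁ heq₂ hl10 hl1'0 hl20 hl11 hl21 hl2'1
  obtain ⟨a1, a2, a3, -, a5⟩ := reg_aux hl₁ hy₁ hy₂ hy₁pos hy₂pos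
  obtain ⟨b1, b2, b3, b4, -⟩ := reg_aux hl₂ hy₂ hy₁ hy₂pos hy₁pos
  have a5 := a5 hy₂1 hy₁1
  have b4 := b4 hy₁0 hy₂0
  set w₁ := fun s => deriv l₁ s / (y₁ s / y₂ s) with hw₁
  set w₂ := fun s => deriv l₂ s / (y₂ s / y₁ s) with hw₂
  have a1 : ∀ t ∈ Ioo (0:ℝ) 1, HasDerivAt l₁ (w₁ t * (y₁ t / y₂ t)) t := a1
  have b1 : ∀ t ∈ Ioo (0:ℝ) 1, HasDerivAt l₂ (w₂ t * (y₂ t / y₁ t)) t := b1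
  have a3 : ∀ t ∈ Ioo (0:ℝ) 1, derivWithin l₁ (Icc 0 1) t = w₁ t * (y₁ t / y₂ t) := a3
  have b3 : ∀ t ∈ Ioo (0:ℝ) 1, derivWithin l₂ (Icc 0 1) t = w₂ t * (y₂ t / y₁ t) := b3
  have hd₁ : ∀ t ∈ Ioo (0:ℝ) 1, HasDerivAt w₁ (l₁ t *
      F (p * l₂ t + (1 - p) * Real.sin (Real.pi * t / 2)) / (y₁ t * y₂ t)) t := by
    intro t ht
    rw [← heq₁ t ht]; exact (a2 t ht).hasDerivAt
  have hd₂ : ∀ t ∈ Ioo (0:ℝ) 1, HasDerivAt w₂ (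
      F (p * l₁ t - (1 - p) * Real.cos (Real.pi * t / 2)) * l₂ t / (y₁ t * y₂ t)) t := by
    intro t ht
    rw [← heq₂ t ht]; exact (b2 t ht).hasDerivAt
  have hb₁ : ∀ t ∈ Ioo (0:ℝ) 1, -1 ≤ l₁ t ∧ l₁ t ≤ 0 ∧ 0 ≤ w₁ t := by
    refine mp_aux (b := fun t => y₁ t / y₂ t)
      (Q := fun t => F (p * l₂ t + (1 - p) * Real.sin (Real.pi * t / 2)) / (y₁ t * y₂ t))
      hl₁.continuousOn a1 ?_ (fun t ht => div_pos (hy₁pos t ht) (hy₂pos t ht)) ?_ hl10 hl11 a5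
    · intro t ht
      have := hd₁ t ht
      rwa [mul_div_assoc] at this
    · intro t ht
      exact div_nonneg (hFnn _) (mul_pos (hy₁pos t ht) (hy₂pos t ht)).le
  have hb₂' : ∀ t ∈ Ioo (0:ℝ) 1, -1 ≤ -l₂ (1 - t) ∧ -l₂ (1 - t) ≤ 0 ∧ 0 ≤ w₂ (1 - t) := by
    refine mp_aux (l := fun t => -l₂ (1 - t)) (w := fun t => w₂ (1 - t))
      (b := fun t => y₂ (1 - t) / y₁ (1 - t))
      (Q := fun t => F (p * l₁ (1 - t) - (1 - p) * Real.cos (Real.pi * (1 - t) / 2)) /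
        (y₁ (1 - t) * y₂ (1 - t)))
      (refl_cont hl₂.continuousOn) ?_ ?_
      (fun t ht => div_pos (hy₂pos _ (hI t ht)) (hy₁pos _ (hI t ht))) ?_
      (by simp [hl21]) (by simp [hl20]) (refl_lim0 b4)
    · intro t ht
      have := (refl_deriv (b1 _ (hI t ht))).neg
      rwa [neg_neg] at this
    · intro t ht
      have := refl_deriv (hd₂ _ (hI t ht))
      convert this using 1
      ring
    · intro t ht
      exact div_nonneg (hFnn _) (mul_pos (hy₁pos _ (hI t ht)) (hy₂pos _ (hI t ht))).le
  have hb₂ : ∀ t ∈ Ioo (0:ℝ) 1, 0 ≤ l₂ t ∧ l₂ t ≤ 1 ∧ 0 ≤ w₂ t := by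
    intro t ht
    obtain ⟨e1, e2, e3⟩ := hb₂' (1 - t) (hI t ht)
    rw [sub_sub_cancel] at e1 e2 e3
    exact ⟨by linarith, by linarith, e3⟩
  have hp0 := hp.1
  have hp1 : 0 ≤ 1 - p := by linarith [hp.2]
  have hd₁s : ∀ t ∈ Ioo (0:ℝ) 1, HasDerivAt w₁ (l₁ t *
      (p * l₂ t + (1 - p) * Real.sin (Real.pi * t / 2))^2 / (y₁ t * y₂ t)) t := by
    intro t ht
    rw [← hFsq]
    · exact hd₁ t ht
    · obtain ⟨e1, e2, e3⟩ := hb₂ t ht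
      have s1 := Real.sin_le_one (Real.pi * t / 2)
      have s2 := Real.neg_one_le_sin (Real.pi * t / 2)
      rw [abs_le]; constructor <;> nlinarith
  have hd₂s : ∀ t ∈ Ioo (0:ℝ) 1, HasDerivAt w₂ (
      (p * l₁ t - (1 - p) * Real.cos (Real.pi * t / 2))^2 * l₂ t / (y₁ t * y₂ t)) t := by
    intro t ht
    rw [← hFsq]
    · exact hd₂ t ht
    · obtain ⟨e1, e2, e3⟩ := hb₁ t ht
      have s1 := Real.cos_le_one (Real.pi * t / 2)
      have s2 := Real.neg_one_le_cos (Real.pi * t / 2)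
      rw [abs_le]; constructor <;> nlinarith
  have H := hhalf p hp l₁ l₂ w₁ w₂ hl₁.continuousOn hl₂.continuousOn a1 b1 hd₁s hd₂s hb₁ hb₂
    hl10 hl20 b4
  have H' := hhalf' p hp (fun s => -l₂ (1 - s)) (fun s => -l₁ (1 - s)) (fun s => w₂ (1 - s))
    (fun s => w₁ (1 - s)) (refl_cont hl₂.continuousOn) (refl_cont hl₁.continuousOn)
    (fun t ht => by
      have := (refl_deriv (b1 _ (hI t ht))).neg
      rwa [neg_neg] at this)
    (fun t ht => by
      have := (refl_deriv (a1 _ (hI t ht))).neg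
      rwa [neg_neg] at this)
    (fun t ht => by
      have := refl_deriv (hd₂s _ (hI t ht))
      have hc : Real.cos (Real.pi * (1 - t) / 2) = Real.sin (Real.pi * t / 2) := by
        rw [← Real.cos_pi_div_two_sub]; congr 1; ring
      rw [hc] at this
      convert this using 1
      ring)
    (fun t ht => by
      have := refl_deriv (hd₁s _ (hI t ht))
      have hc : Real.sin (Real.pi * (1 - t) / 2) = Real.cos (Real.pi * t / 2) := by
        rw [← Real.sin_pi_div_two_sub]; congr 1; ring
      rw [hc] at this
      convert this using 1
      ring)
    hb₂'
    (fun t ht => by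
      obtain ⟨e1, e2, e3⟩ := hb₁ (1 - t) (hI t ht)
      exact ⟨by linarith, by linarith, e3⟩)
    (by simp [hl21]) (by simp [hl11]) (refl_lim1 a5)
  have hin : ∀ t ∈ Ioc (0:ℝ) (1/2), t ∈ Ioo (0:ℝ) 1 := fun t ht => ⟨ht.1, by linarith [ht.2]⟩
  have c1 : |derivWithin (derivWithin l₁ (Icc 0 1)) (Icc 0 1) 0| ≤ R := by
    apply dw_bound (by simp) hR.le
    filter_upwards [ev0] with t ht
    have ht' := hin t ht
    rw [hl1'0, a3 t ht', sub_zero, sub_zero, abs_of_pos ht.1, abs_of_nonneg]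
    · exact (H t ht).2
    · exact mul_nonneg (hb₁ t ht').2.2 (div_pos (hy₁pos t ht') (hy₂pos t ht')).le
  have c2 : |derivWithin l₂ (Icc 0 1) 0| ≤ R := by
    apply dw_bound (by simp) hR.le
    filter_upwards [ev0] with t ht
    have ht' := hin t ht
    rw [hl20, sub_zero, sub_zero, abs_of_pos ht.1, abs_of_nonneg (hb₂ t ht').1]
    exact (H t ht).1
  have c3 : |derivWithin l₁ (Icc 0 1) 1| ≤ R' := by
    apply dw_bound (by simp) hR'.le
    filter_upwards [ev1] with t ht
    have ht' := hI _ (hin _ ht)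
    have h1 := (H' _ ht).1
    rw [sub_sub_cancel] at ht'
    simp only [sub_sub_cancel] at h1
    rw [hl11, sub_zero, abs_of_nonpos (hb₁ t ht').2.1, abs_sub_comm, abs_of_pos ht.1]
    exact h1
  have c4 : |derivWithin (derivWithin l₂ (Icc 0 1)) (Icc 0 1) 1| ≤ R' := by
    apply dw_bound (by simp) hR'.le
    filter_upwards [ev1] with t ht
    have ht' := hI _ (hin _ ht)
    have h1 := (H' _ ht).2
    rw [sub_sub_cancel] at ht'
    simp only [sub_sub_cancel] at h1
    rw [hl2'1, sub_zero, b3 t ht', abs_sub_comm, abs_of_pos ht.1, abs_of_nonneg]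
    · exact h1
    · exact mul_nonneg (hb₂ t ht').2.2 (div_pos (hy₂pos t ht') (hy₁pos t ht')).le
  refine ⟨?_, ?_, ?_, ?_⟩ <;> linarith
end
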